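/- Assume the normalized setup with n ≥ 3, p = 1/(n−2) and T ≤ 1. Then there exist universal constants α > 0 and γ > 0 such that for every compact set K contained in the open set {x ∈ Ω : u₀(x) < 1} there is a constant C(K), depending only on the universal constants and on the distance from K to ∂{u₀ < 1}, such that u₀ is differentiable at every point of K and |∇u₀(x) − ∇u₀(y)| ≤ C(K) · |log |x − y||^{−α} · T^{−γ} for all x, y ∈ K with 0 < |x − y| ≤ 1/2. -/

import Mathlib

open Set Metric MeasureTheory
open scoped RealInnerProductSpace

noncomputable section

abbrev E (n : ℕ) := EuclideanSpace ℝ (Fin n)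

variable {n : ℕ}

/-- The time derivative `∂ₜφ(x,t)`. -/
noncomputable def timeDeriv (φ : E n → ℝ → ℝ) (x : E n) (t : ℝ) : ℝ :=
  deriv (φ x) t

/-- The spatial Hessian matrix `D²φ(x,t)` (in the standard coordinates). -/
noncomputable def hessMatrix (φ : E n → ℝ → ℝ) (x : E n) (t : ℝ) :
    Matrix (Fin n) (Fin n) ℝ :=
  Matrix.of fun i j =>
    fderiv ℝ (fun y => fderiv ℝ (fun z => φ z t) y (EuclideanSpace.single j (1:ℝ))) x
      (EuclideanSpace.single i (1:ℝ))

/-- `φ` is an admissible test function near `(x₀,t₀)`: C² in `x` and C¹ in `t` nearby. -/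
def IsTestAt (φ : E n → ℝ → ℝ) (x₀ : E n) (t₀ : ℝ) : Prop :=
  ∃ ε > (0:ℝ),
    (∀ t ∈ ball t₀ ε, ContDiffOn ℝ 2 (fun x => φ x t) (ball x₀ ε)) ∧
    (∀ x ∈ ball x₀ ε, ContDiffOn ℝ 1 (fun t => φ x t) (ball t₀ ε))

/-- `u - φ` attains a local maximum at `(x₀,t₀)` among times `t ≤ t₀`,
relative to `closure Ω × [t₁,t₂]`. -/
def LocalMaxBelow (Ω : Set (E n)) (t₁ t₂ : ℝ) (u φ : E n → ℝ → ℝ)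
    (x₀ : E n) (t₀ : ℝ) : Prop :=
  ∃ ε > (0:ℝ), ∀ x ∈ closure Ω, ∀ t ∈ Icc t₁ t₂, t ≤ t₀ →
    dist x x₀ < ε → dist t t₀ < ε →
    u x t - φ x t ≤ u x₀ t₀ - φ x₀ t₀

/-- `u - φ` attains a local minimum at `(x₀,t₀)` among times `t ≤ t₀`. -/
def LocalMinBelow (Ω : Set (E n)) (t₁ t₂ : ℝ) (u φ : E n → ℝ → ℝ)
    (x₀ : E n) (t₀ : ℝ) : Prop :=
  ∃ ε > (0:ℝ), ∀ x ∈ closure Ω, ∀ t ∈ Icc t₁ t₂, t ≤ t₀ →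
    dist x x₀ < ε → dist t t₀ < ε →
    u x₀ t₀ - φ x₀ t₀ ≤ u x t - φ x t

/-- Viscosity subsolution of `u_t ≤ Λ (det D²u)^p` on `Ω × [t₁,t₂]`. -/
def ViscSubsolution (Lam p : ℝ) (Ω : Set (E n)) (t₁ t₂ : ℝ) (u : E n → ℝ → ℝ) : Prop :=
  ∀ x₀ ∈ Ω, ∀ t₀ ∈ Ioc t₁ t₂, ∀ φ : E n → ℝ → ℝ, IsTestAt φ x₀ t₀ →
    LocalMaxBelow Ω t₁ t₂ u φ x₀ t₀ →
    timeDeriv φ x₀ t₀ ≤ Lam * max (hessMatrix φ x₀ t₀).det 0 ^ p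

/-- Viscosity supersolution of `u_t ≥ λ (det D²u)^p` on `Ω × [t₁,t₂]`. -/
def ViscSupersolution (lam p : ℝ) (Ω : Set (E n)) (t₁ t₂ : ℝ) (u : E n → ℝ → ℝ) : Prop :=
  ∀ x₀ ∈ Ω, ∀ t₀ ∈ Ioc t₁ t₂, ∀ φ : E n → ℝ → ℝ, IsTestAt φ x₀ t₀ →
    LocalMinBelow Ω t₁ t₂ u φ x₀ t₀ →
    (hessMatrix φ x₀ t₀).PosSemidef →
    lam * (hessMatrix φ x₀ t₀).det ^ p ≤ timeDeriv φ x₀ t₀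

/-- The regularity/structure assumptions: continuity on `closure Ω × [t₁,t₂]`,
convexity in `x`, monotonicity in `t`. -/
structure ParabolicRegular (Ω : Set (E n)) (t₁ t₂ : ℝ) (u : E n → ℝ → ℝ) : Prop where
  cont : ContinuousOn (fun q : E n × ℝ => u q.1 q.2) (closure Ω ×ˢ Icc t₁ t₂)
  conv : ∀ t ∈ Icc t₁ t₂, ConvexOn ℝ (closure Ω) (fun x => u x t)
  mono : ∀ x ∈ closure Ω, ∀ s ∈ Icc t₁ t₂, ∀ t ∈ Icc t₁ t₂, s ≤ t → u x s ≤ u x t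

/-- Viscosity solution of `λ (det D²u)^p ≤ u_t ≤ Λ (det D²u)^p` on `Ω × [t₁,t₂]`. -/
def ViscositySolution (lam Lam p : ℝ) (Ω : Set (E n)) (t₁ t₂ : ℝ) (u : E n → ℝ → ℝ) : Prop :=
  ParabolicRegular Ω t₁ t₂ u ∧ ViscSubsolution Lam p Ω t₁ t₂ u ∧
    ViscSupersolution lam p Ω t₁ t₂ u

/-- `w` is `C^{1,α}` at `x₀` (relative to the set `D`) with some finite constant. -/
def C1AlphaAt (w : E n → ℝ) (D : Set (E n)) (α : ℝ) (x₀ : E n) : Prop :=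
  ∃ C a : ℝ, ∃ q : E n, ∀ x ∈ D, |w x - (a + ⟪q, x - x₀⟫)| ≤ C * ‖x - x₀‖ ^ (1 + α)

/-- `w` is `C^{1,α}` at `x₀` in the direction `e` (relative to the set `D`). -/
def C1AlphaDirAt (w : E n → ℝ) (D : Set (E n)) (α : ℝ) (x₀ e : E n) : Prop :=
  ∃ C a q : ℝ, ∀ s : ℝ, x₀ + s • e ∈ D →
    |w (x₀ + s • e) - (a + q * s)| ≤ C * |s| ^ (1 + α)

/-- A convex set `S` is `d`-balanced with respect to `x₀`. -/
def DBalanced (d : ℝ) (S : Set (E n)) (x₀ : E n) : Prop :=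
  ∃ A : E n →ₗ[ℝ] E n, Function.Bijective A ∧
    ball (0 : E n) 1 ⊆ A '' ((fun y => y - x₀) '' S) ∧
    A '' ((fun y => y - x₀) '' S) ⊆ ball (0 : E n) d

/-- `x₀` is an extremal point of the convex set `D`. -/
def ExtremalPoint (D : Set (E n)) (x₀ : E n) : Prop :=
  ¬ ∃ y ∈ closure D, ∃ z ∈ closure D, ∃ t : ℝ,
      0 < t ∧ t < 1 ∧ y ≠ z ∧ x₀ = t • y + (1 - t) • z

/-- The distance between two sets. -/
noncomputable def setDist {n : ℕ} (A B : Set (E n)) : ℝ :=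
  sInf (Set.image2 dist A B)

/-- Test functions that are affine plus a time-dependent multiple of a quadratic form. -/
def quadTest (c : ℝ) (q z : E n) (M : E n →L[ℝ] E n) (b k : ℝ → ℝ) : E n → ℝ → ℝ :=
  fun y t => c + ⟪q, y⟫ + b t + k t * ‖M (y - z)‖ ^ 2

lemma quadTest_hasFDerivAt (c : ℝ) (q z : E n) (M : E n →L[ℝ] E n) (b k : ℝ → ℝ) (t : ℝ)
    (y : E n) :
    HasFDerivAt (fun y => quadTest c q z M b k y t)
      (innerSL ℝ q + (2 * k t) • (innerSL ℝ (M (y - z))).comp M) y := by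
  have h1 : HasFDerivAt (fun y : E n => M (y - z)) M y :=
    M.hasFDerivAt.comp y ((hasFDerivAt_id y).sub_const z)
  have h2 := (h1.norm_sq).const_mul (k t)
  have h3 : HasFDerivAt (fun y : E n => c + ⟪q, y⟫ + b t) (innerSL ℝ q) y :=
    (((innerSL ℝ q).hasFDerivAt).const_add c).add_const (b t)
  refine (h3.add h2).congr_fderiv ?_
  ext v
  simp
  ring

lemma hessMatrix_quadTest (c : ℝ) (q z : E n) (M : E n →L[ℝ] E n) (b k : ℝ → ℝ) (t : ℝ)
    (x : E n) :
    hessMatrix (quadTest c q z M b k) x t =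
      (2 * k t) • ((LinearMap.toMatrix (EuclideanSpace.basisFun (Fin n) ℝ).toBasis
          (EuclideanSpace.basisFun (Fin n) ℝ).toBasis (M : E n →ₗ[ℝ] E n)).transpose *
        LinearMap.toMatrix (EuclideanSpace.basisFun (Fin n) ℝ).toBasis
          (EuclideanSpace.basisFun (Fin n) ℝ).toBasis (M : E n →ₗ[ℝ] E n)) := by
  ext i j
  have h0 : (fun y => fderiv ℝ (fun z' => quadTest c q z M b k z' t) y
        (EuclideanSpace.single j (1:ℝ))) =
      fun y => ⟪q, EuclideanSpace.single j (1:ℝ)⟫ +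
        (2 * k t) * ⟪M (y - z), M (EuclideanSpace.single j (1:ℝ))⟫ := by
    funext y
    rw [(quadTest_hasFDerivAt c q z M b k t y).fderiv]
    simp [inner_sub_left]
  have h1 : HasFDerivAt (fun y : E n => M (y - z)) M x :=
    M.hasFDerivAt.comp x ((hasFDerivAt_id x).sub_const z)
  have h2 := ((h1.inner ℝ (hasFDerivAt_const (M (EuclideanSpace.single j (1:ℝ))) x)).const_mul
    (2 * k t)).const_add ⟪q, EuclideanSpace.single j (1:ℝ)⟫
  simp only [hessMatrix, Matrix.of_apply, h0]
  rw [h2.fderiv]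
  simp [Matrix.mul_apply, LinearMap.toMatrix_apply, PiLp.inner_apply, mul_comm]

lemma det_hessMatrix_quadTest (c : ℝ) (q z : E n) (M : E n →L[ℝ] E n) (b k : ℝ → ℝ) (t : ℝ)
    (x : E n) :
    (hessMatrix (quadTest c q z M b k) x t).det =
      (2 * k t) ^ n * LinearMap.det (M : E n →ₗ[ℝ] E n) ^ 2 := by
  rw [hessMatrix_quadTest, Matrix.det_smul, Matrix.det_mul, Matrix.det_transpose,
    LinearMap.det_toMatrix]
  simp [sq]

lemma posSemidef_hessMatrix_quadTest (c : ℝ) (q z : E n) (M : E n →L[ℝ] E n) (b k : ℝ → ℝ)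
    (t : ℝ) (x : E n) (hk : 0 ≤ k t) :
    (hessMatrix (quadTest c q z M b k) x t).PosSemidef := by
  rw [hessMatrix_quadTest]
  refine Matrix.PosSemidef.smul ?_ (by positivity)
  simpa using Matrix.posSemidef_conjTranspose_mul_self (LinearMap.toMatrix
    (EuclideanSpace.basisFun (Fin n) ℝ).toBasis
          (EuclideanSpace.basisFun (Fin n) ℝ).toBasis (M : E n →ₗ[ℝ] E n))

lemma isTestAt_quadTest (c : ℝ) (q z : E n) (M : E n →L[ℝ] E n) (b k : ℝ → ℝ)
    (x : E n) (t ε : ℝ) (hε : 0 < ε) (hb : ContDiffOn ℝ 1 b (ball t ε))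
    (hk : ContDiffOn ℝ 1 k (ball t ε)) : IsTestAt (quadTest c q z M b k) x t := by
  refine ⟨ε, hε, fun s _ => ?_, fun y _ => ?_⟩
  · apply ContDiff.contDiffOn
    unfold quadTest
    have h : ContDiff ℝ 2 (fun y : E n => M (y - z)) :=
      M.contDiff.comp (contDiff_id.sub contDiff_const)
    have h' := h.norm_sq ℝ
    have h'' : ContDiff ℝ 2 (fun y : E n => ⟪q, y⟫) := (innerSL ℝ q).contDiff
    fun_prop
  · unfold quadTest
    exact (contDiffOn_const.add hb).add (hk.mul contDiffOn_const)

lemma timeDeriv_quadTest (c : ℝ) (q z : E n) (M : E n →L[ℝ] E n) (b k : ℝ → ℝ)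
    (x : E n) (t b' k' : ℝ) (hb : HasDerivAt b b' t) (hk : HasDerivAt k k' t) :
    timeDeriv (quadTest c q z M b k) x t = b' + k' * ‖M (x - z)‖ ^ 2 := by
  have := (hb.const_add (c + ⟪q, x⟫)).add (hk.mul_const (‖M (x - z)‖ ^ 2))
  exact this.deriv

/-- The strict inequality violated by the lower barrier at an interior contact point. -/
lemma rise_aux {m : ℕ} {lam p G r D K : ℝ} (hnm : m + 2 = n) (hm : 0 < m) (hp : p = (m : ℝ)⁻¹)
    (hlam : 0 < lam) (hG : 0 < G) (hr : 0 < r) (hD : D ≠ 0)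
    (hK : K ^ 2 * D ^ 2 = (m / lam) ^ m) (hGK : G ^ 2 * r ^ m = K ^ 2) (a : ℝ) :
    -2 * (-(m / 2 : ℝ) * G / r) + -(m / 2 : ℝ) * G / r * a ^ 2
      < lam * ((2 * G) ^ n * D ^ 2) ^ p := by
  have hm' : (0:ℝ) < m := by exact_mod_cast hm
  have hle : -2 * (-(m / 2 : ℝ) * G / r) + -(m / 2 : ℝ) * G / r * a ^ 2 ≤ m * G / r := by
    have : 0 ≤ (m / 2 : ℝ) * G / r * a ^ 2 := by positivity
    have e1 : -2 * (-(m / 2 : ℝ) * G / r) = m * G / r := by ring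
    have e2 : -(m / 2 : ℝ) * G / r * a ^ 2 = - ((m / 2) * G / r * a ^ 2) := by ring
    rw [e1, e2]; linarith
  have hstrict : (m * G / (lam * r)) ^ m < (2 * G) ^ n * D ^ 2 := by
    have h1 : (m * G / (lam * r)) ^ m = G ^ m * ((m / lam) ^ m / r ^ m) := by
      rw [← div_pow, ← mul_pow]; congr 1; field_simp
    have h2 : (m / lam) ^ m / r ^ m = G ^ 2 * D ^ 2 := by
      rw [← hK, ← hGK]; field_simp
    have h3 : (2 * G) ^ n * D ^ 2 = 2 ^ n * (G ^ m * (G ^ 2 * D ^ 2)) := by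
      rw [← hnm]; ring
    rw [h1, h2, h3]
    have h4 : (1:ℝ) < 2 ^ n := one_lt_pow₀ (by norm_num) (by omega)
    exact lt_mul_of_one_lt_left (by positivity) h4
  have hfin : m * G / (lam * r) < ((2 * G) ^ n * D ^ 2) ^ p := by
    have h1 : m * G / (lam * r) = ((m * G / (lam * r)) ^ m) ^ p := by
      rw [hp, Real.pow_rpow_inv_natCast (by positivity) hm.ne']
    rw [h1]
    exact Real.rpow_lt_rpow (by positivity) hstrict (by rw [hp]; positivity)
  have : lam * (m * G / (lam * r)) = m * G / r := by field_simp
  have h6 := mul_lt_mul_of_pos_left hfin hlam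
  linarith

/-- Barrier from below: the height of `u(·,t)` below a plane decays at a definite rate. -/
lemma ParabolicRegular.rise {m : ℕ} {lam p : ℝ} {Ω : Set (E n)} {T : ℝ} {u : E n → ℝ → ℝ}
    (hnm : m + 2 = n) (hm : 0 < m) (hp : p = (m : ℝ)⁻¹) (hlam : 0 < lam)
    (hbd : Bornology.IsBounded Ω)
    (hreg : ParabolicRegular Ω (-T) 0 u) (hsup : ViscSupersolution lam p Ω (-T) 0 u)
    {s t : ℝ} (hs : -T ≤ s) (hst : s < t) (ht : t ≤ 0)
    (c : ℝ) (q z : E n) (M : E n →L[ℝ] E n) (hM : LinearMap.det (M : E n →ₗ[ℝ] E n) ≠ 0)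
    (hsec : ∀ y ∈ closure Ω, u y s < c + ⟪q, y⟫ → y ∈ Ω ∧ ‖M (y - z)‖ ≤ 1)
    {y : E n} (hy : y ∈ closure Ω) (hpos : u y t < c + ⟪q, y⟫) :
    (c + ⟪q, y⟫ - u y t) ^ 2 * (t - s) ^ m * LinearMap.det (M : E n →ₗ[ℝ] E n) ^ 2
      ≤ 4 * (m / lam) ^ m := by
  set D := LinearMap.det (M : E n →ₗ[ℝ] E n) with hD
  have hm' : (0:ℝ) < m := by exact_mod_cast hm
  set K : ℝ := Real.sqrt ((m / lam) ^ m / D ^ 2) with hK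
  have hD2 : 0 < D ^ 2 := by positivity
  have hKpos : 0 < K := Real.sqrt_pos.2 (by positivity)
  have hKsq : K ^ 2 * D ^ 2 = (m / lam) ^ m := by
    rw [hK, Real.sq_sqrt (by positivity)]; field_simp
  set g : ℝ → ℝ := fun r => K * (r - s) ^ (-(m / 2 : ℝ)) with hg
  have hgpos : ∀ r, s < r → 0 < g r := fun r hr =>
    mul_pos hKpos (Real.rpow_pos_of_pos (by linarith) _)
  have hgsq : ∀ r, s < r → g r ^ 2 * (r - s) ^ m = K ^ 2 := by
    intro r hr
    have h0 : 0 < r - s := by linarith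
    simp only [hg, mul_pow]
    rw [← Real.rpow_natCast (r - s) m, ← Real.rpow_natCast (_ ^ (-(m / 2 : ℝ))) 2,
      ← Real.rpow_mul h0.le, mul_assoc, ← Real.rpow_add h0]
    have : -((m:ℝ) / 2) * ((2:ℕ):ℝ) + m = 0 := by push_cast; ring
    rw [this, Real.rpow_zero, mul_one]
  have hgder : ∀ r, s < r → HasDerivAt g (-(m / 2) * g r / (r - s)) r := by
    intro r hr
    have h0 : 0 < r - s := by linarith
    have h1 : HasDerivAt (fun r : ℝ => r - s) 1 r := (hasDerivAt_id r).sub_const s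
    have h2 := (h1.rpow_const (p := -(m / 2 : ℝ)) (Or.inl h0.ne')).const_mul K
    refine h2.congr_deriv ?_
    rw [Real.rpow_sub_one h0.ne']
    simp only [hg]; ring
  have hgcont : ∀ r, s < r → ContDiffAt ℝ 1 g r := by
    intro r hr
    have h0 : r - s ≠ 0 := by linarith
    exact contDiffAt_const.mul ((contDiffAt_id.sub contDiffAt_const).rpow_const_of_ne h0)
  have hcpt : IsCompact (closure Ω) := hbd.isCompact_closure
  suffices hmain : c + ⟪q, y⟫ - 2 * g t ≤ u y t by
    have h1 : c + ⟪q, y⟫ - u y t ≤ 2 * g t := by linarith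
    have h2 : 0 < c + ⟪q, y⟫ - u y t := by linarith
    have h3 : (c + ⟪q, y⟫ - u y t) ^ 2 ≤ (2 * g t) ^ 2 := by gcongr
    have h4 : 0 < t - s := by linarith
    calc _ ≤ (2 * g t) ^ 2 * (t - s) ^ m * D ^ 2 := by gcongr
      _ = 4 * (g t ^ 2 * (t - s) ^ m) * D ^ 2 := by ring
      _ = 4 * (m / lam) ^ m := by rw [hgsq t hst, mul_assoc, hKsq]
  have hyin : u y s < c + ⟪q, y⟫ :=
    lt_of_le_of_lt (hreg.mono y hy s ⟨hs, by linarith⟩ t ⟨by linarith, ht⟩ hst.le) hpos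
  by_contra hcon
  push Not at hcon
  -- choose the starting time
  have hlow : ∃ B : ℝ, ∀ x ∈ closure Ω, c + ⟪q, x⟫ - u x s ≤ B := by
    have hc : ContinuousOn (fun x => c + ⟪q, x⟫ - u x s) (closure Ω) := by
      have : ContinuousOn (fun x => u x s) (closure Ω) :=
        hreg.cont.comp (f := fun x => (x, s)) (by fun_prop)
          (fun x hx => ⟨hx, hs, by linarith⟩)
      exact (by fun_prop : ContinuousOn (fun x : E n => c + ⟪q, x⟫) (closure Ω)).sub this
    obtain ⟨B, hB⟩ := hcpt.bddAbove_image hc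
    exact ⟨B, fun x hx => hB ⟨x, hx, rfl⟩⟩
  obtain ⟨B, hB⟩ := hlow
  obtain ⟨δ, hδ0, hδt, hδB⟩ : ∃ δ > 0, s + δ ≤ t ∧ B ≤ g (s + δ) := by
    have h0 : Filter.Tendsto (fun δ : ℝ => K * δ ^ (-(m / 2 : ℝ))) (nhdsWithin 0 (Ioi 0))
        Filter.atTop :=
      (tendsto_rpow_neg_nhdsGT_zero (by linarith)).const_mul_atTop hKpos
    have h1 := h0.eventually_ge_atTop B
    have h2 : ∀ᶠ δ : ℝ in nhdsWithin 0 (Ioi 0), δ < t - s :=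
      nhdsWithin_le_nhds (Iio_mem_nhds (by linarith))
    obtain ⟨δ, ⟨h3, h4⟩, h5⟩ := ((h1.and h2).and self_mem_nhdsWithin).exists
    exact ⟨δ, h5, by linarith, by simpa [hg] using h3⟩
  set φ := quadTest c q z M (fun r => -2 * g r) g with hφ
  set Q : Set (E n × ℝ) := (closure Ω ∩ {x | ‖M (x - z)‖ ≤ 1}) ×ˢ Icc (s + δ) t with hQ
  have hQc : IsCompact Q := by
    refine IsCompact.prod (hcpt.inter_right ?_) isCompact_Icc
    exact isClosed_le (by fun_prop) continuous_const
  have hφval : ∀ x r, φ x r = c + ⟪q, x⟫ - g r * (2 - ‖M (x - z)‖ ^ 2) := by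
    intro x r; simp only [hφ, quadTest]; ring
  have hcont : ContinuousOn (fun w : E n × ℝ => u w.1 w.2 - φ w.1 w.2) Q := by
    have h1 : ContinuousOn (fun w : E n × ℝ => u w.1 w.2) Q :=
      hreg.cont.mono (fun w hw => ⟨hw.1.1, by linarith [hw.2.1], by linarith [hw.2.2]⟩)
    have h2 : ContinuousOn (fun w : E n × ℝ => g w.2) Q := by
      have : ContinuousOn g (Ioi s) := fun r hr => (hgder r hr).continuousAt.continuousWithinAt
      exact this.comp continuousOn_snd (fun w hw => by
        have := hw.2.1; simp only [mem_Ioi]; linarith)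
    simp only [hφval]
    have h3 : ContinuousOn (fun w : E n × ℝ => c + ⟪q, w.1⟫) Q := by
      clear h1 h2; clear_value Q; fun_prop
    have h4 : ContinuousOn (fun w : E n × ℝ => 2 - ‖M (w.1 - z)‖ ^ 2) Q := by
      clear h1 h2; clear_value Q; fun_prop
    exact h1.sub (h3.sub (h2.mul h4))
  have hyQ : (y, t) ∈ Q := ⟨⟨hy, (hsec y hy hyin).2⟩, hδt, le_rfl⟩
  obtain ⟨⟨x₀, t₀⟩, hxQ, hmin⟩ := hQc.exists_isMinOn ⟨_, hyQ⟩ hcont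
  have hneg : u x₀ t₀ - φ x₀ t₀ < 0 := by
    have h1 := hmin hyQ
    simp only [mem_ofPred_eq] at h1
    refine lt_of_le_of_lt h1 ?_
    rw [hφval]
    have := hgpos t hst
    nlinarith [sq_nonneg ‖M (y - z)‖]
  obtain ⟨⟨hx₀S, hx₀M⟩, ht₀l, ht₀r⟩ := hxQ
  simp only [mem_ofPred_eq] at hx₀M ht₀l ht₀r
  have hst₀ : s < t₀ := by linarith
  have hMsq : ‖M (x₀ - z)‖ ^ 2 ≤ 1 := pow_le_one₀ (norm_nonneg _) hx₀M
  have hx₀s : u x₀ s < c + ⟪q, x₀⟫ := by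
    have h1 := hreg.mono x₀ hx₀S s ⟨hs, by linarith⟩ t₀ ⟨by linarith, by linarith⟩ hst₀.le
    rw [hφval] at hneg
    have := hgpos t₀ hst₀
    nlinarith
  have hx₀Ω := (hsec x₀ hx₀S hx₀s).1
  have ht₀ne : s + δ < t₀ := by
    rcases ht₀l.lt_or_eq with h | h
    · exact h
    · exfalso
      have h1 := hreg.mono x₀ hx₀S s ⟨hs, by linarith⟩ t₀ ⟨by linarith, by linarith⟩ hst₀.le
      have h2 := hB x₀ hx₀S
      rw [h] at hδB
      rw [hφval] at hneg
      have := hgpos t₀ hst₀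
      nlinarith
  -- neighbourhood in space
  obtain ⟨ε₁, hε₁, hball⟩ : ∃ ε > 0, ∀ x ∈ closure Ω, dist x x₀ < ε → u x s < c + ⟪q, x⟫ := by
    have hc : ContinuousOn (fun x => u x s - (c + ⟪q, x⟫)) (closure Ω) := by
      have : ContinuousOn (fun x => u x s) (closure Ω) :=
        hreg.cont.comp (f := fun x => (x, s)) (by fun_prop)
          (fun x hx => ⟨hx, hs, by linarith⟩)
      exact this.sub (by fun_prop : ContinuousOn (fun x : E n => c + ⟪q, x⟫) (closure Ω))
    have h1 := (hc x₀ hx₀S).eventually_lt_const (u := 0) (by linarith)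
    obtain ⟨ε, hε, h2⟩ := Metric.mem_nhdsWithin_iff.1 h1
    exact ⟨ε, hε, fun x hx hd => by have := h2 ⟨hd, hx⟩; simp only [mem_ofPred_eq] at this; linarith⟩
  have hlocal : LocalMinBelow Ω (-T) 0 u φ x₀ t₀ := by
    refine ⟨min ε₁ (t₀ - (s + δ)), lt_min hε₁ (by linarith), fun x hx r hr hrt hd hdr => ?_⟩
    have h1 := hball x hx (lt_of_lt_of_le hd (min_le_left _ _))
    have h2 := (hsec x hx h1).2
    have h3 := lt_of_lt_of_le hdr (min_le_right _ _)
    rw [Real.dist_eq, abs_lt] at h3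
    exact hmin (show (x, r) ∈ Q from ⟨⟨hx, h2⟩, by simp only; linarith, by simp only; linarith⟩)
  have hopen : ContDiffOn ℝ 1 g (ball t₀ (t₀ - s)) := by
    intro r hr
    rw [mem_ball, Real.dist_eq, abs_lt] at hr
    exact (hgcont r (by linarith)).contDiffWithinAt
  have key := hsup x₀ hx₀Ω t₀ ⟨by linarith, by linarith⟩ φ
    (isTestAt_quadTest c q z M _ g x₀ t₀ (t₀ - s) (by linarith) (contDiffOn_const.mul hopen) hopen)
    hlocal (posSemidef_hessMatrix_quadTest c q z M _ g t₀ x₀ (hgpos t₀ hst₀).le)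
  rw [timeDeriv_quadTest c q z M _ g x₀ t₀ _ _ ((hgder t₀ hst₀).const_mul (-2)) (hgder t₀ hst₀),
    det_hessMatrix_quadTest, ← hD] at key
  have hr0 : 0 < t₀ - s := by linarith
  exact absurd key (not_le.2 (rise_aux hnm hm hp hlam (hgpos t₀ hst₀) hr0 hM hKsq (hgsq t₀ hst₀) _))

/-- The strict inequality violated by the upper barrier at an interior contact point. -/
lemma drop_aux {m : ℕ} {Lam p H r D : ℝ} (hnm : m + 2 = n) (hm : 0 < m) (hp : p = (m : ℝ)⁻¹)
    (hLam : 0 < Lam) (hH : 0 < H) (hr : 0 < r)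
    (hc : (2 * Lam) ^ m * 4 ^ n * r ^ m * H ^ 2 * D ^ 2 < 1) :
    Lam * max ((2 * (2 * H)) ^ n * D ^ 2) 0 ^ p < H / (2 * r) := by
  have hdet : (2 * (2 * H)) ^ n * D ^ 2 < (H / (2 * r * Lam)) ^ m := by
    rw [div_pow, lt_div_iff₀ (by positivity)]
    calc _ = ((2 * Lam) ^ m * 4 ^ n * r ^ m * H ^ 2 * D ^ 2) * H ^ m := by
          rw [← hnm]; ring
      _ < 1 * H ^ m := by gcongr
      _ = _ := one_mul _
  rw [max_eq_left (by positivity)]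
  have h1 : H / (2 * r * Lam) = ((H / (2 * r * Lam)) ^ m) ^ p := by
    rw [hp, Real.pow_rpow_inv_natCast (by positivity) hm.ne']
  have h2 : ((2 * (2 * H)) ^ n * D ^ 2) ^ p < H / (2 * r * Lam) := by
    rw [h1]
    exact Real.rpow_lt_rpow (by positivity) hdet (by rw [hp]; positivity)
  calc _ < Lam * (H / (2 * r * Lam)) := by gcongr
    _ = _ := by field_simp

lemma ParabolicRegular.continuousOn_slice {Ω : Set (E n)} {t₁ t₂ : ℝ} {u : E n → ℝ → ℝ}
    (hreg : ParabolicRegular Ω t₁ t₂ u) {t : ℝ} (ht : t ∈ Icc t₁ t₂) :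
    ContinuousOn (fun x => u x t) (closure Ω) :=
  hreg.cont.comp (f := fun x => (x, t)) (by fun_prop) (fun _ hx => ⟨hx, ht⟩)

lemma eq_of_clm_sub_eq_zero {M : E n →L[ℝ] E n} (hM : LinearMap.det (M : E n →ₗ[ℝ] E n) ≠ 0)
    {y z : E n} (h : M (y - z) = 0) : y = z := by
  have h1 : Function.Injective (M : E n →ₗ[ℝ] E n) :=
    ((LinearMap.equivOfDetNeZero _ hM).injective)
  have h2 : y - z = 0 := h1 (by simpa using h)
  exact sub_eq_zero.1 h2

/-- Barrier from above: the value at a point cannot drop fast if `u(·,t)` is nearly affine on an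
ellipsoid centred there. -/
lemma ParabolicRegular.drop {m : ℕ} {Lam p : ℝ} {Ω : Set (E n)} {T : ℝ} {u : E n → ℝ → ℝ}
    (hnm : m + 2 = n) (hm : 0 < m) (hp : p = (m : ℝ)⁻¹) (hLam : 0 < Lam)
    (hbd : Bornology.IsBounded Ω)
    (hreg : ParabolicRegular Ω (-T) 0 u) (hsub : ViscSubsolution Lam p Ω (-T) 0 u)
    {s t : ℝ} (hs : -T ≤ s) (hst : s < t) (ht : t ≤ 0)
    (q x₁ : E n) (M : E n →L[ℝ] E n) (hM : LinearMap.det (M : E n →ₗ[ℝ] E n) ≠ 0)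
    {H : ℝ} (hH : 0 < H)
    (hell : ∀ y, ‖M (y - x₁)‖ ≤ 1 → y ∈ Ω ∧ u y t ≤ u x₁ t + ⟪q, y - x₁⟫ + H)
    (hc : (2 * Lam) ^ m * 4 ^ n * (t - s) ^ m * H ^ 2 * LinearMap.det (M : E n →ₗ[ℝ] E n) ^ 2 < 1) :
    u x₁ t - 3 * H ≤ u x₁ s := by
  by_contra hcon
  push Not at hcon
  have hr0 : 0 < t - s := by linarith
  have hsI : s ∈ Icc (-T) 0 := ⟨hs, by linarith⟩
  have htI : t ∈ Icc (-T) 0 := ⟨by linarith, ht⟩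
  set b : ℝ → ℝ := fun r => -H + H / (2 * (t - s)) * (r - s) with hb
  have hbder : ∀ r, HasDerivAt b (H / (2 * (t - s))) r := by
    intro r
    have := (((hasDerivAt_id r).sub_const s).const_mul (H / (2 * (t - s)))).const_add (-H)
    rw [mul_one] at this
    exact this
  have hbs : b s = -H := by simp [hb]
  have hbt : b t = -H / 2 := by simp only [hb]; field_simp; ring
  have hbge : ∀ r, s ≤ r → -H ≤ b r := fun r hr => by
    have : 0 ≤ H / (2 * (t - s)) * (r - s) := mul_nonneg (by positivity) (by linarith)
    simp only [hb]; linarith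
  set ψ := quadTest (u x₁ t - ⟪q, x₁⟫) q x₁ M b (fun _ => 2 * H) with hψ
  have hψval : ∀ y r, ψ y r = u x₁ t + ⟪q, y - x₁⟫ + b r + 2 * H * ‖M (y - x₁)‖ ^ 2 := by
    intro y r; simp only [hψ, quadTest, inner_sub_right]; ring
  set B : Set (E n) := {y | ‖M (y - x₁)‖ ≤ 1} with hB
  have hBΩ : B ⊆ Ω := fun y hy => (hell y hy).1
  have hBS : B ⊆ closure Ω := hBΩ.trans subset_closure
  have hBc : IsCompact B := (hbd.subset hBΩ).isCompact_closure.of_isClosed_subset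
    (isClosed_le (by fun_prop) continuous_const) subset_closure
  have hx₁B : x₁ ∈ B := by simp [hB]
  have hQc : IsCompact (B ×ˢ Icc s t) := hBc.prod isCompact_Icc
  have hcont : ContinuousOn (fun w : E n × ℝ => u w.1 w.2 - ψ w.1 w.2) (B ×ˢ Icc s t) := by
    have h1 : ContinuousOn (fun w : E n × ℝ => u w.1 w.2) (B ×ˢ Icc s t) :=
      hreg.cont.mono (fun w hw => ⟨hBS hw.1, by linarith [hw.2.1], by linarith [hw.2.2]⟩)
    simp only [hψval]
    refine h1.sub ?_
    have hbc : Continuous b := by simp only [hb]; fun_prop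
    clear_value B b
    clear h1 hcon hc
    fun_prop
  obtain ⟨⟨x₀, t₀⟩, ⟨hx₀B, hst₀, ht₀⟩, hmax⟩ :=
    hQc.exists_isMaxOn ⟨(x₁, t), hx₁B, hst.le, le_rfl⟩ hcont
  simp only at hx₀B hst₀ ht₀
  have hpos : 0 < u x₀ t₀ - ψ x₀ t₀ := by
    have h1 := hmax (show (x₁, t) ∈ B ×ˢ Icc s t from ⟨hx₁B, hst.le, le_rfl⟩)
    simp only [mem_ofPred_eq] at h1
    refine lt_of_lt_of_le ?_ h1
    rw [hψval, hbt]; simp; linarith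
  have hup : ∀ y ∈ B, ∀ r, s ≤ r → r ≤ t → u y r ≤ u x₁ t + ⟪q, y - x₁⟫ + H := by
    intro y hy r hr hrt
    exact (hreg.mono y (hBS hy) r ⟨by linarith, by linarith⟩ t htI hrt).trans (hell y hy).2
  have hint : ‖M (x₀ - x₁)‖ < 1 := by
    rcases (show ‖M (x₀ - x₁)‖ ≤ 1 from hx₀B).lt_or_eq with h | h
    · exact h
    · exfalso
      have h1 := hup x₀ hx₀B t₀ hst₀ ht₀
      rw [hψval, h] at hpos
      have := hbge t₀ hst₀
      linarith
  have hst₀' : s < t₀ := by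
    rcases hst₀.lt_or_eq with h | h
    · exact h
    · exfalso
      rw [hψval, ← h, hbs] at hpos
      set ρ := ‖M (x₀ - x₁)‖ with hρ
      rcases eq_or_ne ρ 0 with h0 | h0
      · have h2 : x₀ = x₁ := eq_of_clm_sub_eq_zero hM (norm_eq_zero.1 h0)
        rw [h2, h0] at hpos
        simp at hpos
        linarith
      · have hρpos : 0 < ρ := lt_of_le_of_ne (norm_nonneg _) (Ne.symm h0)
        set y' := x₁ + ρ⁻¹ • (x₀ - x₁) with hy'
        have hy'B : y' ∈ B := by
          simp only [hB, mem_ofPred_eq, hy', add_sub_cancel_left, map_smul, norm_smul, norm_inv,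
            Real.norm_eq_abs, abs_of_pos hρpos, ← hρ]
          rw [inv_mul_cancel₀ h0]
        have hcx := (hreg.conv s hsI).2 (hBS hx₁B) (hBS hy'B)
          (show 0 ≤ 1 - ρ by linarith) hρpos.le (by ring)
        have he : (1 - ρ) • x₁ + ρ • y' = x₀ := by
          rw [hy', smul_add, smul_smul, mul_inv_cancel₀ h0]; module
        rw [he] at hcx
        simp only [smul_eq_mul] at hcx
        have h3 := hup y' hy'B s le_rfl hst.le
        have h4 : ⟪q, y' - x₁⟫ = ρ⁻¹ * ⟪q, x₀ - x₁⟫ := by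
          rw [hy', add_sub_cancel_left, inner_smul_right]
        rw [h4] at h3
        have h5 : ρ * u y' s ≤ ρ * (u x₁ t + H) + ⟪q, x₀ - x₁⟫ := by
          have := mul_le_mul_of_nonneg_left h3 hρpos.le
          refine this.trans (le_of_eq ?_)
          field_simp; ring
        have h6 : (1 - ρ) * u x₁ s ≤ (1 - ρ) * (u x₁ t - 3 * H) :=
          mul_le_mul_of_nonneg_left hcon.le (by linarith)
        nlinarith [sq_nonneg (1 - ρ)]
  have hlocal : LocalMaxBelow Ω (-T) 0 u ψ x₀ t₀ := by
    have hopen : IsOpen {y : E n | ‖M (y - x₁)‖ < 1} :=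
      isOpen_lt (by fun_prop) continuous_const
    obtain ⟨ε, hε, hεb⟩ := Metric.isOpen_iff.1 hopen x₀ hint
    refine ⟨min ε (t₀ - s), lt_min hε (by linarith), fun x hx r hr hrt hd hdr => ?_⟩
    have h1 : ‖M (x - x₁)‖ < 1 := hεb (lt_of_lt_of_le hd (min_le_left _ _))
    have h3 := lt_of_lt_of_le hdr (min_le_right _ _)
    rw [Real.dist_eq, abs_lt] at h3
    exact hmax (show (x, r) ∈ B ×ˢ Icc s t from
      ⟨h1.le, by simp only; linarith, by simp only; linarith⟩)
  have key := hsub x₀ (hBΩ hx₀B) t₀ ⟨by linarith, by linarith⟩ ψ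
    (isTestAt_quadTest _ q x₁ M b _ x₀ t₀ 1 one_pos
      (by apply ContDiff.contDiffOn; simp only [hb]; fun_prop) contDiffOn_const) hlocal
  rw [timeDeriv_quadTest _ q x₁ M b _ x₀ t₀ _ 0 (hbder t₀) (hasDerivAt_const _ _),
    det_hessMatrix_quadTest, zero_mul, add_zero] at key
  exact absurd key (not_le.2 (drop_aux hnm hm hp hLam hH hr0 hc))

/-- Rescaled version of `ParabolicRegular.drop`. -/
lemma ParabolicRegular.drop_scaled {m : ℕ} {Lam p : ℝ} {Ω : Set (E n)} {T : ℝ} {u : E n → ℝ → ℝ}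
    (hnm : m + 2 = n) (hm : 0 < m) (hp : p = (m : ℝ)⁻¹) (hLam : 0 < Lam)
    (hbd : Bornology.IsBounded Ω)
    (hreg : ParabolicRegular Ω (-T) 0 u) (hsub : ViscSubsolution Lam p Ω (-T) 0 u)
    {s t : ℝ} (hs : -T ≤ s) (hst : s < t) (ht : t ≤ 0)
    (q x₁ : E n) (M : E n →L[ℝ] E n) (hM : LinearMap.det (M : E n →ₗ[ℝ] E n) ≠ 0)
    {H θ : ℝ} (hH : 0 < H) (hθ : 0 < θ) (hθ1 : θ ≤ 1)
    (hell : ∀ y, ‖M (y - x₁)‖ ≤ 1 → y ∈ Ω ∧ u y t ≤ u x₁ t + ⟪q, y - x₁⟫ + H)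
    (hc : (2 * Lam) ^ m * 4 ^ n * (t - s) ^ m * H ^ 2 * LinearMap.det (M : E n →ₗ[ℝ] E n) ^ 2
      < θ ^ (2 * m + 2)) :
    u x₁ t - 3 * (θ * H) ≤ u x₁ s := by
  have htI : t ∈ Icc (-T) 0 := ⟨by linarith, ht⟩
  have hdet : LinearMap.det ((θ⁻¹ • M : E n →L[ℝ] E n) : E n →ₗ[ℝ] E n) =
      (θ⁻¹) ^ n * LinearMap.det (M : E n →ₗ[ℝ] E n) := by
    have : ((θ⁻¹ • M : E n →L[ℝ] E n) : E n →ₗ[ℝ] E n) = θ⁻¹ • (M : E n →ₗ[ℝ] E n) := rfl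
    rw [this, LinearMap.det_smul]; simp
  refine hreg.drop hnm hm hp hLam hbd hsub hs hst ht q x₁ (θ⁻¹ • M) ?_ (mul_pos hθ hH) ?_ ?_
  · rw [hdet]; positivity
  · intro y hy
    set y' := x₁ + θ⁻¹ • (y - x₁) with hy'
    have hy'M : ‖M (y' - x₁)‖ ≤ 1 := by
      simpa [hy'] using hy
    obtain ⟨h1, h2⟩ := hell y' hy'M
    have hx₁ := (hell x₁ (by simp)).1
    have he : (1 - θ) • x₁ + θ • y' = y := by
      rw [hy', smul_add, smul_smul, mul_inv_cancel₀ hθ.ne']; module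
    have hcv := hreg.conv t htI
    constructor
    · have hyM : ‖M (y - x₁)‖ ≤ 1 := by
        have h3 : ‖θ⁻¹ • M (y - x₁)‖ ≤ 1 := by simpa using hy
        rw [norm_smul, norm_inv, Real.norm_eq_abs, abs_of_pos hθ, inv_mul_le_iff₀ hθ] at h3
        linarith
      exact (hell y hyM).1
    · have h3 := hcv.2 (subset_closure hx₁) (subset_closure h1)
        (show 0 ≤ 1 - θ by linarith) hθ.le (by ring)
      rw [he] at h3
      simp only [smul_eq_mul] at h3
      have h4 : ⟪q, y' - x₁⟫ = θ⁻¹ * ⟪q, y - x₁⟫ := by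
        rw [hy', add_sub_cancel_left, inner_smul_right]
      rw [h4] at h2
      have h5 : θ * u y' t ≤ θ * (u x₁ t + H) + ⟪q, y - x₁⟫ := by
        have := mul_le_mul_of_nonneg_left h2 hθ.le
        refine this.trans (le_of_eq ?_)
        field_simp; ring
      linarith
  · rw [hdet]
    calc _ = ((2 * Lam) ^ m * 4 ^ n * (t - s) ^ m * H ^ 2 *
          LinearMap.det (M : E n →ₗ[ℝ] E n) ^ 2) * (θ ^ (2 * m + 2))⁻¹ := by
          have : θ ^ n = θ ^ (m + 2) := by rw [hnm]
          rw [inv_pow, this]; field_simp; ring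
      _ < θ ^ (2 * m + 2) * (θ ^ (2 * m + 2))⁻¹ := by gcongr
      _ = 1 := by field_simp

/-- The absolute value of the determinant of a frame in the standard coordinates. -/
def frameDet (g : Fin n → E n) : ℝ :=
  |(EuclideanSpace.basisFun (Fin n) ℝ).toBasis.det g|

lemma frameDet_smul (w : Fin n → ℝ) (hw : ∀ i, 0 ≤ w i) (g : Fin n → E n) :
    frameDet (fun i => w i • g i) = (∏ i, w i) * frameDet g := by
  have := ((EuclideanSpace.basisFun (Fin n) ℝ).toBasis.det).map_smul_univ w g
  unfold frameDet
  rw [this, smul_eq_mul, abs_mul, abs_of_nonneg (Finset.prod_nonneg fun i _ => hw i)]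

lemma continuous_frameDet : Continuous (frameDet : (Fin n → E n) → ℝ) := by
  unfold frameDet
  simp only [Module.Basis.det_apply]
  refine continuous_abs.comp (Continuous.matrix_det ?_)
  refine continuous_matrix fun i j => ?_
  simp only [Module.Basis.toMatrix_apply, OrthonormalBasis.coe_toBasis_repr_apply,
    EuclideanSpace.basisFun_repr]
  fun_prop

lemma frameDet_le_prod_norm (g : Fin n → E n) : frameDet g ≤ ∏ i, ‖g i‖ := by
  have : Fact (Module.finrank ℝ (E n) = n) := ⟨by simp⟩
  have h := Orientation.abs_volumeForm_apply_le
    (EuclideanSpace.basisFun (Fin n) ℝ).toBasis.orientation g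
  rwa [Orientation.volumeForm_robust' _ (EuclideanSpace.basisFun (Fin n) ℝ)] at h

lemma frameDet_update_sum (g : Fin n → E n) (i : Fin n) (c : Fin n → ℝ) :
    frameDet (Function.update g i (∑ j, c j • g j)) = |c i| * frameDet g := by
  unfold frameDet
  set d := (EuclideanSpace.basisFun (Fin n) ℝ).toBasis.det
  have h : d (Function.update g i (∑ j, c j • g j)) = c i * d g := by
    have h1 := d.toMultilinearMap.map_update_sum Finset.univ i (fun j => c j • g j) g
    simp only [AlternatingMap.coe_multilinearMap] at h1
    rw [h1, Finset.sum_eq_single i]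
    · rw [d.map_update_smul, Function.update_eq_self, smul_eq_mul]
    · intro j _ hj
      rw [d.map_update_smul, d.map_update_self g (Ne.symm hj), smul_zero]
    · simp
  rw [h, abs_mul]

lemma frameDet_update_neg (g : Fin n → E n) (i : Fin n) (e : E n) :
    frameDet (Function.update g i (-e)) = frameDet (Function.update g i e) := by
  unfold frameDet
  rw [AlternatingMap.map_update_neg, abs_neg]

/-- Coordinates with respect to a nondegenerate frame with weights. -/
lemma exists_frame_coords (g : Fin n → E n) (w : Fin n → ℝ) (hg : 0 < frameDet g)
    (hw : ∀ i, 0 < w i) :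
    ∃ M : E n →L[ℝ] E n, LinearMap.det (M : E n →ₗ[ℝ] E n) ≠ 0 ∧
      LinearMap.det (M : E n →ₗ[ℝ] E n) ^ 2 * ((∏ i, w i) * frameDet g) ^ 2 = 1 ∧
      (∀ y, y = ∑ i, (M y i * w i) • g i) ∧
      ∀ c : Fin n → ℝ, ∀ i, M (∑ j, c j • g j) i = c i / w i := by
  set B := (EuclideanSpace.basisFun (Fin n) ℝ).toBasis with hB
  set V : E n →ₗ[ℝ] E n := B.constr ℝ (fun i => w i • g i) with hV
  have hVB : V ∘ B = fun i => w i • g i := by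
    funext i; simp only [hV, Function.comp, Module.Basis.constr_basis]
  have hdet : |LinearMap.det V| = (∏ i, w i) * frameDet g := by
    have h1 := B.det_comp V B
    rw [hVB, B.det_self, mul_one] at h1
    rw [← h1]
    exact frameDet_smul w (fun i => (hw i).le) g
  have hpos : 0 < (∏ i, w i) * frameDet g := mul_pos (Finset.prod_pos fun i _ => hw i) hg
  have hV0 : LinearMap.det V ≠ 0 := by
    rw [← abs_pos, hdet]; exact hpos
  set L := LinearMap.equivOfDetNeZero V hV0 with hL
  have hLV : ∀ y, L y = V y := fun y => rfl
  have hVval : ∀ c : E n, V c = ∑ i, (c i * w i) • g i := by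
    intro c
    rw [hV, Module.Basis.constr_apply_fintype]
    refine Finset.sum_congr rfl fun i _ => ?_
    rw [smul_smul]; simp [hB]
  set M : E n →L[ℝ] E n := LinearMap.toContinuousLinearMap (L.symm : E n →ₗ[ℝ] E n) with hM
  have hMy : ∀ y, M y = L.symm y := fun y => rfl
  have hdM : LinearMap.det (M : E n →ₗ[ℝ] E n) * LinearMap.det V = 1 := by
    rw [← LinearMap.det_comp]
    have : (M : E n →ₗ[ℝ] E n).comp V = LinearMap.id := by
      ext1 y; change M (V y) = y; rw [hMy, ← hLV, LinearEquiv.symm_apply_apply]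
    rw [this, LinearMap.det_id]
  refine ⟨M, fun h => by simp [h] at hdM, ?_, fun y => ?_, fun c i => ?_⟩
  · rw [← hdet, sq_abs, ← mul_pow, hdM, one_pow]
  · rw [← hVval, hMy, ← hLV, LinearEquiv.apply_symm_apply]
  · have : ∑ j, c j • g j = V (WithLp.toLp 2 fun j => c j / w j) := by
      rw [hVval]
      refine Finset.sum_congr rfl fun j _ => ?_
      simp [div_mul_cancel₀ _ (hw j).ne']
    rw [this, hMy, ← hLV, LinearEquiv.symm_apply_apply]

/-- A ball contains frames with large determinant. -/
lemma exists_frame_of_ball (i₀ : Fin n) {e : E n} (he : ‖e‖ = 1) {r : ℝ} (hr : 0 ≤ r) :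
    ∃ g : Fin n → E n, (∀ i, ‖g i‖ ≤ r) ∧ r ^ (n - 1) ≤ frameDet (Function.update g i₀ e) := by
  have ho : Orthonormal ℝ (({i₀} : Set (Fin n)).domRestrict (fun _ => e)) := by
    constructor
    · intro i; simpa using he
    · intro i j hij; exact absurd (Subsingleton.elim i j) hij
  obtain ⟨b, hb⟩ := ho.exists_orthonormalBasis_extension_of_card_eq (by simp)
  refine ⟨fun i => r • b i, fun i => ?_, le_of_eq ?_⟩
  · rw [norm_smul, b.norm_eq_one, mul_one, Real.norm_eq_abs, abs_of_nonneg hr]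
  · have h1 : Function.update (fun i => r • b i) i₀ e =
        fun i => (Function.update (fun _ => r) i₀ 1 : Fin n → ℝ) i • b i := by
      funext i
      rcases eq_or_ne i i₀ with rfl | h
      · simp [hb]
      · simp [h]
    rw [h1, frameDet_smul]
    · have h2 : frameDet b = 1 := by
        unfold frameDet
        have := OrthonormalBasis.det_to_matrix_orthonormalBasis
          (EuclideanSpace.basisFun (Fin n) ℝ) b
        rwa [Real.norm_eq_abs] at this
      rw [h2, mul_one, Finset.prod_update_of_mem (Finset.mem_univ _)]
      simp [Finset.card_sdiff]
    · intro i
      rcases eq_or_ne i i₀ with rfl | h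
      · simp
      · simp [h, hr]

lemma exists_norm_ge_of_frameDet (i₀ : Fin n) {e : E n} (he : ‖e‖ = 1) {r : ℝ}
    {g : Fin n → E n} (h : r ^ (n - 1) < frameDet (Function.update g i₀ e)) :
    ∃ i, r ≤ ‖g i‖ := by
  by_contra hcon
  push Not at hcon
  refine absurd h (not_lt.2 ((frameDet_le_prod_norm _).trans ?_))
  rw [← Finset.mul_prod_erase _ _ (Finset.mem_univ i₀)]
  simp only [Function.update_self, he, one_mul]
  calc _ ≤ ∏ _x ∈ Finset.univ.erase i₀, r := by
        refine Finset.prod_le_prod (fun _ _ => norm_nonneg _) fun i hi => ?_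
        rw [Function.update_of_ne (Finset.ne_of_mem_erase hi)]
        exact (hcon i).le
    _ = _ := by simp

/-- A frame of a symmetric convex compact set, maximal subject to one column being `e`, controls the
whole set. -/
lemma exists_maximal_frame {G : Set (E n)} (hc : IsCompact G) (hcv : Convex ℝ G)
    (hsymm : ∀ g ∈ G, -g ∈ G) (h0 : (0 : E n) ∈ G) (i₀ : Fin n) {e : E n} {X : ℝ}
    (hX : ∀ s : ℝ, s • e ∈ G → |s| ≤ X)
    {g₁ : Fin n → E n} (hg₁ : ∀ i, g₁ i ∈ G) (hpos : 0 < frameDet (Function.update g₁ i₀ e)) :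
    ∃ g : Fin n → E n, (∀ i, g i ∈ G) ∧ 0 < frameDet (Function.update g i₀ e) ∧
      ∀ c : Fin n → ℝ, ∑ j, c j • Function.update g i₀ e j ∈ G →
        (∀ i, i ≠ i₀ → |c i| ≤ 1) ∧ |c i₀| ≤ n * X := by
  have hK : IsCompact (Set.pi univ (fun _ : Fin n => G)) := isCompact_univ_pi fun _ => hc
  have hcont : Continuous fun g : Fin n → E n => frameDet (Function.update g i₀ e) :=
    continuous_frameDet.comp (continuous_id.update i₀ continuous_const)
  obtain ⟨g, hgG, hmax⟩ := hK.exists_isMaxOn ⟨g₁, fun i _ => hg₁ i⟩ hcont.continuousOn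
  have hgG' : ∀ i, g i ∈ G := fun i => hgG i (mem_univ _)
  have hD : 0 < frameDet (Function.update g i₀ e) :=
    lt_of_lt_of_le hpos (hmax (show g₁ ∈ _ from fun i _ => hg₁ i))
  refine ⟨g, hgG', hD, fun c hcG => ?_⟩
  have h1 : ∀ i, i ≠ i₀ → |c i| ≤ 1 := by
    intro i hi
    have hm := hmax (show Function.update g i (∑ j, c j • Function.update g i₀ e j) ∈
      Set.pi univ (fun _ : Fin n => G) from fun k _ => by
        rcases eq_or_ne k i with rfl | hk
        · simpa using hcG
        · simpa [hk] using hgG' k)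
    simp only [mem_ofPred_eq] at hm
    rw [Function.update_comm hi, frameDet_update_sum] at hm
    exact le_of_mul_le_mul_right (by linarith) hD
  refine ⟨h1, ?_⟩
  have hn : (0:ℝ) < n := by exact_mod_cast i₀.pos
  -- express the `e`-component as an average
  have hmem : ∀ i, (if i = i₀ then ∑ j, c j • Function.update g i₀ e j else (-c i) • g i) ∈ G := by
    intro i
    split_ifs with h
    · exact hcG
    · have hle := h1 i h
      have hz : ∀ a : ℝ, 0 ≤ a → a ≤ 1 → ∀ v ∈ G, a • v ∈ G := fun a ha ha1 v hv => by
        have := hcv hv h0 ha (show 0 ≤ 1 - a by linarith) (by ring)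
        simpa using this
      rcases le_total 0 (c i) with hci | hci
      · have := hz _ (abs_nonneg (c i)) hle _ (hsymm _ (hgG' i))
        rw [abs_of_nonneg hci] at this
        simpa using this
      · have := hz _ (abs_nonneg (c i)) hle _ (hgG' i)
        rwa [abs_of_nonpos hci] at this
  have havg : ∑ i : Fin n, (1 / (n:ℝ)) •
      (if i = i₀ then ∑ j, c j • Function.update g i₀ e j else (-c i) • g i) ∈ G :=
    hcv.sum_mem (fun _ _ => by positivity) (by simp [hn.ne']) (fun i _ => hmem i)
  have hsum : ∑ i : Fin n, (1 / (n:ℝ)) •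
      (if i = i₀ then ∑ j, c j • Function.update g i₀ e j else (-c i) • g i) =
      (c i₀ / n) • e := by
    rw [← Finset.smul_sum, ← Finset.add_sum_erase _ _ (Finset.mem_univ i₀), if_pos rfl,
      ← Finset.add_sum_erase _ (fun j => c j • Function.update g i₀ e j) (Finset.mem_univ i₀),
      add_assoc, ← Finset.sum_add_distrib, Finset.sum_eq_zero]
    · simp only [Function.update_self, add_zero, smul_smul]; congr 1; ring
    · intro i hi
      have hi' := Finset.ne_of_mem_erase hi
      simp [hi']
  rw [hsum] at havg
  have := hX _ havg
  rw [abs_div, abs_of_pos hn, div_le_iff₀ hn] at this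
  linarith

lemma convexHull_eq_image_stdSimplex {V : Type*} [NormedAddCommGroup V] [NormedSpace ℝ V]
    [FiniteDimensional ℝ V] (s : Set V) :
    convexHull ℝ s = (fun p : (Fin (Module.finrank ℝ V + 1) → ℝ) ×
      (Fin (Module.finrank ℝ V + 1) → V) => ∑ i, p.1 i • p.2 i) ''
        (stdSimplex ℝ (Fin (Module.finrank ℝ V + 1)) ×ˢ Set.pi univ fun _ => s) := by
  apply Subset.antisymm
  · intro x hx
    obtain ⟨ι, _, z, w, hz, hind, hw, hsum, hx⟩ := eq_pos_convex_span_of_mem_convexHull hx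
    have hcard : Fintype.card ι ≤ Fintype.card (Fin (Module.finrank ℝ V + 1)) := by
      rw [Fintype.card_fin]
      exact hind.card_le_finrank_succ.trans (by
        gcongr; exact Submodule.finrank_le _)
    obtain ⟨φ⟩ := Function.Embedding.nonempty_of_card_le hcard
    have hne : Nonempty ι := by
      by_contra h
      rw [not_nonempty_iff] at h
      simp at hsum
    obtain ⟨i₁⟩ := hne
    refine ⟨(Function.extend φ w 0, Function.extend φ z fun _ => z i₁), ⟨⟨fun j => ?_, ?_⟩,
      fun j _ => ?_⟩, ?_⟩
    · by_cases hj : ∃ i, φ i = j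
      · obtain ⟨i, rfl⟩ := hj
        simp only [φ.injective.extend_apply]
        exact (hw i).le
      · simp [Function.extend_apply' _ _ _ hj]
    · rw [← hsum]
      refine (Fintype.sum_of_injective φ φ.injective _ _ (fun j hj => ?_) fun i => ?_).symm
      · exact Function.extend_apply' _ _ _ hj
      · exact (φ.injective.extend_apply w 0 i).symm
    · by_cases hj : ∃ i, φ i = j
      · obtain ⟨i, rfl⟩ := hj
        simp only [φ.injective.extend_apply]
        exact hz ⟨i, rfl⟩
      · simp only [Function.extend_apply' _ _ _ hj]
        exact hz ⟨i₁, rfl⟩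
    · rw [← hx]
      refine (Fintype.sum_of_injective φ φ.injective _ _ (fun j hj => ?_) fun i => ?_).symm
      · dsimp only
        rw [Function.extend_apply' _ _ _ hj, Pi.zero_apply, zero_smul]
      · simp only [φ.injective.extend_apply]
  · rintro _ ⟨⟨w, z⟩, ⟨hw, hz⟩, rfl⟩
    exact (convex_convexHull ℝ s).sum_mem (fun i _ => hw.1 i) hw.2
      fun i _ => subset_convexHull ℝ s (hz i (mem_univ i))

lemma IsCompact.convexHull_of_finiteDimensional {V : Type*} [NormedAddCommGroup V]
    [NormedSpace ℝ V] [FiniteDimensional ℝ V] {s : Set V} (hs : IsCompact s) :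
    IsCompact (convexHull ℝ s) := by
  rw [convexHull_eq_image_stdSimplex]
  refine ((isCompact_stdSimplex ℝ _).prod (isCompact_univ_pi fun _ => hs)).image ?_
  fun_prop

/-- The symmetrised section of `f` at `x` of height `h`. -/
def secG (S : Set (E n)) (f : E n → ℝ) (x : E n) (h : ℝ) : Set (E n) :=
  {g | x + g ∈ S ∧ x - g ∈ S ∧ f (x + g) + f (x - g) ≤ 2 * f x + 2 * h}

section secG

variable {S : Set (E n)} {f : E n → ℝ} {x : E n} {h : ℝ}

lemma secG_neg {g : E n} (hg : g ∈ secG S f x h) : -g ∈ secG S f x h := by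
  obtain ⟨h1, h2, h3⟩ := hg
  refine ⟨by simpa [sub_eq_add_neg] using h2, by simpa using h1, ?_⟩
  rw [sub_neg_eq_add, ← sub_eq_add_neg]; linarith

lemma zero_mem_secG (hx : x ∈ S) (hh : 0 ≤ h) : (0 : E n) ∈ secG S f x h := by
  refine ⟨by simpa using hx, by simpa using hx, ?_⟩
  simp only [add_zero, sub_zero]; linarith

lemma convex_secG (hf : ConvexOn ℝ S f) : Convex ℝ (secG S f x h) := by
  intro g₁ h₁ g₂ h₂ a b ha hb hab
  have e1 : x + (a • g₁ + b • g₂) = a • (x + g₁) + b • (x + g₂) := by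
    rw [smul_add, smul_add, add_add_add_comm, ← add_smul, hab, one_smul]
  have e2 : x - (a • g₁ + b • g₂) = a • (x - g₁) + b • (x - g₂) := by
    rw [smul_sub, smul_sub, sub_add_sub_comm, ← add_smul, hab, one_smul]
  refine ⟨e1 ▸ hf.1 h₁.1 h₂.1 ha hb hab, e2 ▸ hf.1 h₁.2.1 h₂.2.1 ha hb hab, ?_⟩
  have i1 := hf.2 h₁.1 h₂.1 ha hb hab
  have i2 := hf.2 h₁.2.1 h₂.2.1 ha hb hab
  simp only [smul_eq_mul] at i1 i2
  rw [e1, e2]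
  have j1 := mul_le_mul_of_nonneg_left h₁.2.2 ha
  have j2 := mul_le_mul_of_nonneg_left h₂.2.2 hb
  have : a * (2 * f x + 2 * h) + b * (2 * f x + 2 * h) = 2 * f x + 2 * h := by
    rw [← add_mul, hab, one_mul]
  linarith

lemma isCompact_secG (hS : IsCompact S) (hf : ContinuousOn f S) :
    IsCompact (secG S f x h) := by
  have h1 : IsCompact ((fun g => x + g) ⁻¹' S ∩ (fun g => x - g) ⁻¹' S) := by
    refine IsCompact.inter_right ?_ (hS.isClosed.preimage (by fun_prop))
    have := (Homeomorph.addLeft x).isClosedEmbedding.isCompact_preimage hS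
    simpa using this
  have hcont : ContinuousOn (fun g => f (x + g) + f (x - g))
      ((fun g => x + g) ⁻¹' S ∩ (fun g => x - g) ⁻¹' S) :=
    (hf.comp (by fun_prop) fun g hg => hg.1).add (hf.comp (by fun_prop) fun g hg => hg.2)
  have h2 := hcont.preimage_isClosed_of_isClosed h1.isClosed (isClosed_Iic (a := 2 * f x + 2 * h))
  have : secG S f x h = ((fun g => x + g) ⁻¹' S ∩ (fun g => x - g) ⁻¹' S) ∩
      (fun g => f (x + g) + f (x - g)) ⁻¹' Iic (2 * f x + 2 * h) := by
    ext g; simp [secG, and_assoc]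
  rw [this]
  exact h1.of_isClosed_subset h2 inter_subset_left

lemma secG_mono {h' : ℝ} (hh : h ≤ h') : secG S f x h ⊆ secG S f x h' :=
  fun _ hg => ⟨hg.1, hg.2.1, hg.2.2.trans (by linarith)⟩

end secG

/-- A convex combination seen from one of its points. -/
lemma exists_two_point {V : Type*} [AddCommGroup V] [Module ℝ V] {S : Set V} {f : V → ℝ}
    (hf : ConvexOn ℝ S f) {ι : Type*} [Fintype ι] {w : ι → ℝ} {y : ι → V}
    (hw : w ∈ stdSimplex ℝ ι) (hy : ∀ i, y i ∈ S) (i : ι) :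
    ∃ z ∈ S, ∑ j, w j • y j = w i • y i + (1 - w i) • z ∧
      w i * f (y i) + (1 - w i) * f z ≤ ∑ j, w j * f (y j) := by
  classical
  have hsum : w i + ∑ j ∈ Finset.univ.erase i, w j = 1 := by
    rw [Finset.add_sum_erase _ _ (Finset.mem_univ i)]; exact hw.2
  rcases eq_or_ne (w i) 1 with h1 | h1
  · refine ⟨y i, hy i, ?_, ?_⟩
    all_goals
      have h0 : ∀ j ∈ Finset.univ.erase i, w j = 0 :=
        (Finset.sum_eq_zero_iff_of_nonneg fun j _ => hw.1 j).1 (by linarith)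
    · rw [← Finset.add_sum_erase _ _ (Finset.mem_univ i), h1, sub_self, zero_smul,
        Finset.sum_eq_zero]
      intro j hj; rw [h0 j hj, zero_smul]
    · rw [← Finset.add_sum_erase _ _ (Finset.mem_univ i), h1, sub_self, zero_mul,
        Finset.sum_eq_zero]
      intro j hj; rw [h0 j hj, zero_mul]
  · have hpos : 0 < 1 - w i := by
      have : w i ≤ 1 := by
        have := Finset.sum_nonneg fun j (_ : j ∈ Finset.univ.erase i) => hw.1 j
        linarith
      exact sub_pos.2 (lt_of_le_of_ne this h1)
    have hs1 : ∑ j ∈ Finset.univ.erase i, w j / (1 - w i) = 1 := by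
      rw [← Finset.sum_div, div_eq_one_iff_eq hpos.ne']; linarith
    have hnn : ∀ j ∈ Finset.univ.erase i, 0 ≤ w j / (1 - w i) :=
      fun j _ => div_nonneg (hw.1 j) hpos.le
    refine ⟨∑ j ∈ Finset.univ.erase i, (w j / (1 - w i)) • y j,
      hf.1.sum_mem hnn hs1 fun j _ => hy j, ?_, ?_⟩
    · rw [← Finset.add_sum_erase _ _ (Finset.mem_univ i), Finset.smul_sum]
      congr 1
      refine Finset.sum_congr rfl fun j _ => ?_
      rw [smul_smul, mul_div_cancel₀ _ hpos.ne']
    · have := hf.map_sum_le hnn hs1 fun j _ => hy j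
      have := mul_le_mul_of_nonneg_left this hpos.le
      rw [← Finset.add_sum_erase _ _ (Finset.mem_univ i)]
      rw [Finset.mul_sum] at this
      have e : ∑ j ∈ Finset.univ.erase i, (1 - w i) * (w j / (1 - w i)) • f (y j) =
          ∑ j ∈ Finset.univ.erase i, w j * f (y j) := by
        refine Finset.sum_congr rfl fun j _ => ?_
        rw [smul_eq_mul, ← mul_assoc, mul_div_cancel₀ _ hpos.ne']
      linarith

/-- Every ray from a point of a bounded open set hits its frontier. -/
lemma exists_ray_mem_frontier {Ω : Set (E n)} (hΩ : IsOpen Ω) (hb : Bornology.IsBounded Ω)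
    {x d : E n} (hx : x ∈ Ω) (hd : d ≠ 0) : ∃ s : ℝ, 0 ≤ s ∧ x + s • d ∈ frontier Ω := by
  by_contra hcon
  push Not at hcon
  set R : Set (E n) := (fun s : ℝ => x + s • d) '' Ici 0
  have hR : IsPreconnected R := isPreconnected_Ici.image _ (by fun_prop)
  have hsub : R ⊆ Ω := by
    refine hR.subset_of_closure_inter_subset hΩ ⟨x, ⟨0, self_mem_Ici, by simp⟩, hx⟩ ?_
    rintro _ ⟨h1, s, hs, rfl⟩
    by_contra h2
    exact hcon s hs (by rw [hΩ.frontier_eq]; exact ⟨h1, h2⟩)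
  obtain ⟨C, hC⟩ := hb.subset_ball x
  have hd' : 0 < ‖d‖ := norm_pos_iff.2 hd
  have hxC := hC hx
  have hCpos : 0 < C := by simpa using hxC
  have := hC (hsub ⟨C / ‖d‖, by simp; positivity, rfl⟩)
  simp [norm_smul, abs_of_pos hCpos, hd'.ne'] at this

/-- A point far out along a convex decomposition of `(x, f x + h)` gives a section vector. -/
lemma two_point_secG {Ω : Set (E n)} {f : E n → ℝ} (hΩ : IsOpen Ω) (hΩc : Convex ℝ Ω)
    (hf : ConvexOn ℝ (closure Ω) f) {x y z : E n} {h β w : ℝ} (hx : x ∈ Ω) (hh : 0 < h)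
    (hβ : 1 < β) (hwβ : β⁻¹ ≤ w) (hw1 : w ≤ 1)
    (hy : y ∈ closure Ω) (hz : z ∈ closure Ω) (hxe : x = w • y + (1 - w) • z)
    (hle : w * f y + (1 - w) * f z ≤ f x + h) :
    x + β⁻¹ • (y - x) ∈ Ω ∧ x - β⁻¹ • (y - x) ∈ Ω ∧
      f (x + β⁻¹ • (y - x)) + f (x - β⁻¹ • (y - x)) < 2 * f x + 2 * h := by
  have hcv := hf.2
  have hxS := subset_closure hx
  have hβ0 : 0 < β⁻¹ := by positivity
  have hβ1 : β⁻¹ < 1 := inv_lt_one_of_one_lt₀ hβ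
  have hw0 : 0 < w := hβ0.trans_le hwβ
  have hk1 : β⁻¹ / w ≤ 1 := (div_le_one hw0).2 hwβ
  have hk2 : β⁻¹ ≤ β⁻¹ / w := by
    rw [le_div_iff₀ hw0]; nlinarith
  set k := β⁻¹ / w with hk
  have hkw : k * w = β⁻¹ := by rw [hk, div_mul_cancel₀ _ hw0.ne']
  set b := β⁻¹ with hb
  have e1 : x + b • (y - x) = (1 - b) • x + b • y := by
    rw [smul_sub, sub_smul, one_smul]; abel
  have e2 : x - b • (y - x) = (1 - (k - b)) • x + (k - b) • z := by
    have h1 : k • x = b • y + (k - b) • z := by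
      conv_lhs => rw [hxe]
      rw [smul_add, smul_smul, smul_smul, hkw]
      congr 2; rw [mul_sub, hkw, mul_one]
    have h2 : (k - b) • z = k • x - b • y := by rw [h1]; abel
    rw [h2, smul_sub, sub_smul, sub_smul, one_smul]; abel
  have i1 := hcv hxS hy (show 0 ≤ 1 - b by linarith) hβ0.le (by ring)
  have i2 := hcv hxS hz (show 0 ≤ 1 - (k - b) by linarith) (show 0 ≤ k - b by linarith) (by ring)
  simp only [smul_eq_mul] at i1 i2
  have hxi : x ∈ interior Ω := by rwa [hΩ.interior_eq]
  have m1 := hΩc.combo_interior_closure_mem_interior hxi hy (show 0 < 1 - b by linarith) hβ0.le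
    (by ring)
  have m2 := hΩc.combo_interior_closure_mem_interior hxi hz (show 0 < 1 - (k - b) by linarith)
    (show 0 ≤ k - b by linarith) (by ring)
  rw [hΩ.interior_eq] at m1 m2
  rw [e1, e2]
  refine ⟨m1, m2, ?_⟩
  have j := mul_le_mul_of_nonneg_left hle (show 0 ≤ k by linarith)
  have j2 : k * (w * f y + (1 - w) * f z) = b * f y + (k - b) * f z := by
    rw [← hkw]; ring
  have j3 : k * h ≤ h := by nlinarith
  linarith

/-- The balanced supporting plane: sections cut by it are controlled by symmetric sections. -/
lemma exists_balanced_plane [NeZero n] {Ω : Set (E n)} {f : E n → ℝ} (hΩ : IsOpen Ω)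
    (hΩc : Convex ℝ Ω) (hbd : Bornology.IsBounded Ω) (hf : ConvexOn ℝ (closure Ω) f)
    (hfc : ContinuousOn f (closure Ω)) (hfr : ∀ y ∈ frontier Ω, 1 < f y) {M₀ : ℝ} (hM₀ : 0 ≤ M₀)
    (hlow : ∀ y ∈ closure Ω, -M₀ ≤ f y) {x : E n} (hx : x ∈ Ω) {κ h : ℝ} (hκ : 0 < κ)
    (hκ1 : κ ≤ 1)
    (hfx : f x ≤ 1 - κ) (hh : 0 < h) (hhκ : h ≤ κ / 2) :
    ∃ (c : ℝ) (q : E n), c + ⟪q, x⟫ = f x + h ∧ ∀ y ∈ closure Ω, f y < c + ⟪q, y⟫ →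
      y ∈ Ω ∧ ∃ g ∈ secG (closure Ω) f x h, y - x = (2 * (1 + M₀) * (n + 2) / κ) • g := by
  set β := 2 * (1 + M₀) * (n + 2) / κ with hβdef
  have hβ : 1 < β := by
    rw [hβdef, lt_div_iff₀ hκ]
    have : (0:ℝ) ≤ n := by positivity
    nlinarith [mul_nonneg hM₀ this]
  have hβ0 : 0 < β := by linarith
  set P : E n → Prop := fun y => (x + β⁻¹ • (y - x) ∈ Ω ∧ x - β⁻¹ • (y - x) ∈ Ω) ∧
      f (x + β⁻¹ • (y - x)) + f (x - β⁻¹ • (y - x)) < 2 * f x + 2 * h with hP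
  set O : Set (E n) := {y | P y} with hO
  have hOo : IsOpen O := by
    have h1 : IsOpen {y : E n | x + β⁻¹ • (y - x) ∈ Ω ∧ x - β⁻¹ • (y - x) ∈ Ω} :=
      (hΩ.preimage (f := fun y => x + β⁻¹ • (y - x)) (by fun_prop)).inter
        (hΩ.preimage (f := fun y => x - β⁻¹ • (y - x)) (by fun_prop))
    have h2 : ContinuousOn (fun y => f (x + β⁻¹ • (y - x)) + f (x - β⁻¹ • (y - x)))
        {y : E n | x + β⁻¹ • (y - x) ∈ Ω ∧ x - β⁻¹ • (y - x) ∈ Ω} :=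
      (hfc.comp (by fun_prop) fun y hy => subset_closure hy.1).add
        (hfc.comp (by fun_prop) fun y hy => subset_closure hy.2)
    have := h2.isOpen_inter_preimage h1 (isOpen_Iio (a := 2 * f x + 2 * h))
    exact this
  have hScpt : IsCompact (closure Ω) := hbd.isCompact_closure
  set Z : Set (E n) := (closure Ω ∩ Oᶜ) ∪ frontier Ω with hZ
  have hZS : Z ⊆ closure Ω := union_subset inter_subset_left frontier_subset_closure
  have hZc : IsCompact Z :=
    (hScpt.inter_right hOo.isClosed_compl).union
      (hScpt.of_isClosed_subset isClosed_frontier frontier_subset_closure)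
  set Γ : Set (E n × ℝ) := (fun y => (y, f y)) '' Z with hΓ
  have hΓc : IsCompact Γ := hZc.image_of_continuousOn (continuousOn_id.prodMk (hfc.mono hZS))
  have hdisj : Disjoint (convexHull ℝ Γ) ({x} ×ˢ Iic (f x + h)) := by
    rw [Set.disjoint_left]
    rintro ⟨x', s⟩ hp ⟨hx', hs⟩
    simp only [mem_singleton_iff, mem_Iic] at hx' hs
    subst hx'
    rw [convexHull_eq_image_stdSimplex] at hp
    have hfin : Module.finrank ℝ (E n × ℝ) + 1 = n + 2 := by simp
    rw [hfin] at hp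
    obtain ⟨⟨w, P'⟩, ⟨hw, hP'⟩, hpe⟩ := hp
    have hP'' : ∀ i, ∃ y ∈ Z, (y, f y) = P' i := fun i => hP' i (mem_univ i)
    choose y hyZ hyP using hP''
    simp only at hw
    have e1 : ∑ i, w i • y i = x' := by
      have := congrArg Prod.fst hpe
      simp only [← hyP, Prod.smul_mk] at this
      rw [Prod.fst_sum] at this
      exact this
    have e2 : ∑ i, w i * f (y i) = s := by
      have := congrArg Prod.snd hpe
      simp only [← hyP, Prod.smul_mk] at this
      rw [Prod.snd_sum] at this
      exact this
    have hsum : ∑ _i : Fin (n + 2), κ / (2 * (n + 2)) ≤ ∑ i, w i * (1 - f (y i)) := by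
      simp only [mul_sub, mul_one, Finset.sum_sub_distrib]
      rw [hw.2, e2]
      simp only [Finset.sum_const, Finset.card_univ, Fintype.card_fin, nsmul_eq_mul]
      have : ((n + 2 : ℕ) : ℝ) * (κ / (2 * (n + 2))) = κ / 2 := by
        push_cast; field_simp
      rw [this]; linarith
    obtain ⟨i, -, hi⟩ := Finset.exists_le_of_sum_le (Finset.univ_nonempty) hsum
    have hwi := hw.1 i
    have hnpos : (0:ℝ) < n + 2 := by positivity
    have hpos : 0 < κ / (2 * (n + 2)) := by positivity
    have hfy : f (y i) < 1 := by
      by_contra hcon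
      push Not at hcon
      have := mul_nonneg hwi (sub_nonneg.2 hcon)
      linarith
    have hnf : y i ∉ frontier Ω := fun h' => by linarith [hfr _ h']
    have hyS := hZS (hyZ i)
    have hyO : y i ∉ O := by
      rcases hyZ i with h' | h'
      · exact h'.2
      · exact absurd h' hnf
    have hwβ : β⁻¹ ≤ w i := by
      have h3 : κ / (2 * (n + 2)) ≤ w i * (1 + M₀) :=
        hi.trans (mul_le_mul_of_nonneg_left (by linarith [hlow _ hyS]) hwi)
      have h4 : β⁻¹ = κ / (2 * (n + 2)) / (1 + M₀) := by
        rw [hβdef, inv_div]; field_simp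
      rw [h4, div_le_iff₀ (by linarith)]; exact h3
    have hw1 : w i ≤ 1 := by
      rw [← hw.2]; exact Finset.single_le_sum (fun j _ => hw.1 j) (Finset.mem_univ i)
    obtain ⟨z, hz, hz1, hz2⟩ := exists_two_point hf hw (fun j => hZS (hyZ j)) i
    rw [e1] at hz1
    rw [e2] at hz2
    obtain ⟨a1, a2, a3⟩ := two_point_secG hΩ hΩc hf hx hh hβ hwβ hw1 hyS hz hz1 (hz2.trans hs)
    exact hyO ⟨⟨a1, a2⟩, a3⟩
  obtain ⟨F, a, b, hF1, hab, hF2⟩ := geometric_hahn_banach_compact_closed (convex_convexHull ℝ Γ)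
    hΓc.convexHull_of_finiteDimensional ((convex_singleton x).prod (convex_Iic (f x + h)))
    (isClosed_singleton.prod isClosed_Iic) hdisj
  set F₁ : E n →L[ℝ] ℝ := F.comp (ContinuousLinearMap.inl ℝ (E n) ℝ) with hF₁
  set c := F (0, 1) with hc
  have hFv : ∀ v s, F (v, s) = F₁ v + c * s := by
    intro v s
    have : ((v, s) : E n × ℝ) = (v, 0) + s • (0, 1) := by simp
    rw [this, map_add, map_smul]
    simp [hF₁, hc, mul_comm]
  have hZF : ∀ y ∈ Z, F₁ y + c * f y < F₁ x + c * (f x + h) := by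
    intro y hy
    have h1 := hF1 (y, f y) (subset_convexHull ℝ Γ ⟨y, hy, rfl⟩)
    have h2 := hF2 (x, f x + h) ⟨rfl, self_mem_Iic⟩
    rw [hFv] at h1 h2
    linarith
  have hc0 : c ≤ 0 := by
    by_contra hcon
    push Not at hcon
    have h2 := hF2 (x, min (f x + h) ((b - F₁ x) / c))
      ⟨rfl, mem_Iic.2 (min_le_left _ _)⟩
    rw [hFv] at h2
    have h3 : c * min (f x + h) ((b - F₁ x) / c) ≤ c * ((b - F₁ x) / c) :=
      mul_le_mul_of_nonneg_left (min_le_right _ _) hcon.le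
    rw [mul_div_cancel₀ _ hcon.ne'] at h3
    linarith
  have hcne : c ≠ 0 := by
    intro hcz
    have hd : ∃ d : E n, d ≠ 0 ∧ 0 ≤ F₁ d := by
      have hd0 : (EuclideanSpace.single (0 : Fin n) (1:ℝ) : E n) ≠ 0 := by
        intro h0
        have := congrArg norm h0
        simp at this
      rcases le_total 0 (F₁ (EuclideanSpace.single (0 : Fin n) (1:ℝ))) with h0 | h0
      · exact ⟨_, hd0, h0⟩
      · exact ⟨-_, neg_ne_zero.2 hd0, by rw [map_neg]; linarith⟩
    obtain ⟨d, hd0, hdF⟩ := hd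
    obtain ⟨s, hs, hsf⟩ := exists_ray_mem_frontier hΩ hbd hx hd0
    have := hZF _ (Or.inr hsf)
    rw [hcz, map_add, map_smul, smul_eq_mul] at this
    nlinarith [mul_nonneg hs hdF]
  have hcneg : c < 0 := lt_of_le_of_ne hc0 hcne
  refine ⟨f x + h + F₁ x / c, (InnerProductSpace.toDual ℝ (E n)).symm (-(c⁻¹) • F₁), ?_, ?_⟩
  · rw [InnerProductSpace.toDual_symm_apply]
    simp only [smul_apply, smul_eq_mul]
    ring
  · intro y hy hlt
    rw [InnerProductSpace.toDual_symm_apply] at hlt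
    simp only [smul_apply, smul_eq_mul] at hlt
    have hyZ : y ∉ Z := by
      intro hyZ
      have h1 := hZF y hyZ
      have h2 := mul_lt_mul_of_neg_left hlt hcneg
      have h3 : c * (f x + h + F₁ x / c + -c⁻¹ * F₁ y) = c * (f x + h) + F₁ x - F₁ y := by
        field_simp
        ring
      linarith
    have hyf : y ∉ frontier Ω := fun h' => hyZ (Or.inr h')
    have hyΩ : y ∈ Ω := by
      by_contra h'
      exact hyf (by rw [hΩ.frontier_eq]; exact ⟨hy, h'⟩)
    have hyO : y ∈ O := by
      by_contra h'
      exact hyZ (Or.inl ⟨hy, h'⟩)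
    refine ⟨hyΩ, β⁻¹ • (y - x), ⟨subset_closure hyO.1.1, subset_closure hyO.1.2, hyO.2.le⟩, ?_⟩
    rw [smul_smul, mul_inv_cancel₀ hβ0.ne', one_smul]

/-- The normalized setup, with a lower bound for `u` on the second half of the time interval. -/
structure Setup (m : ℕ) (lam Lam p M₀ κ T : ℝ) (Ω : Set (E n)) (y₀ : E n)
    (u : E n → ℝ → ℝ) : Prop where
  hnm : m + 2 = n
  hm : 0 < m
  hp : p = (m : ℝ)⁻¹
  hlam : 0 < lam
  hLam : 0 < Lam
  isOpen : IsOpen Ω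
  convex : Convex ℝ Ω
  subset_ball : Ω ⊆ ball y₀ 1
  hT : 0 < T
  reg : ParabolicRegular Ω (-T) 0 u
  sub : ViscSubsolution Lam p Ω (-T) 0 u
  sup : ViscSupersolution lam p Ω (-T) 0 u
  one_lt : ∀ x ∈ frontier Ω, ∀ t ∈ Icc (-T) 0, 1 < u x t
  M₀_nonneg : 0 ≤ M₀
  κ_pos : 0 < κ
  κ_le : κ ≤ 1
  hM₀ : 4 * (m / lam) ^ m ≤ M₀ ^ 2 * (T / 2) ^ m

/-- The dilation constant of the balanced plane. -/
def planeC (n : ℕ) (M₀ κ : ℝ) : ℝ := 2 * (1 + M₀) * (n + 2) / κ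

/-- The constant relating elapsed time to the size of sections. -/
def bigC (n m : ℕ) (lam M₀ κ : ℝ) : ℝ :=
  144 * (m / lam) ^ m * (planeC n M₀ κ * n) ^ (2 * n) * n ^ 2

/-- `G` contains a frame that spans, together with `e`, a volume at least `v`. -/
def Big (i₀ : Fin n) (e : E n) (G : Set (E n)) (v : ℝ) : Prop :=
  ∃ g : Fin n → E n, (∀ i, g i ∈ G) ∧ v ≤ frameDet (Function.update g i₀ e)

namespace Setup

variable {m : ℕ} {lam Lam p M₀ κ T : ℝ} {Ω : Set (E n)} {y₀ : E n} {u : E n → ℝ → ℝ}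

lemma isBounded (S : Setup m lam Lam p M₀ κ T Ω y₀ u) : Bornology.IsBounded Ω :=
  isBounded_ball.subset S.subset_ball

lemma norm_sub_le (S : Setup m lam Lam p M₀ κ T Ω y₀ u) {x : E n} (hx : x ∈ closure Ω) :
    ‖x - y₀‖ ≤ 1 := by
  have := closure_mono S.subset_ball hx
  have := closure_ball_subset_closedBall this
  rwa [mem_closedBall, dist_eq_norm] at this

lemma mem_of_lt (S : Setup m lam Lam p M₀ κ T Ω y₀ u) {x : E n} (hx : x ∈ closure Ω) {t : ℝ}
    (ht : t ∈ Icc (-T) 0) (h : u x t < 1) : x ∈ Ω := by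
  by_contra h'
  have := S.one_lt x (by rw [S.isOpen.frontier_eq]; exact ⟨hx, h'⟩) t ht
  linarith

lemma mem_Icc (S : Setup m lam Lam p M₀ κ T Ω y₀ u) {t : ℝ} (ht : -T / 2 ≤ t) (ht0 : t ≤ 0) :
    t ∈ Icc (-T) 0 :=
  have := S.hT
  ⟨by linarith, ht0⟩

lemma neg_M₀_le (S : Setup m lam Lam p M₀ κ T Ω y₀ u) {y : E n} (hy : y ∈ closure Ω) {t : ℝ}
    (ht : -T / 2 ≤ t) (ht0 : t ≤ 0) : -M₀ ≤ u y t := by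
  have hT := S.hT
  have hM := S.M₀_nonneg
  rcases le_or_gt 1 (u y t) with h1 | h1
  · linarith
  have := S.reg.rise S.hnm S.hm S.hp S.hlam S.isBounded S.sup (s := -T) (t := t) le_rfl
    (by linarith) ht0 1 0 y₀ (ContinuousLinearMap.id ℝ (E n))
    (by simp)
    (fun y hy hlt => by
      simp only [inner_zero_left, add_zero] at hlt
      exact ⟨S.mem_of_lt hy ⟨le_rfl, by linarith⟩ hlt, by simpa using S.norm_sub_le hy⟩) hy
    (by simpa using h1)
  simp only [inner_zero_left, add_zero] at this
  have hd : LinearMap.det ((ContinuousLinearMap.id ℝ (E n) : E n →L[ℝ] E n) : E n →ₗ[ℝ] E n) = 1 := by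
    simp
  rw [hd, one_pow, mul_one] at this
  have h2 : (1 - u y t) ^ 2 * (T / 2) ^ m ≤ M₀ ^ 2 * (T / 2) ^ m := by
    refine le_trans ?_ (this.trans S.hM₀)
    gcongr
    linarith
  have h3 := le_of_mul_le_mul_right h2 (by positivity)
  linarith [(abs_le.1 (abs_le_of_sq_le_sq h3 hM)).2]

/-- Sections at interior points contain a small ball. -/
lemma exists_closedBall_subset_secG {f : E n → ℝ} {x : E n} {h : ℝ} (hΩ : IsOpen Ω)
    (hf : ContinuousOn f (closure Ω)) (hx : x ∈ Ω) (hh : 0 < h) :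
    ∃ r > 0, ∀ g : E n, ‖g‖ ≤ r → g ∈ secG (closure Ω) f x h := by
  have hfa : ContinuousAt f x := hf.continuousAt (Filter.mem_of_superset (hΩ.mem_nhds hx)
    subset_closure)
  have h1 : ∀ᶠ y in nhds x, y ∈ Ω ∧ f y < f x + h :=
    (hΩ.eventually_mem hx).and
      (hfa.eventually_lt continuousAt_const (by linarith))
  obtain ⟨r, hr, hball⟩ := Metric.eventually_nhds_iff.1 h1
  refine ⟨r / 2, by positivity, fun g hg => ?_⟩
  have a1 := hball (y := x + g) (by simp; linarith)
  have a2 := hball (y := x - g) (by simp; linarith)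
  exact ⟨subset_closure a1.1, subset_closure a2.1, by linarith [a1.2, a2.2]⟩

/-- If little growth occurred at `x` on `[t',t]`, then the sections at time `t'` are large. -/
lemma big_after (S : Setup m lam Lam p M₀ κ T Ω y₀ u) (i₀ : Fin n) {e : E n} (he : ‖e‖ = 1)
    {x : E n} (hx : x ∈ Ω) {t' t h a : ℝ} (ht' : -T / 2 ≤ t') (htt : t' < t) (ht : t ≤ 0)
    (hux : u x t' ≤ 1 - κ) (hh : 0 < h) (hhκ : h ≤ κ / 2) (ha : 0 < a)
    (hX : ∀ s : ℝ, s • e ∈ secG (closure Ω) (fun y => u y t') x h → |s| ≤ 3 * h / a)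
    (hgrow : u x t ≤ u x t' + h / 2) :
    ∃ v > 0, a ^ 2 * (t - t') ^ m ≤ bigC n m lam M₀ κ * v ^ 2 ∧
      Big i₀ e (secG (closure Ω) (fun y => u y t') x h) v := by
  have hn0 : 0 < n := by have := S.hnm; omega
  have : NeZero n := ⟨hn0.ne'⟩
  have hnpos : (0:ℝ) < n := by exact_mod_cast hn0
  have hn1 : (1:ℝ) ≤ n := by exact_mod_cast hn0
  have ht'I := S.mem_Icc ht' (by linarith)
  have hcvx := S.reg.conv t' ht'I
  have hcont := S.reg.continuousOn_slice ht'I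
  obtain ⟨r, hr, hball⟩ := exists_closedBall_subset_secG S.isOpen hcont hx hh
  obtain ⟨g₁, hg₁, hg₁d⟩ := exists_frame_of_ball i₀ he hr.le
  obtain ⟨g, hgG, hD, hmax⟩ := exists_maximal_frame
    (isCompact_secG S.isBounded.isCompact_closure hcont) (convex_secG hcvx)
    (fun _ => secG_neg) (zero_mem_secG (subset_closure hx) hh.le) i₀ hX
    (fun i => hball _ (hg₁ i)) ((pow_pos hr _).trans_le hg₁d)
  obtain ⟨c, q, hcx, hplane⟩ := exists_balanced_plane S.isOpen S.convex S.isBounded hcvx hcont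
    (fun y hy => S.one_lt y hy t' ht'I) S.M₀_nonneg
    (fun y hy => S.neg_M₀_le hy ht' (by linarith)) hx S.κ_pos S.κ_le hux hh hhκ
  change ∀ y ∈ closure Ω, u y t' < c + ⟪q, y⟫ → y ∈ Ω ∧
    ∃ g ∈ secG (closure Ω) (fun y => u y t') x h, y - x = planeC n M₀ κ • g at hplane
  set β := planeC n M₀ κ with hβ
  have hβpos : 0 < β := by
    have := S.M₀_nonneg; have := S.κ_pos
    rw [hβ, planeC]; positivity
  set X := 3 * h / a with hXdef
  have hXpos : 0 < X := by positivity
  set w : Fin n → ℝ := fun i => β * n * (Function.update (fun _ => 1) i₀ (n * X) : Fin n → ℝ) i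
    with hw
  have hwpos : ∀ i, 0 < w i := fun i => by
    rcases eq_or_ne i i₀ with rfl | hi
    · simp only [hw, Function.update_self]; positivity
    · simp only [hw, Function.update_of_ne hi]; positivity
  have hprod : ∏ i, w i = (β * n) ^ n * (n * X) := by
    rw [hw, Finset.prod_mul_distrib, Finset.prod_update_of_mem (Finset.mem_univ _)]
    simp
  obtain ⟨M, hM, hMdet, hMsum, hMc⟩ := exists_frame_coords _ w hD hwpos
  have hsec : ∀ y ∈ closure Ω, u y t' < c + ⟪q, y⟫ → y ∈ Ω ∧ ‖M (y - x)‖ ≤ 1 := by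
    intro y hy hlt
    obtain ⟨hyΩ, γ, hγ, hyx⟩ := hplane y hy hlt
    refine ⟨hyΩ, ?_⟩
    have hγs := hMsum γ
    rw [hγs] at hγ
    obtain ⟨h1, h2⟩ := hmax _ hγ
    have hcoord : ∀ i, |M (y - x) i| ≤ 1 / n := by
      intro i
      rw [hyx, map_smul]
      simp only [PiLp.smul_apply, smul_eq_mul, abs_mul, abs_of_pos hβpos]
      rw [le_div_iff₀ hnpos]
      rcases eq_or_ne i i₀ with rfl | hi
      · rw [abs_mul, abs_of_pos (hwpos i)] at h2
        simp only [hw, Function.update_self] at h2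
        have h3 : β * |M γ i| * n * (n * X) ≤ 1 * (n * X) := by linarith
        exact le_of_mul_le_mul_right h3 (by positivity)
      · have h1' := h1 i hi
        rw [abs_mul, abs_of_pos (hwpos i)] at h1'
        simp only [hw, Function.update_of_ne hi] at h1'
        linarith
    have hsq : ‖M (y - x)‖ ^ 2 ≤ 1 := by
      rw [EuclideanSpace.norm_sq_eq]
      calc ∑ i, ‖M (y - x) i‖ ^ 2 ≤ ∑ _i : Fin n, (1 / (n:ℝ)) ^ 2 := by
            refine Finset.sum_le_sum fun i _ => ?_
            rw [Real.norm_eq_abs]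
            exact pow_le_pow_left₀ (abs_nonneg _) (hcoord i) 2
        _ = 1 / n := by simp; field_simp
        _ ≤ 1 := by rw [div_le_one hnpos]; exact hn1
    exact (sq_le_one_iff₀ (norm_nonneg _)).1 hsq
  have hℓ : h / 2 ≤ c + ⟪q, x⟫ - u x t := by linarith
  have hrise := S.reg.rise S.hnm S.hm S.hp S.hlam S.isBounded S.sup ht'I.1 htt ht c q x M hM hsec
    (subset_closure hx) (by linarith)
  set D := frameDet (Function.update g i₀ e) with hDdef
  refine ⟨D, hD, ?_, g, hgG, le_rfl⟩
  set dM := LinearMap.det (M : E n →ₗ[ℝ] E n)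
  have hτ : 0 < t - t' := by linarith
  have h1 : (h / 2) ^ 2 * (t - t') ^ m ≤ 4 * (m / lam) ^ m * ((∏ i, w i) * D) ^ 2 := by
    calc (h / 2) ^ 2 * (t - t') ^ m ≤ (c + ⟪q, x⟫ - u x t) ^ 2 * (t - t') ^ m := by gcongr
      _ = (c + ⟪q, x⟫ - u x t) ^ 2 * (t - t') ^ m * (dM ^ 2 * ((∏ i, w i) * D) ^ 2) := by
        rw [hMdet, mul_one]
      _ = ((c + ⟪q, x⟫ - u x t) ^ 2 * (t - t') ^ m * dM ^ 2) * ((∏ i, w i) * D) ^ 2 := by ring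
      _ ≤ _ := by gcongr
  rw [hprod] at h1
  have h2 : a ^ 2 * (t - t') ^ m * (h / 2) ^ 2 ≤ bigC n m lam M₀ κ * D ^ 2 * (h / 2) ^ 2 := by
    calc a ^ 2 * (t - t') ^ m * (h / 2) ^ 2 = a ^ 2 * ((h / 2) ^ 2 * (t - t') ^ m) := by ring
      _ ≤ a ^ 2 * (4 * (m / lam) ^ m * ((β * n) ^ n * (n * X) * D) ^ 2) := by gcongr
      _ = bigC n m lam M₀ κ * D ^ 2 * (h / 2) ^ 2 := by
        rw [hXdef, bigC, ← hβ, pow_mul']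
        field_simp
        ring
  exact le_of_mul_le_mul_right h2 (by positivity)

end Setup

/-- Bounds for a convex function at a combination of section vectors. -/
lemma add_sum_secG {S : Set (E n)} {f : E n → ℝ} (hf : ConvexOn ℝ S f) {x : E n} (hx : x ∈ S)
    {h : ℝ} (hh : 0 ≤ h) {ι : Type*} (s : Finset ι) {g : ι → E n} {c : ι → ℝ}
    (hg : ∀ i ∈ s, g i ∈ secG S f x h) (hc : ∑ i ∈ s, |c i| ≤ 1) :
    x + ∑ i ∈ s, c i • g i ∈ S ∧ f (x + ∑ i ∈ s, c i • g i) ≤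
      f x + h + ∑ i ∈ s, c i * ((f (x + g i) - f (x - g i)) / 2) := by
  set ε : ι → ℝ := fun i => if 0 ≤ c i then 1 else -1 with hε
  have hεc : ∀ i, |c i| * ε i = c i := fun i => by
    simp only [hε]; split_ifs with h
    · rw [mul_one, abs_of_nonneg h]
    · rw [abs_of_neg (not_le.1 h)]; ring
  have hp : ∀ i ∈ s, x + ε i • g i ∈ S ∧
      f (x + ε i • g i) ≤ f x + h + ε i * ((f (x + g i) - f (x - g i)) / 2) := fun i hi => by
    obtain ⟨h1, h2, h3⟩ := hg i hi
    simp only [hε]; split_ifs with h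
    · rw [one_smul]; exact ⟨h1, by linarith⟩
    · rw [neg_smul, one_smul, ← sub_eq_add_neg]; exact ⟨h2, by linarith⟩
  have he : x + ∑ i ∈ s, c i • g i =
      (1 - ∑ i ∈ s, |c i|) • x + ∑ i ∈ s, |c i| • (x + ε i • g i) := by
    simp only [smul_add, smul_smul, hεc, Finset.sum_add_distrib]
    rw [← Finset.sum_smul, ← add_assoc, ← add_smul]; simp
  rw [he]
  have h0 : 0 ≤ 1 - ∑ i ∈ s, |c i| := by linarith
  have h1 : (1 - ∑ i ∈ s, |c i|) + ∑ i ∈ s, |c i| = 1 := by ring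
  refine ⟨?_, (hf.map_add_sum_le (fun i _ => abs_nonneg (c i)) h1 (fun i hi => (hp i hi).1) h0
    hx).trans ?_⟩
  · have := hf.1.sum_mem (t := Finset.insertNone s)
      (w := fun o => o.elim (1 - ∑ i ∈ s, |c i|) fun i => |c i|)
      (z := fun o => o.elim x fun i => x + ε i • g i) ?_ ?_ ?_
    · rw [Finset.sum_insertNone] at this
      exact this
    · rintro (_ | i) _
      · exact h0
      · exact abs_nonneg _
    · rw [Finset.sum_insertNone]; exact h1
    · rintro (_ | i) hi
      · exact hx
      · exact (hp i (by simpa using hi)).1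
  · simp only [smul_eq_mul]
    have : ∑ i ∈ s, |c i| * f (x + ε i • g i) ≤
        ∑ i ∈ s, (|c i| * (f x + h) + c i * ((f (x + g i) - f (x - g i)) / 2)) := by
      refine Finset.sum_le_sum fun i hi => ?_
      refine (mul_le_mul_of_nonneg_left (hp i hi).2 (abs_nonneg _)).trans (le_of_eq ?_)
      rw [mul_add, ← mul_assoc, hεc]
    rw [Finset.sum_add_distrib, ← Finset.sum_mul] at this
    nlinarith [mul_nonneg h0 hh]

/-- Growth along a ray on which `f` is nearly affine. -/
lemma ray_le {S : Set (E n)} {f : E n → ℝ} (hf : ConvexOn ℝ S f) {x e : E n} (hx : x ∈ S)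
    {ρ δ r : ℝ} (hρ : 0 < ρ) (hδ : 0 ≤ δ) (he : x + (2 * ρ) • e ∈ S)
    (hD : f (x + (2 * ρ) • e) ≤ 2 * f (x + ρ • e) - f x + δ) (hr : 0 ≤ r) (hr2 : r ≤ 2 * ρ) :
    x + r • e ∈ S ∧ f (x + r • e) ≤ f x + r / ρ * (f (x + ρ • e) - f x) + δ := by
  have hcv := hf.2
  have hmem : ∀ r, 0 ≤ r → r ≤ 2 * ρ → x + r • e ∈ S := fun r h0 h2 => by
    have hd : r / (2 * ρ) ≤ 1 := (div_le_one (by positivity)).2 h2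
    have := hf.1 hx he (show 0 ≤ 1 - r / (2 * ρ) by linarith)
      (show 0 ≤ r / (2 * ρ) by positivity) (by ring)
    convert this using 1
    rw [smul_add, smul_smul, div_mul_cancel₀ _ (by positivity), ← add_assoc, ← add_smul]; simp
  refine ⟨hmem r hr hr2, ?_⟩
  have h1 := hmem ρ hρ.le (by linarith)
  rcases le_total r ρ with h | h
  · have hd : r / ρ ≤ 1 := (div_le_one hρ).2 h
    have := hcv hx h1 (show 0 ≤ 1 - r / ρ by linarith) (show 0 ≤ r / ρ by positivity) (by ring)
    have e1 : (1 - r / ρ) • x + (r / ρ) • (x + ρ • e) = x + r • e := by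
      rw [smul_add, smul_smul, div_mul_cancel₀ _ hρ.ne', ← add_assoc, ← add_smul]; simp
    rw [e1] at this
    simp only [smul_eq_mul] at this
    linarith
  · set μ := r / ρ - 1 with hμ
    have hd : 0 ≤ μ := by rw [hμ, sub_nonneg, one_le_div hρ]; exact h
    have hd2 : μ ≤ 1 := by
      rw [hμ, sub_le_iff_le_add, div_le_iff₀ hρ]; linarith
    have := hcv h1 he (show 0 ≤ 1 - μ by linarith) hd (by ring)
    have e1 : (1 - μ) • (x + ρ • e) + μ • (x + (2 * ρ) • e) = x + r • e := by
      have : r = (1 - μ) * ρ + μ * (2 * ρ) := by rw [hμ]; field_simp; ring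
      conv_rhs => rw [this]
      module
    rw [e1] at this
    simp only [smul_eq_mul] at this
    have h5 := mul_le_mul_of_nonneg_left hD hd
    have h6 : r / ρ = μ + 1 := by rw [hμ]; ring
    rw [h6]
    nlinarith [mul_le_mul_of_nonneg_right hd2 hδ]

/-- The constant in the barrier from above. -/
def dropC (n m : ℕ) (Lam : ℝ) : ℝ := (2 * Lam) ^ m * 4 ^ n * (8 * n) ^ (2 * n)

namespace Setup

variable {m : ℕ} {lam Lam p M₀ κ T : ℝ} {Ω : Set (E n)} {y₀ : E n} {u : E n → ℝ → ℝ}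

/-- The values near a nearly affine direction cannot drop fast. -/
lemma drop_at (S : Setup m lam Lam p M₀ κ T Ω y₀ u) (i₀ : Fin n) {x e : E n} {t' t ρ h θ v : ℝ}
    (ht' : -T ≤ t') (htt : t' < t) (ht : t ≤ 0) (hx : x ∈ Ω) (hρ : 0 < ρ) (hh : 0 < h)
    (he : x + (2 * ρ) • e ∈ closure Ω)
    (hD : u (x + (2 * ρ) • e) t ≤ 2 * u (x + ρ • e) t - u x t + h / 5)
    (hθ : 0 < θ) (hθ1 : θ ≤ 1) (hv : 0 < v)
    (hbig : Big i₀ e (secG (closure Ω) (fun y => u y t) x h) v)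
    (hcond : dropC n m Lam * (t - t') ^ m * h ^ 2 < θ ^ (2 * m + 2) * (ρ * v) ^ 2) :
    u (x + ρ • e) t - 3 * (θ * h) ≤ u (x + ρ • e) t' := by
  have hn0 : 0 < n := by have := S.hnm; omega
  have hnpos : (0:ℝ) < n := by exact_mod_cast hn0
  have hn1 : (1:ℝ) ≤ n := by exact_mod_cast hn0
  have htI : t ∈ Icc (-T) 0 := ⟨by linarith, ht⟩
  have hcvx := S.reg.conv t htI
  have hcv := hcvx.2
  obtain ⟨g, hgG, hDv⟩ := hbig
  set D := frameDet (Function.update g i₀ e) with hDdef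
  have hDpos : 0 < D := hv.trans_le hDv
  set w : Fin n → ℝ := Function.update (fun _ => 1 / (8 * n)) i₀ (ρ / 8) with hw
  have hwpos : ∀ i, 0 < w i := fun i => by
    rcases eq_or_ne i i₀ with rfl | hi
    · simp only [hw, Function.update_self]; positivity
    · simp only [hw, Function.update_of_ne hi]; positivity
  have hprod : ρ / (8 * n) ^ n ≤ ∏ i, w i := by
    rw [hw, Finset.prod_update_of_mem (Finset.mem_univ _)]
    simp only [Finset.prod_const, Finset.card_sdiff, Finset.card_univ, Fintype.card_fin]
    have e1 : (8 * (n:ℝ)) ^ n = (8 * n) ^ (n - 1) * (8 * n) := by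
      rw [← pow_succ]; congr 1; omega
    simp only [Finset.inter_univ, Finset.card_singleton]
    have e2 : ρ / 8 * (1 / (8 * (n:ℝ))) ^ (n - 1) = ρ * n / (8 * n) ^ n := by
      rw [e1, one_div, inv_pow]; field_simp
    rw [e2]
    gcongr
    exact le_mul_of_one_le_right hρ.le hn1
  obtain ⟨M, hM, hMdet, hMsum, -⟩ := exists_frame_coords _ w hDpos hwpos
  set q₀ : E n := WithLp.toLp 2 fun i =>
    if i = i₀ then (u (x + ρ • e) t - u x t) / 8
    else ((u (x + g i) t - u (x - g i) t) / 2) / (8 * n) with hq₀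
  refine S.reg.drop_scaled S.hnm S.hm S.hp S.hLam S.isBounded S.sub ht' htt ht
    (ContinuousLinearMap.adjoint M q₀) (x + ρ • e) M hM hh hθ hθ1 ?_ ?_
  · intro y hy
    rw [ContinuousLinearMap.adjoint_inner_left]
    set z := M (y - (x + ρ • e)) with hz
    have hzi : ∀ i, |z i| ≤ 1 := fun i => (PiLp.norm_apply_le z i).trans hy
    have hysum := hMsum (y - (x + ρ • e))
    rw [← hz, ← Finset.add_sum_erase _ _ (Finset.mem_univ i₀)] at hysum
    simp only [Function.update_self] at hysum
    have hw0 : w i₀ = ρ / 8 := by simp [hw]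
    have hwi : ∀ i ∈ Finset.univ.erase i₀, w i = 1 / (8 * n) := fun i hi => by
      simp [hw, Finset.ne_of_mem_erase hi]
    have hsum2 : ∑ i ∈ Finset.univ.erase i₀, (z i * w i) • Function.update g i₀ e i =
        (1 / 8 : ℝ) • ∑ i ∈ Finset.univ.erase i₀, (z i / n) • g i := by
      rw [Finset.smul_sum]
      refine Finset.sum_congr rfl fun i hi => ?_
      rw [Function.update_of_ne (Finset.ne_of_mem_erase hi), hwi i hi, smul_smul]
      congr 1; field_simp
    rw [hsum2, hw0] at hysum
    obtain ⟨hz1, hz2⟩ := add_sum_secG hcvx (subset_closure hx) hh.le (Finset.univ.erase i₀)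
      (g := g) (c := fun i => z i / n) (fun i _ => hgG i) (by
        calc ∑ i ∈ Finset.univ.erase i₀, |z i / n| ≤ ∑ _i ∈ Finset.univ.erase i₀, 1 / (n:ℝ) := by
              refine Finset.sum_le_sum fun i _ => ?_
              rw [abs_div, abs_of_pos hnpos]
              gcongr
              exact hzi i
          _ ≤ ∑ _i : Fin n, 1 / (n:ℝ) :=
              Finset.sum_le_sum_of_subset_of_nonneg (Finset.erase_subset _ _)
                fun _ _ _ => by positivity
          _ = 1 := by simp [hnpos.ne'])
    set Z := x + ∑ i ∈ Finset.univ.erase i₀, (z i / n) • g i with hZ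
    set r := 8 / 7 * (ρ + z i₀ * (ρ / 8)) with hr
    have hz0 := abs_le.1 (hzi i₀)
    have hr0 : 0 ≤ r := by rw [hr]; nlinarith
    have hr2 : r < 2 * ρ := by rw [hr]; nlinarith
    obtain ⟨hr3, hr4⟩ := ray_le hcvx (subset_closure hx) hρ (show 0 ≤ h / 5 by positivity) he hD
      hr0 hr2.le
    have hye : y = (7 / 8 : ℝ) • (x + r • e) + (1 / 8 : ℝ) • Z := by
      have : y = (x + ρ • e) + (y - (x + ρ • e)) := by abel
      rw [this, hysum, hZ, hr]
      module
    have hint : x + r • e ∈ interior Ω := by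
      have hd : r / (2 * ρ) < 1 := (div_lt_one (by positivity)).2 hr2
      have := S.convex.combo_interior_closure_mem_interior
        (show x ∈ interior Ω by rwa [S.isOpen.interior_eq]) he
        (show 0 < 1 - r / (2 * ρ) by linarith) (show 0 ≤ r / (2 * ρ) by positivity) (by ring)
      convert this using 1
      rw [smul_add, smul_smul, div_mul_cancel₀ _ (by positivity), ← add_assoc, ← add_smul]; simp
    constructor
    · rw [hye, ← S.isOpen.interior_eq]
      exact S.convex.combo_interior_closure_mem_interior hint hz1 (by norm_num) (by norm_num)
        (by norm_num)
    · have h1 := hcv hr3 hz1 (show (0:ℝ) ≤ 7 / 8 by norm_num) (show (0:ℝ) ≤ 1 / 8 by norm_num)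
        (by norm_num)
      rw [← hye] at h1
      simp only [smul_eq_mul] at h1
      have hin : ⟪q₀, z⟫ = z i₀ / 8 * (u (x + ρ • e) t - u x t) +
          1 / 8 * ∑ i ∈ Finset.univ.erase i₀, z i / n * ((u (x + g i) t - u (x - g i) t) / 2) := by
        rw [PiLp.inner_apply, ← Finset.add_sum_erase _ _ (Finset.mem_univ i₀), Finset.mul_sum]
        congr 1
        · simp [hq₀]; ring
        · refine Finset.sum_congr rfl fun i hi => ?_
          simp [hq₀, Finset.ne_of_mem_erase hi]; field_simp
      rw [hin]
      have hrr : r / ρ = 8 / 7 * (1 + z i₀ / 8) := by rw [hr]; field_simp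
      rw [hrr] at hr4
      linarith
  · set dM := LinearMap.det (M : E n →ₗ[ℝ] E n)
    have h1 : ρ * v / (8 * n) ^ n ≤ (∏ i, w i) * D := by
      calc ρ * v / (8 * n) ^ n = ρ / (8 * n) ^ n * v := by ring
        _ ≤ _ := by
          gcongr
          exact Finset.prod_nonneg fun i _ => (hwpos i).le
    have hLam := S.hLam
    have hk : dM ^ 2 * (ρ * v) ^ 2 ≤ (8 * n) ^ (2 * n) := by
      have h2 : dM ^ 2 * (ρ * v / (8 * n) ^ n) ^ 2 ≤ 1 := by
        rw [← hMdet, ← hDdef]; gcongr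
      rw [div_pow, ← pow_mul', ← mul_div_assoc, div_le_one (by positivity)] at h2
      exact h2
    have hρv : 0 < (ρ * v) ^ 2 := by positivity
    have h3 : (2 * Lam) ^ m * 4 ^ n * (t - t') ^ m * h ^ 2 * dM ^ 2 * (ρ * v) ^ 2 <
        θ ^ (2 * m + 2) * (ρ * v) ^ 2 := by
      refine lt_of_le_of_lt ?_ hcond
      have hτ : 0 < t - t' := by linarith
      calc _ = (2 * Lam) ^ m * 4 ^ n * (t - t') ^ m * h ^ 2 * (dM ^ 2 * (ρ * v) ^ 2) := by ring
        _ ≤ (2 * Lam) ^ m * 4 ^ n * (t - t') ^ m * h ^ 2 * (8 * n) ^ (2 * n) := by gcongr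
        _ = _ := by rw [dropC]; ring
    exact lt_of_mul_lt_mul_right h3 hρv.le

end Setup

/-- The symmetric second difference of `f` at `x` in direction `e`. -/
def secondDiff (f : E n → ℝ) (x e : E n) (s : ℝ) : ℝ :=
  f (x + s • e) + f (x - s • e) - 2 * f x

lemma add_smul_mem_of_abs_le {S : Set (E n)} (hS : Convex ℝ S) {x e : E n} {R s : ℝ}
    (hp : x + R • e ∈ S) (hm : x - R • e ∈ S) (hs : |s| ≤ R) : x + s • e ∈ S := by
  rcases (abs_nonneg s |>.trans hs).eq_or_lt with h0 | h0
  · rw [← h0] at hs hp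
    rw [abs_nonpos_iff.1 hs]; exact hp
  · have h1 := abs_le.1 hs
    have := hS hp hm (show 0 ≤ (R + s) / (2 * R) from div_nonneg (by linarith) (by linarith))
      (show 0 ≤ (R - s) / (2 * R) from div_nonneg (by linarith) (by linarith))
      (by field_simp; ring)
    convert this using 1
    have e1 : (1:ℝ) = (R + s) / (2 * R) + (R - s) / (2 * R) := by field_simp; ring
    have e2 : s = (R + s) / (2 * R) * R - (R - s) / (2 * R) * R := by field_simp; ring
    conv_lhs => rw [e2, ← one_smul ℝ x, e1]
    module

lemma secondDiff_mul_le {S : Set (E n)} {f : E n → ℝ} (hf : ConvexOn ℝ S f) {x e : E n}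
    {s R : ℝ} (hp : x + R • e ∈ S) (hm : x - R • e ∈ S) (hs : 0 ≤ s) (hsR : s ≤ R) :
    secondDiff f x e s * R ≤ secondDiff f x e R * s := by
  rcases (hs.trans hsR).eq_or_lt with h0 | h0
  · have : s = 0 := by linarith
    rw [← h0, this]
  have hx : x ∈ S := by simpa using add_smul_mem_of_abs_le hf.1 hp hm (s := 0) (by simpa using h0.le)
  have hd : s / R ≤ 1 := (div_le_one h0).2 hsR
  have hd0 : 0 ≤ s / R := by positivity
  have i1 := hf.2 hx hp (show 0 ≤ 1 - s / R by linarith) hd0 (by ring)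
  have i2 := hf.2 hx hm (show 0 ≤ 1 - s / R by linarith) hd0 (by ring)
  have hsR' : s = s / R * R := by field_simp
  have e1 : (1 - s / R) • x + (s / R) • (x + R • e) = x + s • e := by
    conv_rhs => rw [hsR']
    module
  have e2 : (1 - s / R) • x + (s / R) • (x - R • e) = x - s • e := by
    conv_rhs => rw [hsR']
    module
  rw [e1] at i1
  rw [e2] at i2
  simp only [smul_eq_mul] at i1 i2
  have h3 : secondDiff f x e s ≤ s / R * secondDiff f x e R := by
    unfold secondDiff; linarith
  calc _ ≤ s / R * secondDiff f x e R * R := by gcongr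
    _ = _ := by field_simp

namespace Setup

variable {m : ℕ} {lam Lam p M₀ κ T : ℝ} {Ω : Set (E n)} {y₀ : E n} {u : E n → ℝ → ℝ}

/-- One backward time step at a point where `u` bends in direction `e`, and no more at scale `2ρ`
than at scale `ρ`. -/
lemma step (S : Setup m lam Lam p M₀ κ T Ω y₀ u) (i₀ : Fin n) {x e : E n} (he : ‖e‖ = 1)
    {t' t ρ a χ θ v h : ℝ} (ht' : -T / 2 ≤ t') (htt : t' < t) (ht : t ≤ 0) (hx : x ∈ Ω)
    (hρ : 0 < ρ) (hp : x + (2 * ρ) • e ∈ closure Ω) (hm : x - (2 * ρ) • e ∈ closure Ω)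
    (hux : u x t ≤ 1 - κ) (ha : 0 < a) (hχ : 0 < χ) (hχ1 : χ ≤ 1 / 40) (hθ : 0 < θ)
    (hθ1 : θ ≤ 1 / 20) (hh : h = 10 * χ * a * ρ) (hhκ : h ≤ κ / 2)
    (hW : a * ρ ≤ secondDiff (fun y => u y t) x e ρ)
    (hgood : secondDiff (fun y => u y t) x e (2 * ρ) ≤
      2 * secondDiff (fun y => u y t) x e ρ + 2 * χ * a * ρ)
    (hv : 0 < v) (hbig : Big i₀ e (secG (closure Ω) (fun y => u y t) x h) v)
    (hcond : dropC n m Lam * (t - t') ^ m * h ^ 2 < θ ^ (2 * m + 2) * (ρ * v) ^ 2) :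
    secondDiff (fun y => u y t) x e ρ - 6 * (θ * h) ≤ secondDiff (fun y => u y t') x e ρ ∧
    u x t - h / 2 ≤ u x t' ∧
    ∃ v' > 0, a ^ 2 * (t - t') ^ m ≤ bigC n m lam M₀ κ * v' ^ 2 ∧
      Big i₀ e (secG (closure Ω) (fun y => u y t') x h) v' := by
  have hhpos : 0 < h := by rw [hh]; positivity
  have htI := S.mem_Icc (t := t) (by linarith) ht
  have ht'I := S.mem_Icc ht' (by linarith)
  have hcv := (S.reg.conv t htI).2
  have hcv' := (S.reg.conv t' ht'I).2
  have hxS := subset_closure hx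
  have hmem : ∀ s : ℝ, |s| ≤ 2 * ρ → x + s • e ∈ closure Ω := fun s hs =>
    add_smul_mem_of_abs_le S.convex.closure hp hm hs
  have hmem' : ∀ s : ℝ, |s| ≤ 2 * ρ → x - s • e ∈ closure Ω := fun s hs => by
    have := hmem (-s) (by rwa [abs_neg])
    rwa [neg_smul, ← sub_eq_add_neg] at this
  have hmono : ∀ y ∈ closure Ω, u y t' ≤ u y t := fun y hy =>
    S.reg.mono y hy t' ht'I t htI htt.le
  have hρabs : |ρ| ≤ 2 * ρ := by rw [abs_of_pos hρ]; linarith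
  have hχh : χ * a * ρ = h / 10 := by rw [hh]; ring
  unfold secondDiff at hW hgood ⊢
  -- midpoint convexity
  have mid1 : 2 * u (x + ρ • e) t ≤ u x t + u (x + (2 * ρ) • e) t := by
    have := hcv hxS hp (show (0:ℝ) ≤ 1 / 2 by norm_num) (show (0:ℝ) ≤ 1 / 2 by norm_num)
      (by norm_num)
    have e1 : (1 / 2 : ℝ) • x + (1 / 2 : ℝ) • (x + (2 * ρ) • e) = x + ρ • e := by module
    rw [e1] at this
    simp only [smul_eq_mul] at this
    linarith
  have mid2 : 2 * u (x - ρ • e) t ≤ u x t + u (x - (2 * ρ) • e) t := by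
    have := hcv hxS hm (show (0:ℝ) ≤ 1 / 2 by norm_num) (show (0:ℝ) ≤ 1 / 2 by norm_num)
      (by norm_num)
    have e1 : (1 / 2 : ℝ) • x + (1 / 2 : ℝ) • (x - (2 * ρ) • e) = x - ρ • e := by module
    rw [e1] at this
    simp only [smul_eq_mul] at this
    linarith
  have hT := S.hT
  have drop1 := S.drop_at i₀ (by linarith) htt ht hx hρ hhpos hp (by linarith) hθ (by linarith) hv
    hbig hcond
  have drop2 := S.drop_at i₀ (x := x) (e := -e) (by linarith) htt ht hx hρ hhpos
    (by rwa [smul_neg, ← sub_eq_add_neg])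
    (by simp only [smul_neg, ← sub_eq_add_neg]; linarith) hθ (by linarith) hv
    (by
      obtain ⟨g, hg, hgv⟩ := hbig
      exact ⟨g, hg, by rwa [frameDet_update_neg]⟩) hcond
  simp only [smul_neg, ← sub_eq_add_neg] at drop2
  -- convexity at the earlier time
  have key : ∀ s, 0 ≤ s → s ≤ ρ →
      (u (x + ρ • e) t' + u (x - ρ • e) t') * (2 * ρ - s) ≤
      (u (x + s • e) t' + u (x - s • e) t') * ρ +
        (u (x + (2 * ρ) • e) t + u (x - (2 * ρ) • e) t) * (ρ - s) := by
    intro s hs hsρ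
    have hd : 0 < 2 * ρ - s := by linarith
    set l := ρ / (2 * ρ - s) with hl
    have hl0 : 0 ≤ l := by positivity
    have hl1 : l ≤ 1 := (div_le_one hd).2 (by linarith)
    have hl2 : l * (2 * ρ - s) = ρ := div_mul_cancel₀ _ hd.ne'
    have hsabs : |s| ≤ 2 * ρ := by rw [abs_of_nonneg hs]; linarith
    have i1 := hcv' (hmem s hsabs) hp hl0 (show 0 ≤ 1 - l by linarith) (by ring)
    have i2 := hcv' (hmem' s hsabs) hm hl0 (show 0 ≤ 1 - l by linarith) (by ring)
    have hρl : ρ = l * s + (1 - l) * (2 * ρ) := by linarith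
    have e1 : l • (x + s • e) + (1 - l) • (x + (2 * ρ) • e) = x + ρ • e := by
      conv_rhs => rw [hρl]
      module
    have e2 : l • (x - s • e) + (1 - l) • (x - (2 * ρ) • e) = x - ρ • e := by
      conv_rhs => rw [hρl]
      module
    rw [e1] at i1
    rw [e2] at i2
    simp only [smul_eq_mul] at i1 i2
    have hsum : u (x + ρ • e) t' + u (x - ρ • e) t' ≤
        l * (u (x + s • e) t' + u (x - s • e) t') +
        (1 - l) * (u (x + (2 * ρ) • e) t + u (x - (2 * ρ) • e) t) := by
      have := mul_le_mul_of_nonneg_left (add_le_add (hmono _ hp) (hmono _ hm))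
        (show 0 ≤ 1 - l by linarith)
      linarith
    have h3 := mul_le_mul_of_nonneg_right hsum hd.le
    have h4 : (1 - l) * (2 * ρ - s) = ρ - s := by rw [sub_mul, hl2]; ring
    calc _ ≤ _ := h3
      _ = (u (x + s • e) t' + u (x - s • e) t') * (l * (2 * ρ - s)) +
        (u (x + (2 * ρ) • e) t + u (x - (2 * ρ) • e) t) * ((1 - l) * (2 * ρ - s)) := by ring
      _ = _ := by rw [hl2, h4]
  have hdec : u x t - h / 2 ≤ u x t' := by
    have := key 0 le_rfl hρ.le
    simp only [zero_smul, add_zero, sub_zero] at this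
    have h2 : (u (x + ρ • e) t' + u (x - ρ • e) t') * 2 ≤
        (u x t' + u x t') + (u (x + (2 * ρ) • e) t + u (x - (2 * ρ) • e) t) := by
      nlinarith
    nlinarith
  refine ⟨by linarith [hmono x hxS], hdec, ?_⟩
  have hxle := hmono x hxS
  set G := secG (closure Ω) (fun y => u y t') x h with hG
  have hkey2 : ∀ s, 0 ≤ s → s ≤ ρ → s • e ∈ G → a * s ≤ 2.8 * h := by
    intro s hs hsρ hsG
    have h1 := key s hs hsρ
    have h2 : u (x + s • e) t' + u (x - s • e) t' ≤ 2 * u x t' + 2 * h := hsG.2.2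
    have h3 : (u (x + s • e) t' + u (x - s • e) t') * ρ ≤ (2 * u x t + 2 * h) * ρ :=
      mul_le_mul_of_nonneg_right (by linarith) hρ.le
    have h4 : (u (x + ρ • e) t + u (x - ρ • e) t - 6 * (θ * h)) * (2 * ρ - s) ≤
        (u (x + ρ • e) t' + u (x - ρ • e) t') * (2 * ρ - s) :=
      mul_le_mul_of_nonneg_right (by linarith) (by linarith)
    have h5 := mul_le_mul_of_nonneg_right hgood (show 0 ≤ ρ - s by linarith)
    have h6 := mul_le_mul_of_nonneg_right hW hs
    set U := u (x + ρ • e) t + u (x - ρ • e) t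
    set V := u (x + (2 * ρ) • e) t + u (x - (2 * ρ) • e) t
    have h7 : θ * h * (2 * ρ - s) ≤ 1 / 20 * h * (2 * ρ) := by
      have : 0 ≤ 2 * ρ - s := by linarith
      gcongr
      linarith
    have h9 : 2 * χ * a * ρ * (ρ - s) ≤ h / 5 * ρ := by
      have : 2 * χ * a * ρ = h / 5 := by linarith
      rw [this]
      gcongr; linarith
    have h8 : a * s * ρ ≤ 2.8 * h * ρ := by
      nlinarith
    exact le_of_mul_le_mul_right h8 hρ
  refine S.big_after i₀ he hx ht' htt ht (by linarith) hhpos hhκ ha ?_ (by linarith)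
  intro s hsG
  have habs : |s| • e ∈ G := by
    rcases abs_choice s with h1 | h1 <;> rw [h1]
    · exact hsG
    · rw [neg_smul]; exact secG_neg hsG
  rw [le_div_iff₀ ha]
  rcases le_or_gt |s| ρ with hsρ | hsρ
  · linarith [hkey2 _ (abs_nonneg s) hsρ habs]
  · exfalso
    have hcvG : Convex ℝ G := convex_secG (S.reg.conv t' ht'I)
    have hspos := hρ.trans hsρ
    have := hcvG habs (zero_mem_secG hxS hhpos.le) (show 0 ≤ ρ / |s| by positivity)
      (show 0 ≤ 1 - ρ / |s| by rw [sub_nonneg, div_le_one hspos]; exact hsρ.le) (by ring)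
    rw [smul_smul, div_mul_cancel₀ _ hspos.ne', smul_zero, add_zero] at this
    have h3 := hkey2 ρ hρ.le le_rfl this
    have h4 : 0 < a * ρ := by positivity
    have h5 := mul_le_mul_of_nonneg_right hχ1 h4.le
    linarith

end Setup

section move

variable {S : Set (E n)} {f : E n → ℝ} {x g e : E n} {h R ρ : ℝ}

lemma add_half_mem (hf : ConvexOn ℝ S f) (hx : x ∈ S) (hg : g ∈ secG S f x h) :
    x + (1 / 2 : ℝ) • g ∈ S := by
  have := hf.1 hx hg.1 (show (0:ℝ) ≤ 1 / 2 by norm_num) (show (0:ℝ) ≤ 1 / 2 by norm_num)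
    (by norm_num)
  convert this using 1
  module

/-- Lower bound for `f` halfway along a section vector. -/
lemma le_add_half (hf : ConvexOn ℝ S f) (hx : x ∈ S) (hg : g ∈ secG S f x h) :
    3 * f x ≤ f (x - g) + 2 * f (x + (1 / 2 : ℝ) • g) := by
  have := hf.2 hg.2.1 (add_half_mem hf hx hg) (show (0:ℝ) ≤ 1 / 3 by norm_num)
    (show (0:ℝ) ≤ 2 / 3 by norm_num) (by norm_num)
  have e1 : (1 / 3 : ℝ) • (x - g) + (2 / 3 : ℝ) • (x + (1 / 2 : ℝ) • g) = x := by module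
  rw [e1] at this
  simp only [smul_eq_mul] at this
  linarith

lemma add_half_le (hf : ConvexOn ℝ S f) (hx : x ∈ S) (hg : g ∈ secG S f x h) :
    2 * f (x + (1 / 2 : ℝ) • g) ≤ f x + f (x + g) := by
  have := hf.2 hx hg.1 (show (0:ℝ) ≤ 1 / 2 by norm_num) (show (0:ℝ) ≤ 1 / 2 by norm_num)
    (by norm_num)
  have e1 : (1 / 2 : ℝ) • x + (1 / 2 : ℝ) • (x + g) = x + (1 / 2 : ℝ) • g := by module
  rw [e1] at this
  simp only [smul_eq_mul] at this
  linarith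

lemma add_half_add_mem (hf : ConvexOn ℝ S f) (hg : g ∈ secG S f x h) {d : E n}
    (hd : x + d ∈ S) : x + (1 / 2 : ℝ) • g + (1 / 2 : ℝ) • d ∈ S ∧
      2 * f (x + (1 / 2 : ℝ) • g + (1 / 2 : ℝ) • d) ≤ f (x + g) + f (x + d) := by
  have e1 : (1 / 2 : ℝ) • (x + g) + (1 / 2 : ℝ) • (x + d) =
      x + (1 / 2 : ℝ) • g + (1 / 2 : ℝ) • d := by module
  have h1 := hf.1 hg.1 hd (show (0:ℝ) ≤ 1 / 2 by norm_num) (show (0:ℝ) ≤ 1 / 2 by norm_num)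
    (by norm_num)
  have h2 := hf.2 hg.1 hd (show (0:ℝ) ≤ 1 / 2 by norm_num) (show (0:ℝ) ≤ 1 / 2 by norm_num)
    (by norm_num)
  rw [e1] at h1 h2
  simp only [smul_eq_mul] at h2
  exact ⟨h1, by linarith⟩

/-- The second difference at a large scale after moving along a section vector. -/
lemma secondDiff_move_le (hf : ConvexOn ℝ S f) (hx : x ∈ S) (hg : g ∈ secG S f x h)
    (hp : x + R • e ∈ S) (hm : x - R • e ∈ S) :
    secondDiff f (x + (1 / 2 : ℝ) • g) e (R / 2) ≤ secondDiff f x e R / 2 + 2 * h := by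
  have a1 := (add_half_add_mem hf hg hp).2
  rw [sub_eq_add_neg] at hm
  have a2 := (add_half_add_mem hf hg hm).2
  have e1 : (1 / 2 : ℝ) • R • e = (R / 2) • e := by module
  rw [smul_neg, ← sub_eq_add_neg, e1, ← sub_eq_add_neg] at a2
  rw [e1] at a1
  have a3 := le_add_half hf hx hg
  have a4 := hg.2.2
  unfold secondDiff
  linarith

/-- The second difference at a small scale after moving along a section vector. -/
lemma le_secondDiff_move (hf : ConvexOn ℝ S f) (hx : x ∈ S) (hg : g ∈ secG S f x h)
    (hρ : 0 ≤ ρ) (hp : x + (1 / 2 : ℝ) • g + (2 * ρ) • e ∈ S)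
    (hm : x + (1 / 2 : ℝ) • g - (2 * ρ) • e ∈ S) :
    6 * secondDiff f x e ρ - 8 * h ≤ 3 * secondDiff f (x + (1 / 2 : ℝ) • g) e (2 * ρ) := by
  have hmem := fun s hs => add_smul_mem_of_abs_le hf.1 hp hm (s := s) hs
  have key : ∀ s : ℝ, |s| = ρ → 3 * f (x + s • e) ≤
      f (x - g) + 2 * f (x + (1 / 2 : ℝ) • g + (3 / 2 * s) • e) := by
    intro s hs
    have := hf.2 hg.2.1 (hmem (3 / 2 * s) (by rw [abs_mul, hs, abs_of_pos] <;> linarith))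
      (show (0:ℝ) ≤ 1 / 3 by norm_num) (show (0:ℝ) ≤ 2 / 3 by norm_num) (by norm_num)
    have e1 : (1 / 3 : ℝ) • (x - g) +
        (2 / 3 : ℝ) • (x + (1 / 2 : ℝ) • g + (3 / 2 * s) • e) = x + s • e := by module
    rw [e1] at this
    simp only [smul_eq_mul] at this
    linarith
  have k1 := key ρ (abs_of_nonneg hρ)
  have k2 := key (-ρ) (by rw [abs_neg, abs_of_nonneg hρ])
  rw [neg_smul, ← sub_eq_add_neg, mul_neg, neg_smul, ← sub_eq_add_neg] at k2
  have k3 := add_half_le hf hx hg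
  have k4 := hg.2.2
  have k5 := secondDiff_mul_le hf hp hm (s := 3 / 2 * ρ) (by positivity) (by linarith)
  have k6 : 4 * secondDiff f (x + (1 / 2 : ℝ) • g) e (3 / 2 * ρ) ≤
      3 * secondDiff f (x + (1 / 2 : ℝ) • g) e (2 * ρ) := by
    rcases hρ.eq_or_lt with h0 | h0
    · subst h0; simp [secondDiff]; linarith
    · refine le_of_mul_le_mul_right ?_ h0
      linarith
  have k7 : 3 * secondDiff f x e ρ - 4 * h ≤
      2 * secondDiff f (x + (1 / 2 : ℝ) • g) e (3 / 2 * ρ) := by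
    unfold secondDiff; linarith
  linarith

lemma third_mem_secG (hf : ConvexOn ℝ S f) (hx : x ∈ S) (hh : 0 ≤ h) (hg : g ∈ secG S f x h)
    {z : E n} (hz : z ∈ secG S f x h) :
    (1 / 3 : ℝ) • z ∈ secG S f (x + (1 / 2 : ℝ) • g) (2 * h) := by
  have hq := hf.1 hx hg.1 (show (0:ℝ) ≤ 1 / 4 by norm_num) (show (0:ℝ) ≤ 3 / 4 by norm_num)
    (by norm_num)
  have hq2 := hf.2 hx hg.1 (show (0:ℝ) ≤ 1 / 4 by norm_num) (show (0:ℝ) ≤ 3 / 4 by norm_num)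
    (by norm_num)
  have key : ∀ w : E n, x + w ∈ S → x + (1 / 2 : ℝ) • g + (1 / 3 : ℝ) • w ∈ S ∧
      3 * f (x + (1 / 2 : ℝ) • g + (1 / 3 : ℝ) • w) ≤
        f (x + w) + 2 * f ((1 / 4 : ℝ) • x + (3 / 4 : ℝ) • (x + g)) := by
    intro w hw
    have h1 := hf.1 hw hq (show (0:ℝ) ≤ 1 / 3 by norm_num) (show (0:ℝ) ≤ 2 / 3 by norm_num)
      (by norm_num)
    have h2 := hf.2 hw hq (show (0:ℝ) ≤ 1 / 3 by norm_num) (show (0:ℝ) ≤ 2 / 3 by norm_num)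
      (by norm_num)
    have e1 : (1 / 3 : ℝ) • (x + w) + (2 / 3 : ℝ) • ((1 / 4 : ℝ) • x + (3 / 4 : ℝ) • (x + g)) =
        x + (1 / 2 : ℝ) • g + (1 / 3 : ℝ) • w := by module
    rw [e1] at h1 h2
    simp only [smul_eq_mul] at h2
    exact ⟨h1, by linarith⟩
  obtain ⟨z1, z2, z3⟩ := hz
  rw [sub_eq_add_neg] at z2
  have k1 := key z z1
  have k2 := key (-z) z2
  rw [smul_neg, ← sub_eq_add_neg, ← sub_eq_add_neg] at k2
  have k3 := le_add_half hf hx hg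
  have k4 := hg.2.2
  simp only [smul_eq_mul] at hq2
  exact ⟨k1.1, k2.1, by linarith [k1.2, k2.2]⟩

end move

lemma Big.third {i₀ : Fin n} {e : E n} {G G' : Set (E n)} {v : ℝ} (hv : Big i₀ e G v)
    (h0 : 0 ≤ v) (hG : ∀ z ∈ G, (1 / 3 : ℝ) • z ∈ G') : Big i₀ e G' (v / 3 ^ n) := by
  obtain ⟨g, hg, hgv⟩ := hv
  refine ⟨fun i => (1 / 3 : ℝ) • g i, fun i => hG _ (hg i), ?_⟩
  set w : Fin n → ℝ := Function.update (fun _ => 1 / 3) i₀ 1 with hw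
  have hw0 : ∀ i, 1 / 3 ≤ w i := fun i => by
    rcases eq_or_ne i i₀ with rfl | hi
    · rw [hw, Function.update_self]; norm_num
    · rw [hw, Function.update_of_ne hi]
  have he : Function.update (fun i => (1 / 3 : ℝ) • g i) i₀ e =
      fun i => w i • Function.update g i₀ e i := by
    funext i
    rcases eq_or_ne i i₀ with rfl | hi
    · simp [hw]
    · simp [hw, Function.update_of_ne hi]
  rw [he, frameDet_smul _ fun i => by linarith [hw0 i]]
  have hprod : (1 / 3 : ℝ) ^ n ≤ ∏ i, w i := by
    calc (1 / 3 : ℝ) ^ n = ∏ _i : Fin n, (1 / 3 : ℝ) := by simp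
      _ ≤ _ := Finset.prod_le_prod (fun _ _ => by norm_num) fun i _ => hw0 i
  calc v / 3 ^ n = (1 / 3) ^ n * v := by rw [one_div, inv_pow]; ring
    _ ≤ (∏ i, w i) * v := by gcongr
    _ ≤ _ := by
      gcongr
      exact (by positivity : (0:ℝ) ≤ (1 / 3) ^ n).trans hprod

/-- The state of the iteration: at the point `x` and time `t ≥ s`, `u` bends in direction `e` at
scale `ρ` with slope jump at least `A`, and its sections are large. -/
structure BendState (m : ℕ) (κ : ℝ) (Ω : Set (E n)) (y₀ : E n) (u : E n → ℝ → ℝ) (i₀ : Fin n)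
    (e : E n) (a χ b τ s : ℝ) (x : E n) (t ρ R A L Ψ : ℝ) : Prop where
  mem : x ∈ Ω
  le_t : s ≤ t
  nonpos : t ≤ 0
  hp : x + R • e ∈ closure Ω
  hm : x - R • e ∈ closure Ω
  hρ : 0 < ρ
  hR : secondDiff (fun y => u y t) x e R ≤ L * R
  hA : A * ρ ≤ secondDiff (fun y => u y t) x e ρ
  hΨ : Ψ ≤ ‖x - y₀‖ ^ 2 - κ⁻¹ * u x t
  big : ∃ v > 0, a ^ 2 * τ ^ m ≤ b * v ^ 2 ∧
    Big i₀ e (secG (closure Ω) (fun y => u y t) x (10 * χ * a * ρ)) v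

/-- `f` bends no more at scale `2ρ` than at scale `ρ`, up to a tolerance. -/
def GoodScale (f : E n → ℝ) (x e : E n) (a χ ρ : ℝ) : Prop :=
  secondDiff f x e (2 * ρ) ≤ 2 * secondDiff f x e ρ + 2 * χ * a * ρ

namespace BendState

variable {m : ℕ} {lam Lam p M₀ κ T : ℝ} {Ω : Set (E n)} {y₀ : E n} {u : E n → ℝ → ℝ}
  {i₀ : Fin n} {e : E n} {a χ b τ s : ℝ} {x : E n} {t ρ R A L Ψ : ℝ}

lemma mono (B : BendState m κ Ω y₀ u i₀ e a χ b τ s x t ρ R A L Ψ) {b' A' L' Ψ' : ℝ}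
    (hb : b ≤ b') (hA : A' ≤ A) (hL : L ≤ L') (hΨ : Ψ' ≤ Ψ) (hR : 0 ≤ R) :
    BendState m κ Ω y₀ u i₀ e a χ b' τ s x t ρ R A' L' Ψ' where
  mem := B.mem
  le_t := B.le_t
  nonpos := B.nonpos
  hp := B.hp
  hm := B.hm
  hρ := B.hρ
  hR := B.hR.trans (mul_le_mul_of_nonneg_right hL hR)
  hA := (mul_le_mul_of_nonneg_right hA B.hρ.le).trans B.hA
  hΨ := hΨ.trans B.hΨ
  big := by
    obtain ⟨v, hv, h1, h2⟩ := B.big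
    exact ⟨v, hv, h1.trans (by gcongr), h2⟩

lemma shift (B : BendState m κ Ω y₀ u i₀ e a χ b τ s x t ρ R A L Ψ) (ha : 0 ≤ a) (hχ : 0 ≤ χ)
    (hbad : ¬ GoodScale (fun y => u y t) x e a χ ρ) :
    BendState m κ Ω y₀ u i₀ e a χ b τ s x t (2 * ρ) R (A + χ * a) L Ψ where
  mem := B.mem
  le_t := B.le_t
  nonpos := B.nonpos
  hp := B.hp
  hm := B.hm
  hρ := by linarith [B.hρ]
  hR := B.hR
  hA := by
    have := not_le.1 hbad
    linarith [B.hA]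
  hΨ := B.hΨ
  big := by
    obtain ⟨v, hv, h1, g, hg, h2⟩ := B.big
    refine ⟨v, hv, h1, g, fun i => secG_mono ?_ (hg i), h2⟩
    have := B.hρ
    have h3 : 0 ≤ 10 * χ * a * ρ := by positivity
    linarith

lemma slope_le (B : BendState m κ Ω y₀ u i₀ e a χ b τ s x t ρ R A L Ψ)
    (S : Setup m lam Lam p M₀ κ T Ω y₀ u) (hs : -T / 2 ≤ s) (hR : ρ ≤ R) : A ≤ L := by
  have hρ := B.hρ
  have hcv := S.reg.conv t (S.mem_Icc (hs.trans B.le_t) B.nonpos)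
  have h1 := secondDiff_mul_le hcv B.hp B.hm hρ.le hR
  have h2 := mul_le_mul_of_nonneg_right B.hR hρ.le
  have h3 := mul_le_mul_of_nonneg_right B.hA (hρ.le.trans hR)
  have h4 : A * (ρ * R) ≤ L * (ρ * R) := by linarith
  exact le_of_mul_le_mul_right h4 (mul_pos hρ (hρ.trans_le hR))

/-- Among the next `J` dyadic scales there is a good one. -/
lemma settle (S : Setup m lam Lam p M₀ κ T Ω y₀ u) (hs : -T / 2 ≤ s) (ha : 0 ≤ a) (hχ : 0 ≤ χ)
    (J : ℕ) : ∀ {ρ A : ℝ}, BendState m κ Ω y₀ u i₀ e a χ b τ s x t ρ R A L Ψ → 2 ^ J * ρ ≤ R →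
      L < A + J * (χ * a) →
      ∃ j < J, BendState m κ Ω y₀ u i₀ e a χ b τ s x t (2 ^ j * ρ) R (A + j * (χ * a)) L Ψ ∧
        GoodScale (fun y => u y t) x e a χ (2 ^ j * ρ) := by
  induction J with
  | zero =>
    intro ρ A B hR hL
    exfalso
    have := B.slope_le S hs (by simpa using hR)
    simp only [Nat.cast_zero, zero_mul, add_zero] at hL
    linarith
  | succ J ih =>
    intro ρ A B hR hL
    by_cases hg : GoodScale (fun y => u y t) x e a χ ρ
    · exact ⟨0, J.succ_pos, by simpa using B, by simpa using hg⟩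
    · obtain ⟨j, hj, h1, h2⟩ := ih (B.shift ha hχ hg) (by rw [← mul_assoc, ← pow_succ]; exact hR)
        (by push_cast at hL; linarith)
      refine ⟨j + 1, by omega, ?_, ?_⟩
      · convert h1 using 1
        · rw [pow_succ]; ring
        · push_cast; ring
      · convert h2 using 1
        rw [pow_succ]; ring

lemma le_one_sub (B : BendState m κ Ω y₀ u i₀ e a χ b τ s x t ρ R A L Ψ)
    (S : Setup m lam Lam p M₀ κ T Ω y₀ u) (hΨ : 2 - κ⁻¹ ≤ Ψ) : u x t ≤ 1 - κ := by
  have hκ := S.κ_pos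
  have h1 : ‖x - y₀‖ ^ 2 ≤ 1 :=
    pow_le_one₀ (norm_nonneg _) (S.norm_sub_le (subset_closure B.mem))
  have h2 : κ⁻¹ * u x t ≤ κ⁻¹ * (1 - κ) := by
    have : κ⁻¹ * κ = 1 := inv_mul_cancel₀ hκ.ne'
    linarith [B.hΨ]
  exact le_of_mul_le_mul_left h2 (by positivity)

/-- A backward time step of length at most twice the current one. -/
lemma time_step (B : BendState m κ Ω y₀ u i₀ e a χ b τ s x t ρ R A L Ψ)
    (S : Setup m lam Lam p M₀ κ T Ω y₀ u) (he : ‖e‖ = 1) {τ' θ : ℝ} (hτ' : 0 < τ')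
    (hττ : τ' ≤ 2 * τ) (hs : -T / 2 ≤ s - τ')
    (hg : GoodScale (fun y => u y t) x e a χ ρ) (hR : 2 * ρ ≤ R) (ha : 0 < a) (hχ : 0 < χ)
    (hχ1 : χ ≤ 1 / 40) (hθ : 0 < θ) (hθ1 : θ ≤ 1 / 20) (hhκ : 10 * χ * a * ρ ≤ κ / 2)
    (haA : a ≤ A) (hΨ : 2 - κ⁻¹ ≤ Ψ)
    (hcond : 100 * 2 ^ m * dropC n m Lam * χ ^ 2 * b < θ ^ (2 * m + 2)) :
    BendState m κ Ω y₀ u i₀ e a χ (bigC n m lam M₀ κ) τ' (s - τ') x (t - τ') ρ R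
      (A - 60 * (θ * χ * a)) (L + 10 * χ * a * ρ / R) Ψ := by
  have hρ := B.hρ
  have hRpos : 0 < R := by linarith
  have hLam := S.hLam
  obtain ⟨v, hv, hv1, hbig⟩ := B.big
  have hsub := fun s' hs' => add_smul_mem_of_abs_le S.convex.closure B.hp B.hm (s := s') hs'
  have h2p := hsub (2 * ρ) (by rwa [abs_of_pos (by linarith)])
  have h2m := hsub (-(2 * ρ)) (by rwa [abs_neg, abs_of_pos (by linarith)])
  rw [neg_smul, ← sub_eq_add_neg] at h2m
  have ht' : -T / 2 ≤ t - τ' := by linarith [B.le_t]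
  have hstep := S.step i₀ he ht' (sub_lt_self t hτ') B.nonpos B.mem hρ h2p h2m
    (B.le_one_sub S hΨ) ha hχ hχ1 hθ hθ1 rfl hhκ
    ((mul_le_mul_of_nonneg_right haA hρ.le).trans B.hA) hg hv hbig (by
      rw [sub_sub_cancel]
      have hd : 0 ≤ dropC n m Lam := by unfold dropC; positivity
      have h1 : τ' ^ m ≤ 2 ^ m * τ ^ m := by rw [← mul_pow]; gcongr
      calc dropC n m Lam * τ' ^ m * (10 * χ * a * ρ) ^ 2
          ≤ dropC n m Lam * (2 ^ m * τ ^ m) * (10 * χ * a * ρ) ^ 2 := by gcongr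
        _ = 100 * 2 ^ m * dropC n m Lam * χ ^ 2 * ρ ^ 2 * (a ^ 2 * τ ^ m) := by ring
        _ ≤ 100 * 2 ^ m * dropC n m Lam * χ ^ 2 * ρ ^ 2 * (b * v ^ 2) := by gcongr
        _ = 100 * 2 ^ m * dropC n m Lam * χ ^ 2 * b * (ρ * v) ^ 2 := by ring
        _ < _ := by gcongr)
  rw [sub_sub_cancel] at hstep
  obtain ⟨k1, k2, k3⟩ := hstep
  have htI := S.mem_Icc (by linarith : -T / 2 ≤ t) B.nonpos
  have ht'I := S.mem_Icc ht' (by linarith [B.nonpos])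
  have hmono : ∀ y ∈ closure Ω, u y (t - τ') ≤ u y t := fun y hy =>
    S.reg.mono y hy _ ht'I t htI (by linarith)
  refine ⟨B.mem, by linarith [B.le_t], by linarith [B.nonpos], B.hp, B.hm, hρ, ?_, ?_, ?_, k3⟩
  · have h1 := B.hR
    have h2 := hmono _ B.hp
    have h3 := hmono _ B.hm
    have h4 : (L + 10 * χ * a * ρ / R) * R = L * R + 10 * χ * a * ρ := by field_simp
    rw [h4]
    unfold secondDiff at h1 ⊢
    linarith
  · linarith [B.hA]
  · have h1 := hmono x (subset_closure B.mem)
    have hκ := S.κ_pos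
    have h2 : κ⁻¹ * u x (t - τ') ≤ κ⁻¹ * u x t := by gcongr
    linarith [B.hΨ]

lemma move_of_le (B : BendState m κ Ω y₀ u i₀ e a χ b τ s x t ρ R A L Ψ)
    (S : Setup m lam Lam p M₀ κ T Ω y₀ u) (hs : -T / 2 ≤ s) (hR : 4 * ρ ≤ R) (ha : 0 ≤ a)
    (hχ : 0 ≤ χ) {g : E n}
    (hg : g ∈ secG (closure Ω) (fun y => u y t) x (10 * χ * a * ρ)) {Ψ' : ℝ}
    (hΨ : 2 - κ⁻¹ ≤ Ψ')
    (hΨ' : Ψ' ≤ ‖x + (1 / 2 : ℝ) • g - y₀‖ ^ 2 - κ⁻¹ * u (x + (1 / 2 : ℝ) • g) t) :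
    BendState m κ Ω y₀ u i₀ e a χ (9 ^ n * b) τ s (x + (1 / 2 : ℝ) • g) t (2 * ρ) (R / 2)
      (A - 14 * (χ * a)) (L + 4 * (10 * χ * a * ρ / R)) Ψ' := by
  have hρ := B.hρ
  have hRpos : 0 < R := by linarith
  have hκ := S.κ_pos
  have htI := S.mem_Icc (hs.trans B.le_t) B.nonpos
  have hcv := S.reg.conv t htI
  have hxS := subset_closure B.mem
  have hh : 0 ≤ 10 * χ * a * ρ := by positivity
  have hyS := add_half_mem hcv hxS hg
  have e1 : (1 / 2 : ℝ) • R • e = (R / 2) • e := by module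
  have hyp := (add_half_add_mem hcv hg B.hp).1
  rw [e1] at hyp
  have hm := B.hm
  rw [sub_eq_add_neg] at hm
  have hym := (add_half_add_mem hcv hg hm).1
  rw [smul_neg, e1, ← sub_eq_add_neg] at hym
  have hsub := fun s' hs' => add_smul_mem_of_abs_le S.convex.closure hyp hym (s := s') hs'
  have h2p := hsub (2 * ρ) (by rw [abs_of_pos (by linarith)]; linarith)
  have h2m := hsub (-(2 * ρ)) (by rw [abs_neg, abs_of_pos (by linarith)]; linarith)
  rw [neg_smul, ← sub_eq_add_neg] at h2m
  refine ⟨?_, B.le_t, B.nonpos, hyp, hym, by linarith, ?_, ?_, hΨ', ?_⟩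
  · refine S.mem_of_lt hyS htI ?_
    have h1 : ‖x + (1 / 2 : ℝ) • g - y₀‖ ^ 2 ≤ 1 := pow_le_one₀ (norm_nonneg _) (S.norm_sub_le hyS)
    have h2 : κ⁻¹ * u (x + (1 / 2 : ℝ) • g) t < κ⁻¹ * 1 := by linarith
    exact lt_of_mul_lt_mul_left h2 (by positivity)
  · have h1 := secondDiff_move_le hcv hxS hg B.hp B.hm
    have h2 : (L + 4 * (10 * χ * a * ρ / R)) * (R / 2) =
        L * R / 2 + 2 * (10 * χ * a * ρ) := by field_simp; ring
    rw [h2]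
    linarith [B.hR]
  · have h1 := le_secondDiff_move hcv hxS hg hρ.le h2p h2m
    have h2 := B.hA
    have h3 : 0 ≤ χ * a * ρ := by positivity
    linarith
  · obtain ⟨v, hv, h1, h2⟩ := B.big
    refine ⟨v / 3 ^ n, by positivity, ?_, h2.third hv.le fun z hz => ?_⟩
    · have : (9 : ℝ) ^ n * b * (v / 3 ^ n) ^ 2 = b * v ^ 2 := by
        rw [div_pow, ← pow_mul, mul_comm n 2, pow_mul]
        norm_num
        field_simp
      rwa [this]
    · have := third_mem_secG hcv hxS hh hg hz
      rwa [show 10 * χ * a * (2 * ρ) = 2 * (10 * χ * a * ρ) by ring]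

/-- Moving along a long section vector increases the energy `‖x - y₀‖² - u/κ`. -/
lemma move (B : BendState m κ Ω y₀ u i₀ e a χ b τ s x t ρ R A L Ψ)
    (S : Setup m lam Lam p M₀ κ T Ω y₀ u) (hs : -T / 2 ≤ s) (hR : 4 * ρ ≤ R) (ha : 0 ≤ a)
    (hχ : 0 ≤ χ) {g : E n} {δ : ℝ}
    (hg : g ∈ secG (closure Ω) (fun y => u y t) x (10 * χ * a * ρ)) (hδ : 0 ≤ δ)
    (hgδ : 8 * δ ≤ ‖g‖ ^ 2) (hhδ : κ⁻¹ * (10 * χ * a * ρ) ≤ 2 * δ) (hΨ : 2 - κ⁻¹ ≤ Ψ) :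
    ∃ y, BendState m κ Ω y₀ u i₀ e a χ (9 ^ n * b) τ s y t (2 * ρ) (R / 2)
      (A - 14 * (χ * a)) (L + 4 * (10 * χ * a * ρ / R)) (Ψ + δ) := by
  have hκ := S.κ_pos
  have htI := S.mem_Icc (hs.trans B.le_t) B.nonpos
  have hcv := S.reg.conv t htI
  have hxS := subset_closure B.mem
  have h1 := add_half_le hcv hxS hg
  have h2 := add_half_le hcv hxS (secG_neg hg)
  have h3 : u (x + g) t + u (x - g) t ≤ 2 * u x t + 2 * (10 * χ * a * ρ) := hg.2.2
  rw [← sub_eq_add_neg] at h2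
  have h4 : κ⁻¹ * (u (x + (1 / 2 : ℝ) • g) t + u (x + (1 / 2 : ℝ) • -g) t) ≤
      κ⁻¹ * (2 * u x t + 10 * χ * a * ρ) :=
    mul_le_mul_of_nonneg_left (by linarith) (by positivity)
  have h5 : ‖x + (1 / 2 : ℝ) • g - y₀‖ ^ 2 + ‖x + (1 / 2 : ℝ) • -g - y₀‖ ^ 2 =
      2 * ‖x - y₀‖ ^ 2 + ‖g‖ ^ 2 / 2 := by
    have := parallelogram_law_with_norm ℝ (x - y₀) ((1 / 2 : ℝ) • g)
    have e1 : x + (1 / 2 : ℝ) • g - y₀ = x - y₀ + (1 / 2 : ℝ) • g := by module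
    have e2 : x + (1 / 2 : ℝ) • -g - y₀ = x - y₀ - (1 / 2 : ℝ) • g := by module
    have e3 : ‖(1 / 2 : ℝ) • g‖ = ‖g‖ / 2 := by rw [norm_smul]; norm_num; ring
    rw [e1, e2]
    rw [e3] at this
    linarith
  have h6 := B.hΨ
  rcases le_total (Ψ + δ) (‖x + (1 / 2 : ℝ) • g - y₀‖ ^ 2 - κ⁻¹ * u (x + (1 / 2 : ℝ) • g) t)
    with h7 | h7
  · exact ⟨_, B.move_of_le S hs hR ha hχ hg (by linarith) h7⟩
  · exact ⟨_, B.move_of_le S hs hR ha hχ (secG_neg hg) (by linarith) (by linarith)⟩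

end BendState

lemma dyadic_scale_eq {R : ℝ} {N : ℕ} (q i : ℕ) :
    (2 : ℝ) ^ q * (R / 2 ^ N) = 2 ^ (q + i) / 2 ^ N * (R / 2 ^ i) := by
  rw [pow_add]; field_simp

lemma dyadic_scale_le {R : ℝ} (hR : 0 ≤ R) {q i N : ℕ} (h : q + i ≤ N) :
    (2 : ℝ) ^ q * (R / 2 ^ N) ≤ R / 2 ^ i := by
  rw [dyadic_scale_eq q i]
  refine mul_le_of_le_one_left (by positivity) ?_
  rw [div_le_one (by positivity)]
  exact pow_le_pow_right₀ (by norm_num) h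

/-- Compatibility conditions on the parameters of the iteration: `J` bounds the number of scale
changes, `k₁` the number of doublings of the time step, `M` the number of moves. -/
structure IterParams (n m : ℕ) (lam Lam M₀ κ T R₀ L₀ a χ θ B η : ℝ) (J N k₁ M : ℕ) : Prop where
  ha : 0 < a
  ha1 : a ≤ 1
  hχ : 0 < χ
  hχ1 : χ ≤ 1 / 40
  hθ : 0 < θ
  hθ1 : θ ≤ 1 / 20
  hB1 : 1 ≤ B
  hB : bigC n m lam M₀ κ ≤ B
  hcond : 100 * 2 ^ m * dropC n m Lam * χ ^ 2 * (9 ^ n * B) < θ ^ (2 * m + 2)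
  hslope : (k₁ + M) * (60 * θ * χ) + 14 * M * χ ≤ 1
  hη : 2 ^ (J + 2 * M) ≤ η * 2 ^ N
  hη1 : (k₁ + 5 * M) * η ≤ 1
  hηκ : η ≤ κ / 2
  hJ : L₀ + 1 ≤ J * (χ * a)
  hN : 2 * J + 2 * M + 2 ≤ N
  hR₀ : 0 < R₀
  hR₀1 : R₀ ≤ 1
  hM : 0 < M
  hgrow : B * (8 * ((1 + M₀) / κ)) ^ (m + 1) * 8 ^ m < a ^ 2 * T ^ m * M

/-- The invariant of the iteration after `i` moves and `k` time steps. -/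
def IterState (m : ℕ) (κ : ℝ) (Ω : Set (E n)) (y₀ : E n) (u : E n → ℝ → ℝ) (i₀ : Fin n)
    (e : E n) (a χ θ R₀ L₀ η δ : ℝ) (J N : ℕ) (b τ s : ℝ) (i k : ℕ) : Prop :=
  ∃ j ≤ J, ∃ x t, BendState m κ Ω y₀ u i₀ e a χ b τ s x t (2 ^ (j + i) * (R₀ / 2 ^ N))
    (R₀ / 2 ^ i) (2 * a + j * (χ * a) - k * (60 * (θ * χ * a)) - i * (14 * (χ * a)))
    (L₀ + (k + 4 * i) * η) (2 - κ⁻¹ + i * δ)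

namespace IterState

variable {m : ℕ} {lam Lam p M₀ κ T : ℝ} {Ω : Set (E n)} {y₀ : E n} {u : E n → ℝ → ℝ}
  {i₀ : Fin n} {e : E n} {a χ θ R₀ L₀ B η δ τ s : ℝ} {J N k₁ M i k : ℕ}

lemma time_step (I : IterState m κ Ω y₀ u i₀ e a χ θ R₀ L₀ η δ J N (9 ^ n * B) τ s i k)
    (S : Setup m lam Lam p M₀ κ T Ω y₀ u)
    (P : IterParams n m lam Lam M₀ κ T R₀ L₀ a χ θ B η J N k₁ M)
    (he : ‖e‖ = 1) {τ' : ℝ} (hτ' : 0 < τ') (hττ : τ' ≤ 2 * τ) (hs : -T / 2 ≤ s - τ')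
    (hδ : 0 ≤ δ) (hi : i ≤ M) (hk : k < k₁ + M) :
    IterState m κ Ω y₀ u i₀ e a χ θ R₀ L₀ η δ J N B τ' (s - τ') i (k + 1) := by
  obtain ⟨ha, ha1, hχ, hχ1, hθ, hθ1, hB1, hB, hcond, hslope, hη, hη1, hηκ, hJ, hN, hR₀, hR₀1, hM,
    hgrow⟩ := P
  obtain ⟨j, hj, x, t, St⟩ := I
  have hηpos : 0 < η := pos_of_mul_pos_left ((by positivity : (0:ℝ) < 2 ^ (J + 2 * M)).trans_le hη)
    (by positivity)
  have hi' : (i : ℝ) ≤ M := by exact_mod_cast hi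
  have hk' : (k : ℝ) + 1 ≤ k₁ + M := by exact_mod_cast hk
  have hχa : 0 < χ * a := by positivity
  have hslack : k * (60 * (θ * χ * a)) + i * (14 * (χ * a)) ≤ a := by
    have h1 := mul_le_mul_of_nonneg_right hslope ha.le
    have h2 : (k : ℝ) * (60 * (θ * χ * a)) ≤ (k₁ + M) * (60 * (θ * χ * a)) := by
      gcongr; linarith
    have h3 : (i : ℝ) * (14 * (χ * a)) ≤ M * (14 * (χ * a)) := by gcongr
    linarith
  have hslackL : (k + 4 * i) * η ≤ 1 := by
    refine le_trans (mul_le_mul_of_nonneg_right ?_ hηpos.le) hη1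
    linarith
  have hscale : ∀ q : ℕ, q + i ≤ N → (2 : ℝ) ^ q * (R₀ / 2 ^ N) ≤ R₀ / 2 ^ i := fun q hq =>
    dyadic_scale_le hR₀.le hq
  set ρ := (2 : ℝ) ^ (j + i) * (R₀ / 2 ^ N) with hρ
  have hpow : ∀ q : ℕ, (2 : ℝ) ^ q * ρ = 2 ^ (q + (j + i)) * (R₀ / 2 ^ N) := fun q => by
    rw [hρ, pow_add 2 q]; ring
  have hs0 : -T / 2 ≤ s := by linarith
  obtain ⟨l, hl, St', hgood⟩ := St.settle S hs0 ha.le hχ.le J (by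
      rw [hpow]; exact hscale _ (by omega)) (by
      have : 0 ≤ (j : ℝ) * (χ * a) := by positivity
      linarith)
  have hle := St'.slope_le S hs0 (by rw [hpow]; exact hscale _ (by omega))
  have hlj : l + j ≤ J := by
    have : ((l + j : ℕ) : ℝ) * (χ * a) ≤ J * (χ * a) := by push_cast; linarith
    exact_mod_cast le_of_mul_le_mul_right this hχa
  have hh : 10 * χ * a * (2 ^ l * ρ) ≤ η * (R₀ / 2 ^ i) := by
    have h1 : 10 * χ * a ≤ 1 := by nlinarith
    have h2 : 0 ≤ 2 ^ l * ρ := by positivity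
    refine (mul_le_of_le_one_left h2 h1).trans ?_
    rw [hpow, dyadic_scale_eq _ i]
    gcongr
    rw [div_le_iff₀ (by positivity)]
    refine le_trans (pow_le_pow_right₀ (by norm_num) (by omega)) hη
  have hRi : R₀ / 2 ^ i ≤ 1 := (div_le_self hR₀.le (one_le_pow₀ (by norm_num))).trans hR₀1
  have hRi0 : 0 < R₀ / 2 ^ i := by positivity
  have hstep := St'.time_step S he hτ' hττ hs hgood
    (by
      have := hscale (1 + (l + (j + i))) (by omega)
      rwa [pow_add, mul_assoc, ← hpow, pow_one] at this) ha hχ hχ1 hθ hθ1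
    (hh.trans ((mul_le_of_le_one_right hηpos.le hRi).trans hηκ))
    (by
      have : 0 ≤ (j : ℝ) * (χ * a) := by positivity
      have : 0 ≤ (l : ℝ) * (χ * a) := by positivity
      linarith)
    (by have : 0 ≤ (i : ℝ) * δ := by positivity
        linarith) hcond
  refine ⟨l + j, hlj, x, t - τ', ?_⟩
  rw [hpow, ← add_assoc] at hstep
  refine hstep.mono hB ?_ ?_ le_rfl hRi0.le
  · push_cast
    linarith
  · rw [hpow, ← add_assoc] at hh
    have := (div_le_iff₀ hRi0).2 hh
    push_cast
    linarith

lemma move (I : IterState m κ Ω y₀ u i₀ e a χ θ R₀ L₀ η δ J N B τ s i k)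
    (S : Setup m lam Lam p M₀ κ T Ω y₀ u)
    (P : IterParams n m lam Lam M₀ κ T R₀ L₀ a χ θ B η J N k₁ M)
    (he : ‖e‖ = 1) (hs : -T / 2 ≤ s) (hδ : 0 ≤ δ) (hηδ : κ⁻¹ * η ≤ 2 * δ)
    (hδτ : B * (8 * δ) ^ (m + 1) < a ^ 2 * τ ^ m) (hi : i < M) :
    IterState m κ Ω y₀ u i₀ e a χ θ R₀ L₀ η δ J N (9 ^ n * B) τ s (i + 1) k := by
  obtain ⟨ha, ha1, hχ, hχ1, hθ, hθ1, hB1, hB, hcond, hslope, hη, hη1, hηκ, hJ, hN, hR₀, hR₀1, hM,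
    hgrow⟩ := P
  obtain ⟨j, hj, x, t, St⟩ := I
  have hηpos : 0 < η := pos_of_mul_pos_left ((by positivity : (0:ℝ) < 2 ^ (J + 2 * M)).trans_le hη)
    (by positivity)
  have hκ := S.κ_pos
  obtain ⟨v, hv, hv1, g, hg, hgv⟩ := St.big
  have hnorm : Real.sqrt (8 * δ) ^ (n - 1) < frameDet (Function.update g i₀ e) := by
    refine lt_of_lt_of_le ?_ hgv
    have hn1 : n - 1 = m + 1 := by have := S.hnm; omega
    rw [hn1]
    refine lt_of_pow_lt_pow_left₀ 2 hv.le ?_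
    rw [← pow_mul, mul_comm (m + 1) 2, pow_mul, Real.sq_sqrt (by positivity)]
    exact lt_of_mul_lt_mul_left (hδτ.trans_le hv1) (by linarith)
  obtain ⟨l, hl⟩ := exists_norm_ge_of_frameDet i₀ he hnorm
  have hRi : R₀ / 2 ^ i ≤ 1 := (div_le_self hR₀.le (one_le_pow₀ (by norm_num))).trans hR₀1
  have hRi0 : 0 < R₀ / 2 ^ i := by positivity
  have hh : 10 * χ * a * (2 ^ (j + i) * (R₀ / 2 ^ N)) ≤ η * (R₀ / 2 ^ i) := by
    have h1 : 10 * χ * a ≤ 1 := by nlinarith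
    have h2 : 0 ≤ 2 ^ (j + i) * (R₀ / 2 ^ N) := by positivity
    refine (mul_le_of_le_one_left h2 h1).trans ?_
    rw [dyadic_scale_eq _ i]
    gcongr
    rw [div_le_iff₀ (by positivity)]
    refine le_trans (pow_le_pow_right₀ (by norm_num) (by omega)) hη
  obtain ⟨y, Sy⟩ := St.move S hs
    (by
      have := dyadic_scale_le hR₀.le (show 2 + (j + i) + i ≤ N by omega)
      rw [pow_add, mul_assoc] at this
      convert this using 1
      norm_num) ha.le hχ.le (hg l) hδ
    (by rw [← Real.sqrt_le_left (norm_nonneg _)]; exact hl)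
    (by
      refine le_trans ?_ hηδ
      gcongr
      exact hh.trans (mul_le_of_le_one_right hηpos.le hRi))
    (by have : 0 ≤ (i : ℝ) * δ := by positivity
        linarith)
  refine ⟨j, hj, y, t, ?_⟩
  have e1 : 2 * (2 ^ (j + i) * (R₀ / 2 ^ N)) = 2 ^ (j + (i + 1)) * (R₀ / 2 ^ N) := by
    rw [← add_assoc, pow_succ]; ring
  have e2 : R₀ / 2 ^ i / 2 = R₀ / 2 ^ (i + 1) := by rw [pow_succ]; field_simp
  rw [e1, e2] at Sy
  refine Sy.mono le_rfl ?_ ?_ ?_ (by positivity)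
  · push_cast
    linarith
  · have := (div_le_iff₀ hRi0).2 hh
    push_cast
    linarith
  · push_cast
    linarith

end IterState

section iteration

variable {m : ℕ} {lam Lam p M₀ κ T : ℝ} {Ω : Set (E n)} {y₀ : E n} {u : E n → ℝ → ℝ}
  {i₀ : Fin n} {e : E n} {a χ θ R₀ L₀ B η τ : ℝ} {J N k₁ M : ℕ}

lemma IterState.mono {δ s : ℝ} {b b' : ℝ} {i k : ℕ}
    (I : IterState m κ Ω y₀ u i₀ e a χ θ R₀ L₀ η δ J N b τ s i k) (hb : b ≤ b') (hR : 0 ≤ R₀) :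
    IterState m κ Ω y₀ u i₀ e a χ θ R₀ L₀ η δ J N b' τ s i k := by
  obtain ⟨j, hj, x, t, St⟩ := I
  exact ⟨j, hj, x, t, St.mono hb le_rfl le_rfl le_rfl (by positivity)⟩

/-- The iteration cannot run to its end. -/
lemma BendState.false_of_iterParams {x : E n} (S : Setup m lam Lam p M₀ κ T Ω y₀ u)
    (P : IterParams n m lam Lam M₀ κ T R₀ L₀ a χ θ B η J N k₁ M) (he : ‖e‖ = 1)
    (hτ : 2 ^ k₁ * τ = T / (8 * M))
    (St : BendState m κ Ω y₀ u i₀ e a χ (9 ^ n * B) τ 0 x 0 (R₀ / 2 ^ N) R₀ (2 * a) L₀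
      (2 - κ⁻¹)) : False := by
  have hT := S.hT
  have hκ := S.κ_pos
  have hM₀ := S.M₀_nonneg
  have hMpos : (0:ℝ) < M := by exact_mod_cast P.hM
  have hM1 : (1:ℝ) ≤ M := by exact_mod_cast P.hM
  have hηpos : 0 < η := pos_of_mul_pos_left
    ((by positivity : (0:ℝ) < 2 ^ (J + 2 * M)).trans_le P.hη) (by positivity)
  have h9 : B ≤ 9 ^ n * B :=
    le_mul_of_one_le_left (by linarith [P.hB1]) (one_le_pow₀ (by norm_num))
  set δ := (1 + M₀) / (κ * M) with hδdef
  have hδ : 0 < δ := by positivity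
  set T₁ := T / (8 * M) with hT₁
  have hT₁pos : 0 < T₁ := by positivity
  have hMT : M * T₁ = T / 8 := by rw [hT₁]; field_simp
  have hT₁le : T₁ ≤ T / 8 := by nlinarith
  have hτpos : 0 < τ := pos_of_mul_pos_right (hτ ▸ hT₁pos) (by positivity)
  have doubling : ∀ k ≤ k₁, IterState m κ Ω y₀ u i₀ e a χ θ R₀ L₀ η δ J N (9 ^ n * B) (2 ^ k * τ)
      (2 * τ - 2 ^ (k + 1) * τ) 0 k := by
    intro k
    induction k with
    | zero =>
      intro _
      exact ⟨0, J.zero_le, x, 0, by simpa using St⟩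
    | succ k ih =>
      intro hk
      have h1 : (2:ℝ) ^ (k + 1) * τ ≤ T₁ := by
        rw [← hτ]
        gcongr
        norm_num
      have e1 : 2 * τ - 2 ^ (k + 1) * τ - 2 ^ (k + 1) * τ = 2 * τ - 2 ^ (k + 1 + 1) * τ := by
        ring
      have := (ih (by omega)).time_step S P he (τ' := 2 ^ (k + 1) * τ) (by positivity)
        (by rw [pow_succ]; linarith) (by linarith) hδ.le (Nat.zero_le _)
        (by have := P.hM; omega)
      rw [e1] at this
      exact this.mono h9 P.hR₀.le
  have steady : ∀ i ≤ M, IterState m κ Ω y₀ u i₀ e a χ θ R₀ L₀ η δ J N (9 ^ n * B) T₁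
      (2 * τ - 2 * T₁ - i * T₁) i (k₁ + i) := by
    intro i
    induction i with
    | zero =>
      intro _
      have := doubling k₁ le_rfl
      rw [pow_succ, mul_comm ((2:ℝ) ^ k₁) 2, mul_assoc, hτ] at this
      simpa using this
    | succ i ih =>
      intro hi
      have hi' : (i:ℝ) + 1 ≤ M := by exact_mod_cast hi
      have h2 := mul_le_mul_of_nonneg_right hi' hT₁pos.le
      have e1 : 2 * τ - 2 * T₁ - i * T₁ - T₁ = 2 * τ - 2 * T₁ - (i + 1 : ℕ) * T₁ := by
        push_cast; ring
      have h3 : -T / 2 ≤ 2 * τ - 2 * T₁ - i * T₁ - T₁ := by linarith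
      have := (ih (by omega)).time_step S P he hT₁pos (by linarith) h3 hδ.le (by omega) (by omega)
      rw [e1] at this h3
      refine this.move S P he h3 hδ.le ?_ ?_ (by omega)
      · rw [hδdef]
        have h4 : η * M ≤ 1 := by
          refine le_trans ?_ P.hη1
          rw [mul_comm]
          refine mul_le_mul_of_nonneg_right ?_ hηpos.le
          have : (0:ℝ) ≤ k₁ := by positivity
          linarith
        have h5 : κ⁻¹ * η = η * M / (κ * M) := by field_simp
        rw [h5, ← mul_div_assoc]
        exact div_le_div_of_nonneg_right (by linarith) (by positivity)
      · have h6 : B * (8 * δ) ^ (m + 1) =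
            B * (8 * ((1 + M₀) / κ)) ^ (m + 1) * 8 ^ m / (8 ^ m * M ^ (m + 1)) := by
          have : 8 * δ = 8 * ((1 + M₀) / κ) / M := by rw [hδdef]; field_simp
          rw [this, div_pow]; field_simp
        have h7 : a ^ 2 * T₁ ^ m = a ^ 2 * T ^ m * M / (8 ^ m * M ^ (m + 1)) := by
          rw [hT₁, div_pow, mul_pow, pow_succ (M : ℝ)]; field_simp
        rw [h6, h7]
        have := P.hgrow
        gcongr
  obtain ⟨j, hj, y, t, Sy⟩ := steady M le_rfl
  have h1 := Sy.hΨ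
  have h2 : ‖y - y₀‖ ^ 2 ≤ 1 :=
    pow_le_one₀ (norm_nonneg _) (S.norm_sub_le (subset_closure Sy.mem))
  have h3 := S.neg_M₀_le (subset_closure Sy.mem) (t := t)
    (le_trans (by linarith) Sy.le_t) Sy.nonpos
  have h4 : M * δ = κ⁻¹ * (1 + M₀) := by rw [hδdef]; field_simp
  have h5 : κ⁻¹ * (-M₀) ≤ κ⁻¹ * u y t := by gcongr
  linarith

end iteration

section secondDiff

variable {m : ℕ} {lam Lam p M₀ κ T : ℝ} {Ω : Set (E n)} {y₀ : E n} {u : E n → ℝ → ℝ}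
  {i₀ : Fin n} {e : E n} {a χ θ R₀ L₀ B η τ : ℝ} {J N k₁ M : ℕ}

lemma bigC_nonneg (hlam : 0 ≤ lam) : 0 ≤ bigC n m lam M₀ κ := by
  unfold bigC
  have : 0 ≤ (planeC n M₀ κ * n) ^ (2 * n) := by rw [pow_mul]; positivity
  positivity

lemma dropC_nonneg (hLam : 0 ≤ Lam) : 0 ≤ dropC n m Lam := by
  unfold dropC; positivity

lemma twenty_five_mul_le_two_pow {J : ℕ} (hJ : 8 ≤ J) : 25 * J ≤ 2 ^ J := by
  induction J, hJ using Nat.le_induction with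
  | base => norm_num
  | succ J hJ ih => rw [pow_succ]; omega

/-- A choice of parameters, in terms of a single large natural number `X`. -/
lemma exists_iterParams (X : ℕ) (hX : 0 < X) (hm : 0 < m) (hlam : 0 < lam) (hκ : 0 < κ)
    (ha : 0 < a) (ha1 : a ≤ 1) (hR₀ : 0 < R₀) (hR₀1 : R₀ ≤ 1)
    (h1 : 1 ≤ X * κ) (h2 : 1 + M₀ ≤ X) (h3 : 1 ≤ X * R₀) (h4 : 1 ≤ X * a)
    (h5 : L₀ + 1 ≤ X * a)
    (h6 : 100 * 2 ^ m * dropC n m Lam * (9 ^ n * (bigC n m lam M₀ κ + 1)) ≤ X)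
    (h7 : (bigC n m lam M₀ κ + 1) * (8 * ((1 + M₀) / κ)) ^ (m + 1) * 8 ^ m < a ^ 2 * T ^ m * X) :
    ∃ χ θ η : ℝ, ∃ J : ℕ, IterParams n m lam Lam M₀ κ T R₀ L₀ a χ θ (bigC n m lam M₀ κ + 1) η J
      (3 * (X * (2000 * X) ^ (m + 2))) (8 * (3 * (X * (2000 * X) ^ (m + 2)))) X ∧
      1 + M₀ ≤ 2 ^ (3 * (X * (2000 * X) ^ (m + 2))) * (10 * χ * a * R₀ ^ 2) := by
  have hXr : (1:ℝ) ≤ X := by exact_mod_cast hX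
  set q : ℕ := 2000 * X with hq
  have hq1 : 2000 ≤ q := by omega
  set Q : ℕ := q ^ (m + 2) with hQ
  have hQq : q ^ 3 ≤ Q := Nat.pow_le_pow_right (by omega) (by omega)
  have hqQ : q ≤ Q := (Nat.le_self_pow (by norm_num) q).trans hQq
  have hXQ : X ^ 3 ≤ Q := (Nat.pow_le_pow_left (by omega) 3).trans hQq
  set J : ℕ := X * Q with hJ
  have hQJ : Q ≤ J := Nat.le_mul_of_pos_left _ hX
  have hJ25 : 25 * J ≤ 2 ^ J := twenty_five_mul_le_two_pow (by omega)
  have hqr : (2000:ℝ) ≤ q := by exact_mod_cast hq1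
  have hqX : (q:ℝ) = 2000 * X := by rw [hq]; push_cast; ring
  have hQr : (q:ℝ) ≤ Q := by exact_mod_cast hqQ
  have hQpos : (0:ℝ) < Q := by linarith
  have hQpow : (Q:ℝ) = (q:ℝ) ^ (m + 2) := by rw [hQ]; push_cast; ring
  have hJr : (J:ℝ) = X * Q := by rw [hJ]; push_cast; ring
  have hJpos : (0:ℝ) < J := by rw [hJr]; positivity
  have hη0 : (2:ℝ) ^ (J + 2 * X) / 2 ^ (3 * J) ≤ 1 / 2 ^ J := by
    rw [div_le_div_iff₀ (by positivity) (by positivity), ← pow_add, one_mul]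
    exact pow_le_pow_right₀ (by norm_num) (by omega)
  have hJ25r : 25 * (J:ℝ) ≤ 2 ^ J := by exact_mod_cast hJ25
  have hbig := bigC_nonneg (n := n) (m := m) (M₀ := M₀) (κ := κ) hlam.le
  refine ⟨1 / Q, 1 / q, 2 ^ (J + 2 * X) / 2 ^ (3 * J), J, ⟨ha, ha1, by positivity, ?_, by positivity,
    ?_, by linarith, by linarith, ?_, ?_, ?_, ?_, ?_, ?_, by omega, hR₀, hR₀1, hX, h7⟩, ?_⟩
  · exact one_div_le_one_div_of_le (by norm_num) (by linarith)
  · exact one_div_le_one_div_of_le (by norm_num) (by linarith)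
  · have e1 : (1 / (Q:ℝ)) ^ 2 = (1 / q) ^ (2 * m + 2) * (1 / q ^ 2) := by
      rw [hQpow]
      simp only [one_div, ← inv_pow, ← pow_mul, ← pow_add]
      congr 1; ring
    have h8 : 100 * 2 ^ m * dropC n m Lam * (9 ^ n * (bigC n m lam M₀ κ + 1)) < (q:ℝ) ^ 2 := by
      nlinarith
    calc _ = (1 / (q:ℝ)) ^ (2 * m + 2) *
          (100 * 2 ^ m * dropC n m Lam * (9 ^ n * (bigC n m lam M₀ κ + 1)) / q ^ 2) := by
          rw [e1]; ring
      _ < (1 / (q:ℝ)) ^ (2 * m + 2) * 1 := by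
          gcongr
          rw [div_lt_one (by positivity)]; exact h8
      _ = _ := mul_one _
  · push_cast
    have e1 : (8 * (3 * (J:ℝ)) + X) * (60 * (1 / q) * (1 / Q)) + 14 * X * (1 / Q) =
        1440 * (X / q) + 60 * (X / q) * (1 / Q) + 14 * (X / Q) := by
      rw [hJr]; field_simp; ring
    have e2 : (X:ℝ) / q = 1 / 2000 := by rw [hqX]; field_simp
    have e3 : (X:ℝ) / Q ≤ 1 / 2000 := by
      rw [← e2]; gcongr
    have e4 : 1 / (Q:ℝ) ≤ 1 / 2000 := one_div_le_one_div_of_le (by norm_num) (by linarith)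
    rw [e1, e2]
    linarith
  · exact (div_mul_cancel₀ _ (by positivity)).ge
  · have e1 : ((8 * (3 * J) : ℕ) + 5 * X : ℝ) ≤ 2 ^ J := by
      refine le_trans ?_ hJ25r
      push_cast
      nlinarith
    calc _ ≤ (2:ℝ) ^ J * (1 / 2 ^ J) := by gcongr
      _ = 1 := by field_simp
  · refine hη0.trans ?_
    rw [div_le_div_iff₀ (by positivity) (by norm_num), one_mul]
    have e1 : 2 * (X:ℝ) ≤ 2 ^ J := by nlinarith
    calc (2:ℝ) ≤ 2 * (X * κ) := by linarith
      _ = κ * (2 * X) := by ring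
      _ ≤ κ * 2 ^ J := by gcongr
  · rw [hJr]
    convert h5 using 1
    field_simp
  · have hJ2 : (J:ℝ) ^ 2 ≤ 2 ^ (3 * J) := by
      have e1 : (J:ℝ) ≤ 2 ^ J := by linarith
      calc (J:ℝ) ^ 2 ≤ (2 ^ J) ^ 2 := by gcongr
        _ = 2 ^ (2 * J) := by rw [← pow_mul, mul_comm]
        _ ≤ _ := pow_le_pow_right₀ (by norm_num) (by omega)
    have hX3 : (X:ℝ) ^ 3 ≤ Q := by exact_mod_cast hXQ
    have hR2 : 1 ≤ X * a * (X * R₀) ^ 2 := one_le_mul_of_one_le_of_one_le h4 (one_le_pow₀ h3)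
    have e2 : (Q:ℝ) * X ≤ 2 ^ (3 * J) * (a * R₀ ^ 2) := by
      have e3 : (Q:ℝ) * X * X ^ 3 ≤ 2 ^ (3 * J) * (a * R₀ ^ 2) * X ^ 3 := by
        calc (Q:ℝ) * X * X ^ 3 ≤ Q * X * Q := by gcongr
          _ ≤ (Q * X) * (Q * X) := by gcongr; nlinarith
          _ = J ^ 2 := by rw [hJr]; ring
          _ ≤ 2 ^ (3 * J) := hJ2
          _ ≤ 2 ^ (3 * J) * (X * a * (X * R₀) ^ 2) := le_mul_of_one_le_right (by positivity) hR2
          _ = _ := by ring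
      exact le_of_mul_le_mul_right e3 (by positivity)
    refine h2.trans ?_
    have e4 : 2 ^ (3 * J) * (10 * (1 / Q) * a * R₀ ^ 2) =
        10 * (2 ^ (3 * J) * (a * R₀ ^ 2)) / Q := by field_simp
    rw [e4, le_div_iff₀ hQpos]
    have : 0 ≤ (Q:ℝ) * X := by positivity
    linarith

/-- The second difference at a small dyadic scale is small. -/
lemma Setup.secondDiff_lt (S : Setup m lam Lam p M₀ κ T Ω y₀ u) {x : E n} (he : ‖e‖ = 1)
    (hT1 : T ≤ 1)
    (P : IterParams n m lam Lam M₀ κ T R₀ (2 * (1 + M₀) / R₀) a χ θ B η J N (8 * N) M)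
    (hN : 1 + M₀ ≤ 2 ^ N * (10 * χ * a * R₀ ^ 2)) (hx : x ∈ Ω) (hux : u x 0 ≤ 1 - 2 * κ)
    (hball : ∀ g : E n, ‖g‖ ≤ R₀ → x + g ∈ closure Ω ∧ u (x + g) 0 ≤ 1) :
    secondDiff (fun y => u y 0) x e (R₀ / 2 ^ N) < 2 * a * (R₀ / 2 ^ N) := by
  have hT := S.hT
  have hn0 : 0 < n := by have := S.hnm; omega
  have i₀ : Fin n := ⟨0, hn0⟩
  have hR₀ := P.hR₀
  have ha := P.ha
  have hχ := P.hχ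
  have hκ := S.κ_pos
  have hM₀ := S.M₀_nonneg
  have hMpos : (0:ℝ) < M := by exact_mod_cast P.hM
  have hm := S.hm
  have hux0 : -M₀ ≤ u x 0 := S.neg_M₀_le (subset_closure hx) (by linarith) le_rfl
  have hcv := S.reg.conv 0 (S.mem_Icc (by linarith) le_rfl)
  by_contra hcon
  push Not at hcon
  have hRe := hball (R₀ • e) (by rw [norm_smul, he, mul_one, Real.norm_of_nonneg hR₀.le])
  have hRe' := hball (-(R₀ • e))
    (by rw [norm_neg, norm_smul, he, mul_one, Real.norm_of_nonneg hR₀.le])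
  rw [← sub_eq_add_neg] at hRe'
  set h := 10 * χ * a * (R₀ / 2 ^ N) with hh
  have hhpos : 0 < h := by positivity
  set r := R₀ * h / (1 + M₀) with hr
  have hrpos : 0 < r := by positivity
  have hrN : 1 / 2 ^ (2 * N) ≤ r := by
    rw [hr, hh, div_le_div_iff₀ (by positivity) (by positivity), one_mul, two_mul, pow_add]
    refine hN.trans (le_of_eq ?_)
    field_simp
  have hsec : ∀ g : E n, ‖g‖ ≤ r → g ∈ secG (closure Ω) (fun y => u y 0) x h := by
    set s := h / (1 + M₀) with hs
    have hspos : 0 < s := by positivity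
    have hs1 : s ≤ 1 := by
      rw [hs, div_le_one (by positivity), hh]
      have h1 : 10 * χ * a ≤ 1 := by nlinarith [P.hχ1, P.ha1]
      have h2 : R₀ / 2 ^ N ≤ 1 :=
        (div_le_self hR₀.le (one_le_pow₀ (by norm_num))).trans P.hR₀1
      have := mul_le_one₀ h1 (by positivity) h2
      linarith
    have hrs : r = R₀ * s := by rw [hr, hs]; ring
    have key : ∀ g : E n, ‖g‖ ≤ r → x + g ∈ closure Ω ∧ u (x + g) 0 ≤ u x 0 + h := by
      intro g hg
      have hb := hball (s⁻¹ • g) (by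
        rw [norm_smul, Real.norm_of_nonneg (by positivity), inv_mul_le_iff₀ hspos, mul_comm,
          ← hrs]
        exact hg)
      have hc := hcv.2 (subset_closure hx) hb.1 (show 0 ≤ 1 - s by linarith) hspos.le (by ring)
      have e1 : (1 - s) • x + s • (x + s⁻¹ • g) = x + g := by
        rw [smul_add, smul_smul, mul_inv_cancel₀ hspos.ne']; module
      rw [e1] at hc
      simp only [smul_eq_mul] at hc
      refine ⟨(hball g (hg.trans (by rw [hrs]; exact mul_le_of_le_one_right hR₀.le hs1))).1, ?_⟩
      have h3 : s * (1 + M₀) = h := by rw [hs]; field_simp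
      have h4 := mul_le_mul_of_nonneg_left hb.2 hspos.le
      have h5 := mul_le_mul_of_nonneg_left hux0 hspos.le
      linarith
    intro g hg
    have k1 := key g hg
    have k2 := key (-g) (by rwa [norm_neg])
    rw [← sub_eq_add_neg] at k2
    exact ⟨k1.1, k2.1, by linarith [k1.2, k2.2]⟩
  obtain ⟨g, hg, hgd⟩ := exists_frame_of_ball i₀ he hrpos.le
  refine BendState.false_of_iterParams (i₀ := i₀) (τ := T / (8 * M) / 2 ^ (8 * N)) (x := x) S P he
    (by field_simp) ⟨hx, le_rfl, le_rfl, hRe.1, hRe'.1, by positivity, ?_, hcon, ?_,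
      r ^ (n - 1), by positivity, ?_, g, fun i => hsec _ (hg i), hgd⟩
  · have : 2 * (1 + M₀) / R₀ * R₀ = 2 * (1 + M₀) := by field_simp
    rw [this]
    unfold secondDiff
    linarith [hRe.2, hRe'.2]
  · have h1 : κ⁻¹ * u x 0 ≤ κ⁻¹ * (1 - 2 * κ) := by gcongr
    have h2 : κ⁻¹ * (1 - 2 * κ) = κ⁻¹ - 2 := by field_simp
    have : 0 ≤ ‖x - y₀‖ ^ 2 := by positivity
    linarith
  · have hn1 : n - 1 = m + 1 := by have := S.hnm; omega
    rw [hn1]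
    have h9 : (1:ℝ) ≤ 9 ^ n * B :=
      one_le_mul_of_one_le_of_one_le (one_le_pow₀ (by norm_num)) P.hB1
    have hM1 : (1:ℝ) ≤ M := by exact_mod_cast P.hM
    have hTM : T / (8 * M) ≤ 1 := by rw [div_le_one (by positivity)]; linarith
    calc a ^ 2 * (T / (8 * M) / 2 ^ (8 * N)) ^ m ≤ 1 * (1 / 2 ^ (8 * N)) ^ m := by
          have := P.ha1
          gcongr
          exact pow_le_one₀ ha.le this
      _ = (1 / 2) ^ (8 * N * m) := by rw [one_mul, ← one_div_pow, ← pow_mul]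
      _ ≤ (1 / 2) ^ (2 * N * ((m + 1) * 2)) :=
          pow_le_pow_of_le_one (by norm_num) (by norm_num) (by nlinarith)
      _ = ((1 / 2 ^ (2 * N)) ^ (m + 1)) ^ 2 := by
          rw [← one_div_pow, ← pow_mul, ← pow_mul, mul_assoc]
      _ ≤ (r ^ (m + 1)) ^ 2 := by gcongr
      _ ≤ _ := le_mul_of_one_le_left (by positivity) h9

end secondDiff

/-- An explicit bound for `-u` on the second half of the time interval. -/
def lowerC (m : ℕ) (lam T : ℝ) : ℝ := (4 * (m / lam) ^ m + 1) * 2 ^ m / T ^ m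

/-- The power with which the large parameter depends on the slope. -/
def paramExp (n m : ℕ) : ℕ := m * (2 * n + m + 1) + (m + 2)

lemma exists_large_param (n m : ℕ) {lam Lam d : ℝ} (hm : 0 < m) (hlam : 0 < lam) (hLam : 0 < Lam)
    (hd : 0 < d) (hd1 : d ≤ 1) :
    ∃ c : ℝ, 0 ≤ c ∧ ∀ T a : ℝ, 0 < T → T ≤ 1 → 0 < a → a ≤ 1 → ∃ X : ℕ, 0 < X ∧
      X * (a * T) ^ paramExp n m ≤ c ∧ 1 ≤ X * (d / 16) ∧ 1 + lowerC m lam T ≤ X ∧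
      1 ≤ X * (d / 2) ∧ 1 ≤ X * a ∧ 2 * (1 + lowerC m lam T) / (d / 2) + 1 ≤ X * a ∧
      100 * 2 ^ m * dropC n m Lam * (9 ^ n * (bigC n m lam (lowerC m lam T) (d / 16) + 1)) ≤ X ∧
      (bigC n m lam (lowerC m lam T) (d / 16) + 1) *
        (8 * ((1 + lowerC m lam T) / (d / 16))) ^ (m + 1) * 8 ^ m < a ^ 2 * T ^ m * X := by
  set D : ℝ := ((4 * (m / lam) ^ m + 1) * 2 ^ m + 1) * (16 / d) with hD
  set c₁ : ℝ := 144 * (m / lam) ^ m * (2 * (n + 2) * n) ^ (2 * n) * n ^ 2 + 1 with hc₁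
  have hc₁1 : 1 ≤ c₁ := by
    rw [hc₁]
    have : (0:ℝ) ≤ 144 * (m / lam) ^ m * (2 * (n + 2) * n) ^ (2 * n) * n ^ 2 := by positivity
    linarith
  have hdr := dropC_nonneg (n := n) (m := m) hLam.le
  set c₂ : ℝ := 3 + 100 * 2 ^ m * dropC n m Lam * (9 ^ n * c₁) + c₁ * 8 ^ (2 * m + 1) with hc₂
  have h16 : 16 ≤ 16 / d := by rw [le_div_iff₀ hd]; linarith
  have hA1 : 1 ≤ (4 * (m / lam) ^ m + 1) * 2 ^ m + 1 := by
    have : 0 ≤ (4 * (m / lam) ^ m + 1) * 2 ^ m := by positivity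
    linarith
  have hD1 : 16 / d ≤ D := le_mul_of_one_le_left (by positivity) hA1
  have hc₂1 : 3 ≤ c₂ := by
    have h1 : 0 ≤ 100 * 2 ^ m * dropC n m Lam * (9 ^ n * c₁) := by positivity
    have h2 : 0 ≤ c₁ * 8 ^ (2 * m + 1) := by positivity
    linarith
  have hDpos : 0 < D := by linarith
  refine ⟨c₂ * D ^ (2 * n + m + 1) + 1, by positivity, fun T a hT hT1 ha ha1 => ?_⟩
  set z := (a * T)⁻¹ with hz
  have haT : 0 < a * T := by positivity
  have haT1 : a * T ≤ 1 := mul_le_one₀ ha1 hT.le hT1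
  have hz1 : 1 ≤ z := (one_le_inv₀ haT).2 haT1
  set w := D * z ^ m with hw
  have hzm : 1 ≤ z ^ m := one_le_pow₀ hz1
  have hwD : D ≤ w := le_mul_of_one_le_right hDpos.le hzm
  have hw1 : 1 ≤ w := by linarith
  have hM₀ : 0 ≤ lowerC m lam T := by unfold lowerC; positivity
  have hMw : (1 + lowerC m lam T) * (16 / d) ≤ w := by
    have h1 : (T ^ m)⁻¹ ≤ z ^ m := by
      rw [hz, inv_pow]
      gcongr
      exact mul_le_of_le_one_left hT.le ha1
    have h2 : lowerC m lam T ≤ (4 * (m / lam) ^ m + 1) * 2 ^ m * z ^ m := by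
      unfold lowerC
      rw [div_eq_mul_inv]
      gcongr
    calc _ ≤ (z ^ m + (4 * (m / lam) ^ m + 1) * 2 ^ m * z ^ m) * (16 / d) := by gcongr
      _ = _ := by rw [hw, hD]; ring
  have hw16 : 16 / d ≤ w := hD1.trans hwD
  have hMw' : 1 + lowerC m lam T ≤ w :=
    (le_mul_of_one_le_right (by linarith) (by linarith)).trans hMw
  have hbig : bigC n m lam (lowerC m lam T) (d / 16) + 1 ≤ c₁ * w ^ (2 * n) := by
    have h1 : planeC n (lowerC m lam T) (d / 16) * n ≤ 2 * (n + 2) * n * w := by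
      have : planeC n (lowerC m lam T) (d / 16) * n =
          2 * (n + 2) * n * ((1 + lowerC m lam T) * (16 / d)) := by
        unfold planeC; field_simp
      rw [this]; gcongr
    have h0 : 0 ≤ planeC n (lowerC m lam T) (d / 16) * n := by unfold planeC; positivity
    have h2 : 1 ≤ w ^ (2 * n) := one_le_pow₀ hw1
    unfold bigC
    calc _ ≤ 144 * (m / lam) ^ m * (2 * (n + 2) * n * w) ^ (2 * n) * n ^ 2 + w ^ (2 * n) := by
          gcongr
      _ = _ := by rw [hc₁, mul_pow]; ring
  have hbig0 := bigC_nonneg (n := n) (m := m) (M₀ := lowerC m lam T) (κ := d / 16) hlam.le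
  set W := w ^ (2 * n + m + 1) with hW
  have hW1 : w ≤ W := le_self_pow₀ hw1 (by omega)
  have hW2 : w ^ (2 * n) ≤ W := pow_le_pow_right₀ hw1 (by omega)
  set Z := z ^ (m + 2) with hZ
  have hZ1 : z ≤ Z := le_self_pow₀ hz1 (by omega)
  have hWZ : W ≤ W * Z := le_mul_of_one_le_right (by positivity) (hz1.trans hZ1)
  have hlt := Nat.lt_floor_add_one (c₂ * (W * Z))
  have hfl := Nat.floor_le (show 0 ≤ c₂ * (W * Z) by positivity)
  have hcW : c₂ * W ≤ c₂ * (W * Z) := by gcongr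
  have hza : z * a = T⁻¹ := by rw [hz]; field_simp
  have hZa : 1 ≤ Z * a := by
    have : 1 ≤ z * a := by rw [hza]; exact (one_le_inv₀ hT).2 hT1
    exact this.trans (by gcongr)
  set X := ⌊c₂ * (W * Z)⌋₊ + 1 with hX
  have hXr : c₂ * (W * Z) < X := by rw [hX]; push_cast; exact hlt
  have h3W : 3 * W ≤ c₂ * W := by gcongr
  have hXa : 3 * W ≤ X * a := by
    calc 3 * W ≤ c₂ * W := h3W
      _ ≤ c₂ * W * (Z * a) := le_mul_of_one_le_right (by positivity) hZa
      _ = c₂ * (W * Z) * a := by ring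
      _ ≤ X * a := by gcongr
  have hXd : 1 ≤ X * (d / 16) := by
    have : 16 / d ≤ X := by linarith
    rw [div_le_iff₀ hd] at this
    linarith
  refine ⟨X, Nat.succ_pos _, ?_, hXd, by linarith, ?_, by linarith, ?_, ?_, ?_⟩
  · have h1 : (X:ℝ) ≤ c₂ * (W * Z) + 1 := by rw [hX]; push_cast; linarith
    have h2 : W * Z * (a * T) ^ paramExp n m = D ^ (2 * n + m + 1) := by
      have h3 : z * (a * T) = 1 := inv_mul_cancel₀ haT.ne'
      rw [hW, hZ, hw, paramExp, mul_pow, ← pow_mul, pow_add (a * T)]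
      calc _ = D ^ (2 * n + m + 1) * (z * (a * T)) ^ (m * (2 * n + m + 1)) *
            (z * (a * T)) ^ (m + 2) := by rw [mul_pow, mul_pow]; ring
        _ = _ := by rw [h3]; simp
    calc (X:ℝ) * (a * T) ^ paramExp n m ≤ (c₂ * (W * Z) + 1) * (a * T) ^ paramExp n m := by gcongr
      _ = c₂ * (W * Z * (a * T) ^ paramExp n m) + (a * T) ^ paramExp n m := by ring
      _ ≤ _ := by
        rw [h2]
        gcongr
        exact pow_le_one₀ haT.le haT1
  · have : 0 < (X:ℝ) * d := by positivity
    linarith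
  · have : 2 * (1 + lowerC m lam T) / (d / 2) ≤ w := by
      refine le_trans (le_of_eq ?_) ((mul_le_mul_of_nonneg_left
        (show 4 / d ≤ 16 / d by gcongr; norm_num) (show 0 ≤ 1 + lowerC m lam T by linarith)).trans
        hMw)
      field_simp; ring
    linarith
  · calc _ ≤ 100 * 2 ^ m * dropC n m Lam * (9 ^ n * (c₁ * w ^ (2 * n))) := by gcongr
      _ ≤ 100 * 2 ^ m * dropC n m Lam * (9 ^ n * (c₁ * W)) := by gcongr
      _ = 100 * 2 ^ m * dropC n m Lam * (9 ^ n * c₁) * W := by ring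
      _ ≤ c₂ * W := by
        gcongr
        have : 0 ≤ c₁ * 8 ^ (2 * m + 1) := by positivity
        linarith
      _ ≤ _ := by linarith
  · have h1 : (1 + lowerC m lam T) / (d / 16) ≤ w := by
      refine le_trans (le_of_eq ?_) hMw
      field_simp
    have h2 : 1 ≤ a ^ 2 * T ^ m * Z := by
      have : a ^ 2 * T ^ m * Z = ((a ^ m)⁻¹) * (T ^ 2)⁻¹ := by
        rw [hZ, hz, inv_pow, mul_pow, pow_add, pow_add]; field_simp
      rw [this]
      exact one_le_mul_of_one_le_of_one_le ((one_le_inv₀ (by positivity)).2 (pow_le_one₀ ha.le ha1))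
        ((one_le_inv₀ (by positivity)).2 (pow_le_one₀ hT.le hT1))
    calc _ ≤ c₁ * w ^ (2 * n) * (8 * w) ^ (m + 1) * 8 ^ m := by gcongr
      _ = c₁ * 8 ^ (2 * m + 1) * W := by
        rw [hW, show (8 * w) ^ (m + 1) = 8 ^ (m + 1) * w ^ (m + 1) from mul_pow _ _ _]; ring
      _ ≤ c₂ * W := by
        gcongr
        have : 0 ≤ 100 * 2 ^ m * dropC n m Lam * (9 ^ n * c₁) := by positivity
        linarith
      _ ≤ c₂ * W * (a ^ 2 * T ^ m * Z) := le_mul_of_one_le_right (by positivity) h2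
      _ = a ^ 2 * T ^ m * (c₂ * (W * Z)) := by ring
      _ < _ := by gcongr

/-- The power in the final estimate. -/
def finalExp (n m : ℕ) : ℕ := paramExp n m * (m + 3)

/-- The second differences become small at a scale depending polynomially on the slope. -/
lemma exists_scale (n m : ℕ) {lam Lam d : ℝ} (hm : 0 < m) (hlam : 0 < lam) (hLam : 0 < Lam)
    (hd : 0 < d) (hd1 : d ≤ 1) :
    ∃ C : ℝ, 0 ≤ C ∧ ∀ (p T : ℝ) (Ω : Set (E n)) (y₀ : E n) (u : E n → ℝ → ℝ), T ≤ 1 →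
      Setup m lam Lam p (lowerC m lam T) (d / 16) T Ω y₀ u → ∀ a : ℝ, 0 < a → a ≤ 1 →
      ∃ N : ℕ, N * (a * T) ^ finalExp n m ≤ C ∧ ∀ x ∈ Ω, u x 0 ≤ 1 - 2 * (d / 16) →
      (∀ g : E n, ‖g‖ ≤ d / 2 → x + g ∈ closure Ω ∧ u (x + g) 0 ≤ 1) → ∀ e : E n, ‖e‖ = 1 →
      secondDiff (fun y => u y 0) x e (d / 2 / 2 ^ N) < 2 * a * (d / 2 / 2 ^ N) := by
  obtain ⟨c, hc, hparam⟩ := exists_large_param n m hm hlam hLam hd hd1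
  refine ⟨3 * 2000 ^ (m + 2) * c ^ (m + 3), by positivity,
    fun p T Ω y₀ u hT1 S a ha ha1 => ?_⟩
  have hT := S.hT
  obtain ⟨X, hX, hXc, h1, h2, h3, h4, h5, h6, h7⟩ := hparam T a hT hT1 ha ha1
  refine ⟨3 * (X * (2000 * X) ^ (m + 2)), ?_, fun x hx hux hball e he => ?_⟩
  · calc _ = 3 * 2000 ^ (m + 2) * (X * (a * T) ^ paramExp n m) ^ (m + 3) := by
          rw [finalExp, pow_mul]; push_cast; ring
      _ ≤ _ := by gcongr
  · obtain ⟨χ, θ, η, J, P, hP⟩ := exists_iterParams X hX hm hlam S.κ_pos ha ha1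
      (show 0 < d / 2 by positivity) (by linarith) h1 h2 h3 h4 h5 h6 h7
    exact S.secondDiff_lt he hT1 P hP hx hux hball

/-- A continuous convex function on an open set has a subgradient at every point. -/
lemma ConvexOn.exists_subgradient {U : Set (E n)} {f : E n → ℝ} (hf : ConvexOn ℝ U f)
    (hU : IsOpen U) (hc : ContinuousOn f U) {x : E n} (hx : x ∈ U) :
    ∃ g : E n, ∀ y ∈ U, f x + ⟪g, y - x⟫ ≤ f y := by
  have hopen : IsOpen {q : E n × ℝ | q.1 ∈ U ∧ f q.1 < q.2} := by
    have h1 : ContinuousOn (fun q : E n × ℝ => q.2 - f q.1) (U ×ˢ univ) :=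
      continuousOn_snd.sub (hc.comp continuousOn_fst fun q hq => hq.1)
    convert h1.isOpen_inter_preimage (hU.prod isOpen_univ) (isOpen_Ioi (a := (0 : ℝ))) using 1
    ext q
    simp
  obtain ⟨φ, hφ⟩ := geometric_hahn_banach_open_point hf.convex_strict_epigraph hopen
    (show (x, f x) ∉ {q : E n × ℝ | q.1 ∈ U ∧ f q.1 < q.2} from fun h => lt_irrefl _ h.2)
  have hsplit (y : E n) (t : ℝ) : φ (y, t) = φ (y, 0) + t * φ (0, 1) := by
    have : ((y, t) : E n × ℝ) = (y, 0) + t • (0, 1) := by simp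
    rw [this, map_add, map_smul, smul_eq_mul]
  have hc0 : φ (0, 1) < 0 := by
    have := hφ (x, f x + 1) ⟨hx, by simp⟩
    rw [hsplit, hsplit x (f x)] at this
    linarith
  set c := φ (0, 1)
  set l : E n →L[ℝ] ℝ := (-c)⁻¹ • φ.comp (ContinuousLinearMap.inl ℝ (E n) ℝ)
  refine ⟨(InnerProductSpace.toDual ℝ (E n)).symm l, fun y hy => ?_⟩
  rw [InnerProductSpace.toDual_symm_apply]
  have hly : l (y - x) = (-c)⁻¹ * (φ (y, 0) - φ (x, 0)) := by
    have : ((y - x, 0) : E n × ℝ) = (y, 0) - (x, 0) := by simp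
    change (-c)⁻¹ * φ (y - x, 0) = _
    rw [this, map_sub]
  refine le_of_forall_gt_imp_ge_of_dense fun t ht => ?_
  have h := hφ (y, t) ⟨hy, ht⟩
  rw [hsplit, hsplit x (f x)] at h
  have : (-c)⁻¹ * (φ (y, 0) - φ (x, 0)) ≤ t - f x := by
    rw [inv_mul_le_iff₀ (by linarith)]
    linarith
  linarith

/-- A convex function whose second differences at `x` are small has a gradient there. -/
lemma exists_hasGradientAt {f : E n → ℝ} {x : E n} {ρ : ℝ} (hρ : 0 < ρ)
    (hf : ConvexOn ℝ (ball x ρ) f) (hc : ContinuousOn f (ball x ρ))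
    (hsmall : ∀ a, 0 < a → a ≤ 1 → ∃ r, 0 < r ∧ r < ρ ∧ ∀ e : E n, ‖e‖ = 1 →
      secondDiff f x e r < 2 * a * r) :
    ∃ g : E n, HasGradientAt f g x ∧ (∀ y ∈ ball x ρ, f x + ⟪g, y - x⟫ ≤ f y) ∧
      ∀ a r, 0 < r → r < ρ → (∀ e : E n, ‖e‖ = 1 → secondDiff f x e r < 2 * a * r) →
      ∀ v : E n, ‖v‖ ≤ r → f (x + v) ≤ f x + ⟪g, v⟫ + 2 * a * ‖v‖ := by
  obtain ⟨g, hg⟩ := hf.exists_subgradient isOpen_ball hc (mem_ball_self hρ)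
  have key : ∀ a r, 0 < r → r < ρ → (∀ e : E n, ‖e‖ = 1 → secondDiff f x e r < 2 * a * r) →
      ∀ v : E n, ‖v‖ ≤ r → f (x + v) ≤ f x + ⟪g, v⟫ + 2 * a * ‖v‖ := by
    intro a r hr hrρ h v hv
    rcases eq_or_ne v 0 with rfl | hv0
    · simp
    have hv0' : 0 < ‖v‖ := norm_pos_iff.2 hv0
    have he : ‖‖v‖⁻¹ • v‖ = 1 := norm_smul_inv_norm hv0
    have hev : ‖v‖ • (‖v‖⁻¹ • v) = v := smul_inv_smul₀ hv0'.ne' v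
    have hmem (s : ℝ) (hs : |s| < ρ) : x + s • (‖v‖⁻¹ • v) ∈ ball x ρ := by
      rw [mem_ball, dist_eq_norm, add_sub_cancel_left, norm_smul, he]; simpa using hs
    have h1 := secondDiff_mul_le (s := ‖v‖) hf (hmem r (by rwa [abs_of_pos hr]))
      (by rw [sub_eq_add_neg, ← neg_smul]; exact hmem (-r) (by rwa [abs_neg, abs_of_pos hr]))
      hv0'.le hv
    have h2 : secondDiff f x (‖v‖⁻¹ • v) ‖v‖ ≤ 2 * a * ‖v‖ := by
      refine le_of_mul_le_mul_right (h1.trans ?_) hr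
      calc _ ≤ 2 * a * r * ‖v‖ := by gcongr; exact (h _ he).le
        _ = _ := by ring
    have h3 := hg (x - v) (by
      rw [mem_ball, dist_eq_norm, sub_sub_cancel_left, norm_neg]; linarith)
    rw [sub_sub_cancel_left, inner_neg_right] at h3
    rw [secondDiff, hev] at h2
    linarith
  refine ⟨g, ?_, hg, key⟩
  rw [hasGradientAt_iff_isLittleO, Asymptotics.isLittleO_iff]
  intro c hc
  obtain ⟨r, hr, hrρ, h⟩ := hsmall (min (c / 2) 1) (by positivity) (min_le_right _ _)
  filter_upwards [ball_mem_nhds x hr] with y hy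
  have hyr : ‖y - x‖ < r := by rwa [← dist_eq_norm]
  have h1 := key _ r hr hrρ h (y - x) hyr.le
  rw [add_sub_cancel] at h1
  have h2 := hg y (ball_subset_ball hrρ.le hy)
  have h3 : 2 * min (c / 2) 1 * ‖y - x‖ ≤ c * ‖y - x‖ := by
    gcongr; linarith [min_le_left (c / 2) 1]
  rw [Real.norm_eq_abs, abs_le]
  have := mul_nonneg hc.le (norm_nonneg (y - x))
  constructor <;> linarith

/-- A vector whose pairings with the sphere of radius `r` are at most `c * r` has norm at most
`c`. -/
lemma norm_le_of_inner_le {w : E n} {r c : ℝ} (hr : 0 < r) (hc : 0 ≤ c)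
    (h : ∀ v : E n, ‖v‖ = r → ⟪w, v⟫ ≤ c * r) : ‖w‖ ≤ c := by
  rcases eq_or_ne w 0 with rfl | hw
  · simpa using hc
  have hw' : 0 < ‖w‖ := norm_pos_iff.2 hw
  have := h ((r * ‖w‖⁻¹) • w) (by
    rw [norm_smul, Real.norm_of_nonneg (by positivity)]; field_simp)
  rw [inner_smul_right, real_inner_self_eq_norm_sq] at this
  have e : r * ‖w‖⁻¹ * ‖w‖ ^ 2 = ‖w‖ * r := by field_simp
  rw [e] at this
  exact le_of_mul_le_mul_right this hr

/-- Comparison of subgradients at two points through the modulus of one of them. -/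
lemma norm_subgradient_sub_le {U : Set (E n)} {f : E n → ℝ} {x y g g' : E n} {a r : ℝ}
    (hr : 0 < r) (ha : 0 ≤ a) (hxy : ‖y - x‖ ≤ r) (hxU : y ∈ U)
    (hx : ∀ z ∈ U, f x + ⟪g, z - x⟫ ≤ f z)
    (hy : ∀ v, ‖v‖ = r → f y + ⟪g', v⟫ ≤ f (y + v))
    (hW : ∀ v : E n, ‖v‖ ≤ 2 * r → f (x + v) ≤ f x + ⟪g, v⟫ + 2 * a * ‖v‖) :
    ‖g - g'‖ ≤ 4 * a := by
  rw [norm_sub_rev]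
  refine norm_le_of_inner_le hr (by positivity) fun v hv => ?_
  have hn : ‖y - x + v‖ ≤ 2 * r := (norm_add_le _ _).trans (by linarith)
  have h1 := hW _ hn
  have e : x + (y - x + v) = y + v := by module
  rw [e, inner_add_right] at h1
  have h2 := hx y hxU
  have h3 := hy v hv
  have h4 : 2 * a * ‖y - x + v‖ ≤ 2 * a * (2 * r) := by gcongr
  rw [inner_sub_left]
  linarith

lemma setDist_le {A B : Set (E n)} {x y : E n} (hx : x ∈ A) (hy : y ∈ B) :
    setDist A B ≤ dist x y :=
  csInf_le ⟨0, by rintro _ ⟨a, -, b, -, rfl⟩; exact dist_nonneg⟩ (mem_image2_of_mem hx hy)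

/-- Balls centred in `K` with radius the distance from `K` to the frontier stay inside. -/
lemma ball_setDist_frontier_subset {K U : Set (E n)} (hU : IsOpen U) (hKU : K ⊆ U) {x : E n}
    (hx : x ∈ K) : ball x (setDist K (frontier U)) ⊆ U := by
  rcases le_or_gt (setDist K (frontier U)) 0 with h0 | h0
  · rw [ball_eq_empty.2 h0]; exact empty_subset _
  refine (convex_ball x _).isPreconnected.subset_of_closure_inter_subset hU
    ⟨x, mem_ball_self h0, hKU hx⟩ fun z hz => ?_
  by_contra hzU
  have hzf : z ∈ frontier U := ⟨hz.1, fun h => hzU (interior_subset h)⟩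
  have := setDist_le hx hzf
  rw [dist_comm] at this
  exact absurd (mem_ball.1 hz.2) (not_lt.2 this)

lemma setDist_frontier_pos [NeZero n] {K U : Set (E n)} (hU : IsOpen U)
    (hb : Bornology.IsBounded U) (hK : IsCompact K) (hne : K.Nonempty) (hKU : K ⊆ U) :
    0 < setDist K (frontier U) := by
  obtain ⟨δ, hδ, hsub⟩ := hK.exists_thickening_subset_open hU hKU
  have hfr : (frontier U).Nonempty := nonempty_frontier_iff.2 ⟨hne.mono hKU, fun h => by
    rw [h] at hb
    exact noncompact_univ (E n) (isCompact_of_isClosed_isBounded isClosed_univ hb)⟩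
  refine hδ.trans_le (le_csInf (hne.image2 hfr) ?_)
  rintro _ ⟨a, ha, b, hb, rfl⟩
  by_contra hlt
  rw [hU.frontier_eq] at hb
  exact hb.2 (hsub (mem_thickening_iff.2 ⟨a, ha, by rw [dist_comm]; exact not_le.1 hlt⟩))

/-- A convex function vanishing at the origin and at most `1` near `x` is less than `1` at `x`. -/
lemma ConvexOn.le_one_sub_of_ball {S : Set (E n)} {f : E n → ℝ} (hf : ConvexOn ℝ S f)
    (h0 : (0 : E n) ∈ S) (hf0 : f 0 = 0) {x : E n} (hx : ‖x‖ ≤ 2) {d : ℝ} (hd : 0 < d)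
    (hd1 : d ≤ 1) (hball : ∀ g : E n, ‖g‖ ≤ d / 2 → x + g ∈ S ∧ f (x + g) ≤ 1) :
    f x ≤ 1 - 2 * (d / 16) := by
  obtain ⟨hS, h1⟩ := hball ((d / 4) • x) (by
    rw [norm_smul, Real.norm_of_nonneg (by positivity)]; nlinarith)
  have h4 : (0 : ℝ) < 1 + d / 4 := by positivity
  have hc : (1 + d / 4)⁻¹ ≤ 1 := inv_le_one_of_one_le₀ (by linarith)
  have h := hf.2 hS h0 (show 0 ≤ (1 + d / 4)⁻¹ by positivity)
    (show 0 ≤ 1 - (1 + d / 4)⁻¹ by linarith) (by ring)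
  have e : (1 + d / 4)⁻¹ • (x + (d / 4) • x) + (1 - (1 + d / 4)⁻¹) • (0 : E n) = x := by
    rw [smul_zero, add_zero, show x + (d / 4) • x = (1 + d / 4) • x by module,
      inv_smul_smul₀ h4.ne']
  rw [e, hf0] at h
  simp only [smul_eq_mul, mul_zero, add_zero] at h
  have h2 : (1 + d / 4)⁻¹ * f (x + (d / 4) • x) ≤ (1 + d / 4)⁻¹ :=
    mul_le_of_le_one_right (by positivity) h1
  have h3 : (1 + d / 4)⁻¹ ≤ 1 - 2 * (d / 16) := by
    rw [inv_le_iff_one_le_mul₀ h4]; nlinarith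
  linarith

lemma two_mul_le_dyadic {r d : ℝ} {N : ℕ} (hr : 0 < r) (hd : 0 < d)
    (h1 : 2 * Real.log (4 / d) ≤ -Real.log r) (h2 : (N : ℝ) ≤ -Real.log r / 2) :
    2 * r ≤ d / 2 / 2 ^ N := by
  have h3 : (2 : ℝ) ^ N ≤ Real.exp (-Real.log r / 2) := by
    calc (2 : ℝ) ^ N ≤ Real.exp 1 ^ N := by
          gcongr; linarith [Real.add_one_le_exp (1 : ℝ)]
      _ = Real.exp N := by rw [← Real.exp_nat_mul, mul_one]
      _ ≤ _ := Real.exp_le_exp.2 h2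
  have h4 : 4 / d ≤ Real.exp (-Real.log r / 2) := by
    rw [← Real.log_le_iff_le_exp (by positivity)]; linarith
  have h5 : 2 ^ N * (4 / d) ≤ r⁻¹ := by
    calc _ ≤ Real.exp (-Real.log r / 2) * Real.exp (-Real.log r / 2) := by gcongr
      _ = _ := by rw [← Real.exp_add, add_halves, Real.exp_neg, Real.exp_log hr]
  rw [le_div_iff₀ (by positivity)]
  have h6 := mul_le_mul_of_nonneg_right h5 hr.le
  rw [inv_mul_cancel₀ hr.ne'] at h6
  have h7 : 2 ^ N * (4 / d) * r * (d / 2) = 2 * r * 2 ^ N := by field_simp; ring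
  nlinarith

lemma lowerC_nonneg {m : ℕ} {lam T : ℝ} (hlam : 0 < lam) (hT : 0 < T) : 0 ≤ lowerC m lam T := by
  unfold lowerC; positivity

lemma le_lowerC_sq {m : ℕ} {lam T : ℝ} (hlam : 0 < lam) (hT : 0 < T) (hT1 : T ≤ 1) :
    4 * (m / lam) ^ m ≤ lowerC m lam T ^ 2 * (T / 2) ^ m := by
  unfold lowerC
  set c := 4 * (m / lam) ^ m
  have hc : 0 ≤ c := by positivity
  have h1 : 1 ≤ (2 : ℝ) ^ m := one_le_pow₀ (by norm_num)
  have h2 : T ^ m ≤ 1 := pow_le_one₀ hT.le hT1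
  have e : ((c + 1) * 2 ^ m / T ^ m) ^ 2 * (T / 2) ^ m = (c + 1) ^ 2 * (2 ^ m / T ^ m) := by
    rw [div_pow T]; field_simp
  rw [e]
  have h3 : 1 ≤ 2 ^ m / T ^ m := by rw [le_div_iff₀ (by positivity)]; linarith
  calc c ≤ (c + 1) ^ 2 * 1 := by nlinarith
    _ ≤ _ := by gcongr

/-- Optimizing the slope in the dyadic estimate yields a logarithmic modulus. -/
lemma exists_log_bound {C B d : ℝ} (k m : ℕ) (hk : 0 < k) (hC : 0 ≤ C) (hB : 0 ≤ B) (hd : 0 < d)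
    (hd1 : d ≤ 1) :
    ∃ C' : ℝ, ∀ T r X : ℝ, 0 < T → T ≤ 1 → 0 < r → r ≤ 1 / 2 → X ≤ B / T ^ m →
      (∀ a, 0 < a → a ≤ 1 → ∃ N : ℕ, N * (a * T) ^ k ≤ C ∧ (2 * r ≤ d / 2 / 2 ^ N → X ≤ 4 * a)) →
      X ≤ C' * |Real.log r| ^ (-(1 / k : ℝ)) * T ^ (-(m + 1 : ℝ)) := by
  have hk' : (0 : ℝ) < k := by exact_mod_cast hk
  set A : ℝ := (2 * (C + 1)) ^ (1 / k : ℝ) with hA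
  have hA0 : 0 < A := by positivity
  have hAk : A ^ k = 2 * (C + 1) := by
    rw [hA, ← Real.rpow_natCast, ← Real.rpow_mul (by positivity), one_div,
      inv_mul_cancel₀ hk'.ne', Real.rpow_one]
  set H : ℝ := 2 * Real.log (4 / d) with hH
  have hH0 : 0 < H := by
    have : 0 < Real.log (4 / d) := Real.log_pos (by rw [lt_div_iff₀ hd]; linarith)
    positivity
  refine ⟨4 * A + B * A + B * H ^ (1 / k : ℝ), fun T r X hT hT1 hr hr2 hX hN => ?_⟩
  have hlog : Real.log r < 0 := Real.log_neg hr (by linarith)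
  rw [abs_of_neg hlog]
  set l := -Real.log r with hl
  have hl0 : 0 < l := by linarith
  set q : ℝ := l ^ (-(1 / k : ℝ)) with hq
  have hq0 : 0 < q := by positivity
  have hqk : q ^ k * l = 1 := by
    rw [hq, ← Real.rpow_natCast, ← Real.rpow_mul hl0.le, neg_mul, one_div,
      inv_mul_cancel₀ hk'.ne', Real.rpow_neg_one, inv_mul_cancel₀ hl0.ne']
  have hTm : T ^ (-(m + 1 : ℝ)) = (T ^ m)⁻¹ * T⁻¹ := by
    rw [Real.rpow_neg hT.le, Real.rpow_add_one hT.ne', Real.rpow_natCast, mul_inv]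
  rw [hTm]
  have hT' : 1 ≤ T⁻¹ := (one_le_inv₀ hT).2 hT1
  have hTm' : 1 ≤ (T ^ m)⁻¹ := (one_le_inv₀ (by positivity)).2 (pow_le_one₀ hT.le hT1)
  set τ := (T ^ m)⁻¹ with hτ
  rw [div_eq_mul_inv, ← hτ] at hX
  have e : (4 * A + B * A + B * H ^ (1 / k : ℝ)) * q * (τ * T⁻¹) =
      4 * (A * T⁻¹ * q) * τ + B * τ * (A * T⁻¹ * q) + B * τ * (H ^ (1 / k : ℝ) * q) * T⁻¹ := by
    ring
  rw [e]
  have n1 : 0 ≤ 4 * (A * T⁻¹ * q) * τ := by positivity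
  have n2 : 0 ≤ B * τ * (A * T⁻¹ * q) := by positivity
  have n3 : 0 ≤ B * τ * (H ^ (1 / k : ℝ) * q) * T⁻¹ := by positivity
  rcases le_or_gt H l with hHl | hHl
  · rcases le_or_gt (A * T⁻¹ * q) 1 with ha | ha
    · obtain ⟨N, hN1, hN2⟩ := hN (A * T⁻¹ * q) (by positivity) ha
      have e2 : (A * T⁻¹ * q * T) ^ k = 2 * (C + 1) * q ^ k := by
        rw [show A * T⁻¹ * q * T = A * q by field_simp, mul_pow, hAk]
      rw [e2] at hN1
      have hNl : (N : ℝ) ≤ l / 2 := by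
        have h1 := mul_le_mul_of_nonneg_right hN1 hl0.le
        have h2 : (N : ℝ) * (2 * (C + 1) * q ^ k) * l = (N * 2) * (C + 1) := by
          linear_combination (N : ℝ) * (2 * (C + 1)) * hqk
        rw [h2] at h1
        have h3 : (N : ℝ) * 2 * (C + 1) ≤ l * (C + 1) := by linarith
        have := le_of_mul_le_mul_right h3 (by linarith)
        linarith
      have h4 := hN2 (two_mul_le_dyadic hr hd hHl hNl)
      have h5 : 4 * (A * T⁻¹ * q) ≤ 4 * (A * T⁻¹ * q) * τ :=
        le_mul_of_one_le_right (by positivity) hTm'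
      linarith
    · have h5 : B * τ ≤ B * τ * (A * T⁻¹ * q) := le_mul_of_one_le_right (by positivity) ha.le
      linarith
  · have h1 : 1 ≤ H ^ (1 / k : ℝ) * q := by
      have : l ^ (1 / k : ℝ) * q = 1 := by
        rw [hq, ← Real.rpow_add hl0]; simp
      calc 1 = l ^ (1 / k : ℝ) * q := this.symm
        _ ≤ _ := by gcongr
    have h5 : B * τ ≤ B * τ * (H ^ (1 / k : ℝ) * q) * T⁻¹ := by
      calc B * τ ≤ B * τ * (H ^ (1 / k : ℝ) * q) := le_mul_of_one_le_right (by positivity) h1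
        _ ≤ _ := le_mul_of_one_le_right (by positivity) hT'
    linarith

/-- Subgradients at interior points are bounded by the oscillation. -/
lemma norm_subgradient_le {f : E n → ℝ} {x g : E n} {d M : ℝ} (hd : 0 < d) (hM : 0 ≤ M)
    (hfx : -M ≤ f x) (hf1 : ∀ y ∈ ball x d, f y ≤ 1)
    (hg : ∀ y ∈ ball x d, f x + ⟪g, y - x⟫ ≤ f y) : ‖g‖ ≤ 2 * (1 + M) / d := by
  refine norm_le_of_inner_le (r := d / 2) (by positivity) (by positivity) fun v hv => ?_
  have hmem : x + v ∈ ball x d := by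
    rw [mem_ball, dist_eq_norm, add_sub_cancel_left, hv]; linarith
  have h1 := hg _ hmem
  have h2 := hf1 _ hmem
  rw [add_sub_cancel_left] at h1
  have : 2 * (1 + M) / d * (d / 2) = 1 + M := by field_simp
  rw [this]; linarith

/-- The logarithmic modulus of continuity of the gradient at points that are `d`-deep in the
unit sublevel set. -/
lemma exists_gradient_modulus (n m : ℕ) {lam Lam d : ℝ} (hm : 0 < m) (hlam : 0 < lam)
    (hLam : 0 < Lam) (hd : 0 < d) (hd1 : d ≤ 1) :
    ∃ C : ℝ, ∀ (p T : ℝ) (Ω : Set (E n)) (y₀ : E n) (u : E n → ℝ → ℝ), T ≤ 1 →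
      Setup m lam Lam p (lowerC m lam T) (d / 16) T Ω y₀ u → (0 : E n) ∈ Ω → u 0 0 = 0 →
      ∀ x, ball x d ⊆ {x ∈ Ω | u x 0 < 1} → DifferentiableAt ℝ (fun y => u y 0) x ∧
      ∀ y, ball y d ⊆ {x ∈ Ω | u x 0 < 1} → 0 < ‖x - y‖ → ‖x - y‖ ≤ 1 / 2 →
      ‖gradient (fun z => u z 0) x - gradient (fun z => u z 0) y‖ ≤
        C * |Real.log ‖x - y‖| ^ (-(1 / finalExp n m : ℝ)) * T ^ (-(m + 1 : ℝ)) := by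
  obtain ⟨C, hC, hscale⟩ := exists_scale n m hm hlam hLam hd hd1
  obtain ⟨C', hC'⟩ := exists_log_bound (C := C)
    (B := 4 * (1 + (4 * (m / lam) ^ m + 1) * 2 ^ m) / d) (d := d) (finalExp n m) m
    (by unfold finalExp paramExp; positivity) hC (by positivity) hd hd1
  refine ⟨C', fun p T Ω y₀ u hT1 S h0 hu0 => ?_⟩
  have hT := S.hT
  have h0I : (0 : ℝ) ∈ Icc (-T) 0 := ⟨by linarith, le_rfl⟩
  set f : E n → ℝ := fun y => u y 0 with hf
  have hcv : ConvexOn ℝ (closure Ω) f := S.reg.conv 0 h0I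
  have hcont : ContinuousOn f (closure Ω) := S.reg.continuousOn_slice h0I
  have hb {x y : E n} {s r : ℝ} (hy : dist y x ≤ r) (hr : r < s) : y ∈ ball x s :=
    mem_ball.2 (hy.trans_lt hr)
  have hsub {x : E n} (hx : ball x d ⊆ {x ∈ Ω | u x 0 < 1}) : ball x d ⊆ closure Ω :=
    fun y hy => subset_closure (hx hy).1
  have hN (a : ℝ) (ha : 0 < a) (ha1 : a ≤ 1) : ∃ N : ℕ, N * (a * T) ^ finalExp n m ≤ C ∧
      ∀ x, ball x d ⊆ {x ∈ Ω | u x 0 < 1} → ∀ e : E n, ‖e‖ = 1 →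
      secondDiff f x e (d / 2 / 2 ^ N) < 2 * a * (d / 2 / 2 ^ N) := by
    obtain ⟨N, hN1, hN2⟩ := hscale p T Ω y₀ u hT1 S a ha ha1
    refine ⟨N, hN1, fun x hx => ?_⟩
    have hxΩ : x ∈ Ω := (hx (mem_ball_self hd)).1
    have hball (g : E n) (hg : ‖g‖ ≤ d / 2) : x + g ∈ closure Ω ∧ f (x + g) ≤ 1 := by
      have hmem : x + g ∈ ball x d :=
        hb (r := d / 2) (by rwa [dist_eq_norm, add_sub_cancel_left]) (by linarith)
      exact ⟨hsub hx hmem, (hx hmem).2.le⟩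
    have hx2 : ‖x‖ ≤ 2 := by
      have h1 := mem_ball.1 (S.subset_ball hxΩ)
      have h2 := mem_ball'.1 (S.subset_ball h0)
      rw [← dist_zero_right]
      linarith [dist_triangle x y₀ 0]
    exact hN2 x hxΩ (hcv.le_one_sub_of_ball (subset_closure h0) hu0 hx2 hd hd1 hball) hball
  have hr0 (N : ℕ) : 0 < d / 2 / 2 ^ N := by positivity
  have hrd (N : ℕ) : d / 2 / 2 ^ N < d :=
    (div_le_self (by positivity) (one_le_pow₀ (by norm_num))).trans_lt (by linarith)
  have hgrad {x : E n} (hx : ball x d ⊆ {x ∈ Ω | u x 0 < 1}) :=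
    exists_hasGradientAt hd (hcv.subset (hsub hx) (convex_ball x d)) (hcont.mono (hsub hx))
      fun a ha ha1 => (hN a ha ha1).elim fun N h => ⟨_, hr0 N, hrd N, h.2 x hx⟩
  have hbound {x g : E n} (hx : ball x d ⊆ {x ∈ Ω | u x 0 < 1})
      (hg : ∀ y ∈ ball x d, f x + ⟪g, y - x⟫ ≤ f y) : ‖g‖ ≤ 2 * (1 + lowerC m lam T) / d :=
    norm_subgradient_le hd S.M₀_nonneg
      (S.neg_M₀_le (hsub hx (mem_ball_self hd)) (by linarith) le_rfl)
      (fun y hy => (hx hy).2.le) hg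
  intro x hx
  obtain ⟨g, hg, hgx, hmod⟩ := hgrad hx
  refine ⟨hg.differentiableAt, fun y hy hxy hxy2 => ?_⟩
  obtain ⟨g', hg', hgy, -⟩ := hgrad hy
  rw [hg.gradient, hg'.gradient]
  refine hC' T ‖x - y‖ _ hT hT1 hxy hxy2 ?_ fun a ha ha1 => ?_
  · have hTm : T ^ m ≤ 1 := pow_le_one₀ hT.le hT1
    have h1 : 1 + lowerC m lam T ≤ (1 + (4 * (m / lam) ^ m + 1) * 2 ^ m) / T ^ m := by
      rw [add_div, lowerC]
      gcongr
      exact (one_le_div₀ (by positivity)).2 hTm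
    calc _ ≤ ‖g‖ + ‖g'‖ := norm_sub_le _ _
      _ ≤ 2 * (1 + lowerC m lam T) / d + 2 * (1 + lowerC m lam T) / d :=
        add_le_add (hbound hx hgx) (hbound hy hgy)
      _ = 4 * (1 + lowerC m lam T) / d := by ring
      _ ≤ 4 * ((1 + (4 * (m / lam) ^ m + 1) * 2 ^ m) / T ^ m) / d := by gcongr
      _ = _ := by ring
  · obtain ⟨N, hN1, hN2⟩ := hN a ha ha1
    refine ⟨N, hN1, fun hr => ?_⟩
    have hlt : ‖x - y‖ < d := by linarith [hrd N]
    refine norm_subgradient_sub_le hxy ha.le (norm_sub_rev _ _).le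
      (mem_ball'.2 (by rwa [dist_eq_norm])) hgx (fun v hv => ?_) fun v hv =>
      hmod a _ (hr0 N) (hrd N) (hN2 x hx) v (hv.trans hr)
    have := hgy (y + v) (hb (by rw [dist_eq_norm, add_sub_cancel_left, hv]) hlt)
    rwa [add_sub_cancel_left] at this

/-- Theorem 8.2: logarithmic modulus of continuity of the gradient for the
critical exponent `p = 1/(n-2)`. -/
theorem stmt2 (n : ℕ) (hn : 3 ≤ n) (p lam Lam : ℝ)
    (hp : 0 < p) (hp2 : p = 1 / ((n : ℝ) - 2)) (hlam : 0 < lam) (hll : lam ≤ Lam) :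
    ∃ α γ : ℝ, 0 < α ∧ 0 < γ ∧ ∃ C : ℝ → ℝ,
      ∀ (Ω : Set (E n)) (T : ℝ) (y₀ : E n) (u : E n → ℝ → ℝ),
        IsOpen Ω → Convex ℝ Ω → Ω ⊆ ball y₀ 1 →
        0 < T → T ≤ 1 →
        ViscositySolution lam Lam p Ω (-T) 0 u →
        (∀ x ∈ frontier Ω, ∀ t ∈ Icc (-T) 0, 1 < u x t) →
        (0 : E n) ∈ Ω → u 0 0 = 0 →
        ∀ K : Set (E n), IsCompact K → K ⊆ {x ∈ Ω | u x 0 < 1} →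
          (∀ x ∈ K, DifferentiableAt ℝ (fun y => u y 0) x) ∧
          (∀ x ∈ K, ∀ y ∈ K, 0 < ‖x - y‖ → ‖x - y‖ ≤ 1/2 →
            ‖gradient (fun z => u z 0) x - gradient (fun z => u z 0) y‖ ≤
              C (setDist K (frontier {x ∈ Ω | u x 0 < 1})) *
                |Real.log ‖x - y‖| ^ (-α) * T ^ (-γ)) := by
  obtain ⟨m, rfl⟩ : ∃ m, m + 2 = n := ⟨n - 2, by omega⟩
  have hm : 0 < m := by omega
  have hpm : p = (m : ℝ)⁻¹ := by rw [hp2]; push_cast; rw [add_sub_cancel_right, one_div]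
  have hLam : 0 < Lam := hlam.trans_le hll
  choose! C hC using fun (d : ℝ) (h : 0 < d ∧ d ≤ 1) =>
    exists_gradient_modulus (m + 2) m (d := d) hm hlam hLam h.1 h.2
  refine ⟨1 / finalExp (m + 2) m, m + 1, by unfold finalExp paramExp; positivity, by positivity,
    fun D => C (min D 1), fun Ω T y₀ u hΩ hconv hΩb hT hT1 hu h1 h0 hu0 K hK hKU => ?_⟩
  have h0I : (0 : ℝ) ∈ Icc (-T) 0 := ⟨by linarith, le_rfl⟩
  have hU : IsOpen {x ∈ Ω | u x 0 < 1} :=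
    ((hu.1.continuousOn_slice h0I).mono subset_closure).isOpen_inter_preimage hΩ isOpen_Iio
  have hUb : Bornology.IsBounded {x ∈ Ω | u x 0 < 1} :=
    isBounded_ball.subset ((sep_subset _ _).trans hΩb)
  set D := setDist K (frontier {x ∈ Ω | u x 0 < 1})
  have key {x : E (m + 2)} (hx : x ∈ K) :
      (0 < min D 1 ∧ min D 1 ≤ 1) ∧ ball x (min D 1) ⊆ {x ∈ Ω | u x 0 < 1} :=
    ⟨⟨lt_min (setDist_frontier_pos hU hUb hK ⟨x, hx⟩ hKU) one_pos, min_le_right _ _⟩,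
      (ball_subset_ball (min_le_left _ _)).trans (ball_setDist_frontier_subset hU hKU hx)⟩
  have setup {d : ℝ} (hd : 0 < d ∧ d ≤ 1) :
      Setup m lam Lam p (lowerC m lam T) (d / 16) T Ω y₀ u :=
    { hnm := rfl, hm := hm, hp := hpm, hlam := hlam, hLam := hLam, isOpen := hΩ, convex := hconv,
      subset_ball := hΩb, hT := hT, reg := hu.1, sub := hu.2.1, sup := hu.2.2, one_lt := h1,
      M₀_nonneg := lowerC_nonneg hlam hT, κ_pos := by linarith [hd.1], κ_le := by linarith [hd.2],
      hM₀ := le_lowerC_sq hlam hT hT1 }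
  have main {x : E (m + 2)} (hx : x ∈ K) :=
    hC _ (key hx).1 p T Ω y₀ u hT1 (setup (key hx).1) h0 hu0 x (key hx).2
  exact ⟨fun x hx => (main hx).1, fun x hx y hy => (main hx).2 y (key hy).2⟩
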